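/- For all α, d₀ > 0 there exist η > 0 and n₀ ∈ ℕ such that the following holds for all n ≥ n₀ and all d ≥ d₀: if G is an n-vertex (η,d)-quasirandom graph and φ is an edge-colouring of G that is (1+η)dn/2-bounded and locally ηn-bounded, then G has an α-decomposition into rainbow α-spanning cycles. -/

import Mathlib

namespace Paper

variable {V : Type*} {W : Type*} {C : Type*}

/-- The set of edges of `G` receiving colour `c` under `φ`. -/
def colourCls (G : SimpleGraph V) (φ : Sym2 V → C) (c : C) : Set (Sym2 V) :=
  {e | e ∈ G.edgeSet ∧ φ e = c}

/-- `φ` is a (globally) `g`-bounded edge-colouring of `G`: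
every colour is used on at most `g` edges. -/
def GBounded (G : SimpleGraph V) (φ : Sym2 V → C) (g : ℝ) : Prop :=
  ∀ c : C, ((colourCls G φ c).ncard : ℝ) ≤ g

/-- `φ` is a locally `l`-bounded edge-colouring of `G`:
every vertex is incident to at most `l` edges of each colour. -/
def LBounded (G : SimpleGraph V) (φ : Sym2 V → C) (l : ℝ) : Prop :=
  ∀ (v : V) (c : C), (({u | G.Adj v u ∧ φ s(v, u) = c}).ncard : ℝ) ≤ l

/-- A set of edges is rainbow if the colouring is injective on it. -/
def Rainbow (φ : Sym2 V → C) (E : Set (Sym2 V)) : Prop :=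
  Set.InjOn φ E

/-- The set of common neighbours `w` of `u` and `v` with `φ(uw) = φ(vw)`. -/
def monoSet (G : SimpleGraph V) (φ : Sym2 V → C) (u v : V) : Set V :=
  {w | G.Adj u w ∧ G.Adj v w ∧ φ s(u, w) = φ s(v, w)}

/-- The monochromatic codegree `c^φ_G(u,v)`. -/
noncomputable def monoCodeg (G : SimpleGraph V) (φ : Sym2 V → C) (u v : V) : ℕ :=
  (monoSet G φ u v).ncard

/-- Degree of `u` into the set `S`. -/
noncomputable def degIn (G : SimpleGraph V) (u : V) (S : Set V) : ℕ :=
  (G.neighborSet u ∩ S).ncard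

/-- Codegree of `u,v` into the set `S`. -/
noncomputable def codegIn (G : SimpleGraph V) (u v : V) (S : Set V) : ℕ :=
  (G.neighborSet u ∩ G.neighborSet v ∩ S).ncard

/-- `G` restricted to `S` is `(ε,d)`-quasirandom: all degrees (within `S`)
are `(d ± ε)|S|` and all but at most `ε|S|²` unordered pairs of distinct
vertices of `S` have codegree (within `S`) equal to `(d² ± ε)|S|`. -/
def QuasirandomOn (G : SimpleGraph V) (S : Set V) (ε d : ℝ) : Prop :=
  (∀ v ∈ S, |(degIn G v S : ℝ) - d * S.ncard| ≤ ε * S.ncard) ∧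
  ((({p : Sym2 V | ∃ u v, p = s(u, v) ∧ u ≠ v ∧ u ∈ S ∧ v ∈ S ∧
        ¬ (|(codegIn G u v S : ℝ) - d ^ 2 * S.ncard| ≤ ε * S.ncard)}).ncard : ℝ)
      ≤ ε * (S.ncard : ℝ) ^ 2)

/-- `G` is `(ε,d)`-quasirandom. -/
def Quasirandom (G : SimpleGraph V) (ε d : ℝ) : Prop :=
  QuasirandomOn G Set.univ ε d

/-- Edges of `G` with one endpoint in `X` and the other in `Y`. -/
def edgesBetween (G : SimpleGraph V) (X Y : Set V) : Set (Sym2 V) :=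
  {e | e ∈ G.edgeSet ∧ ∃ u v, e = s(u, v) ∧ u ∈ X ∧ v ∈ Y}

/-- The pair `(A,B)` is `(ε,d)`-regular in `G`. -/
def RegularPair (G : SimpleGraph V) (A B : Set V) (ε d : ℝ) : Prop :=
  ∀ X ⊆ A, ∀ Y ⊆ B, ε * A.ncard ≤ (X.ncard : ℝ) → ε * B.ncard ≤ (Y.ncard : ℝ) →
    |((edgesBetween G X Y).ncard : ℝ) / ((X.ncard : ℝ) * (Y.ncard : ℝ)) - d| ≤ ε

/-- The pair `(A,B)` is `(ε,d)`-superregular in `G`. -/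
def SuperregularPair (G : SimpleGraph V) (A B : Set V) (ε d : ℝ) : Prop :=
  RegularPair G A B ε d ∧
  (∀ u ∈ A, |(degIn G u B : ℝ) - d * B.ncard| ≤ ε * B.ncard) ∧
  (∀ v ∈ B, |(degIn G v A : ℝ) - d * A.ncard| ≤ ε * A.ncard)

/-- `H` is a copy of `F`: a subgraph of `G` isomorphic to `F`. -/
def IsCopy (F : SimpleGraph W) {G : SimpleGraph V} (H : G.Subgraph) : Prop :=
  Nonempty (F ≃g H.coe)

/-- `L` is the union of the family `𝒞` of pairwise vertex-disjoint copies of `F`. -/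
def IsFactorFrom (F : SimpleGraph W) {G : SimpleGraph V} (L : G.Subgraph)
    (𝒞 : Set G.Subgraph) : Prop :=
  (∀ H ∈ 𝒞, IsCopy F H) ∧
  𝒞.Pairwise (fun H₁ H₂ => Disjoint H₁.verts H₂.verts) ∧
  L = sSup 𝒞

/-- `L` consists of vertex-disjoint copies of `F`. -/
def IsFFactorSub (F : SimpleGraph W) {G : SimpleGraph V} (L : G.Subgraph) : Prop :=
  ∃ 𝒞 : Set G.Subgraph, IsFactorFrom F L 𝒞

/-- An `ε`-decomposition: pairwise edge-disjoint subgraphs of `G` which together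
contain all but at most an `ε`-proportion of the edges of `G`. -/
def ApxDecomp (G : SimpleGraph V) (ε : ℝ) {t : ℕ} (L : Fin t → G.Subgraph) : Prop :=
  (Pairwise fun i j => Disjoint (L i).edgeSet (L j).edgeSet) ∧
  ((G.edgeSet \ ⋃ i, (L i).edgeSet).ncard : ℝ) ≤ ε * (G.edgeSet.ncard : ℝ)

/-- `a(F) ≤ a`, where `a(F) = max {Δ(F), a'(F), a''(F)}`. -/
def AParamLe (F : SimpleGraph W) (a : ℕ) : Prop :=
  (∀ v, (F.neighborSet v).ncard ≤ a) ∧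
  (∀ u v, F.Adj u v →
    (F.neighborSet u).ncard + (F.neighborSet v).ncard - 2 ≤ a) ∧
  (∀ u v w, F.Adj u v → F.Adj v w → u ≠ w →
    (F.neighborSet u).ncard + (F.neighborSet v).ncard + (F.neighborSet w).ncard - 4 ≤ a)

end Paper

open Paper

namespace RainbowCycles

open Finset
open scoped Classical

section Nibble
variable {ι X μ : Type*}

/-- The number of hyperedges in `F` containing `x`. -/
noncomputable def hdeg (F : Finset ι) (s : ι → Finset X) (x : X) : ℕ :=
  (F.filter fun e => x ∈ s e).card

/-- The number of hyperedges in `F` containing both `x` and `y`. -/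
noncomputable def hcodeg (F : Finset ι) (s : ι → Finset X) (x y : X) : ℕ :=
  (F.filter fun e => x ∈ s e ∧ y ∈ s e).card

/-- The hyperedges in `F` avoiding the vertex set `S`. -/
noncomputable def avoiding (F : Finset ι) (s : ι → Finset X) (S : Finset X) : Finset ι :=
  F.filter fun e => Disjoint (s e) S

/-- The maximum size of a matching in `F`. -/
noncomputable def matchNum (F : Finset ι) (s : ι → Finset X) : ℕ :=
  (F.powerset.filter fun M : Finset ι => (M : Set ι).PairwiseDisjoint s).sup Finset.card

lemma exists_matchNum (F : Finset ι) (s : ι → Finset X) :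
    ∃ M ⊆ F, (M : Set ι).PairwiseDisjoint s ∧ M.card = matchNum F s := by
  have hne : (F.powerset.filter fun M : Finset ι => (M : Set ι).PairwiseDisjoint s).Nonempty :=
    ⟨∅, by simp⟩
  obtain ⟨M, hM, h⟩ := Finset.exists_mem_eq_sup _ hne Finset.card
  simp only [mem_filter, mem_powerset] at hM
  exact ⟨M, hM.1, hM.2, h.symm⟩

lemma card_le_matchNum {F M : Finset ι} {s : ι → Finset X} (h : M ⊆ F)
    (hM : (M : Set ι).PairwiseDisjoint s) : M.card ≤ matchNum F s :=
  Finset.le_sup (f := Finset.card) (by simp [h, hM])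

lemma matchNum_mono {F F' : Finset ι} (s : ι → Finset X) (h : F ⊆ F') :
    matchNum F s ≤ matchNum F' s := by
  obtain ⟨M, hM, hd, hc⟩ := exists_matchNum F s
  exact hc ▸ card_le_matchNum (hM.trans h) hd

lemma matchNum_avoiding_le (F : Finset ι) (s : ι → Finset X) (S : Finset X) :
    matchNum (avoiding F s S) s ≤ matchNum F s :=
  matchNum_mono s (filter_subset _ _)

lemma matchNum_avoiding_add_one_le {F : Finset ι} {s : ι → Finset X} {e : ι} (he : e ∈ F)
    (hs : (s e).Nonempty) : matchNum (avoiding F s (s e)) s + 1 ≤ matchNum F s := by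
  obtain ⟨M, hM, hd, hc⟩ := exists_matchNum (avoiding F s (s e)) s
  have hdis : ∀ f ∈ M, Disjoint (s f) (s e) := fun f hf => (mem_filter.1 (hM hf)).2
  have heM : e ∉ M := fun h => by
    have := hdis e h
    rw [disjoint_self_iff_empty] at this
    simp [this] at hs
  rw [← hc, ← card_insert_of_notMem heM]
  apply card_le_matchNum
  · exact insert_subset he (hM.trans (filter_subset _ _))
  · rw [coe_insert]
    apply hd.insert
    intro f hf _
    exact (hdis f hf).symm

lemma card_avoiding_ge (F : Finset ι) (s : ι → Finset X) (S : Finset X) :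
    (F.card : ℝ) - ∑ f ∈ F, ∑ x ∈ s f, (if x ∈ S then (1 : ℝ) else 0)
      ≤ ((avoiding F s S).card : ℝ) := by
  have h1 : ((avoiding F s S).card : ℝ) = ∑ f ∈ F, (if Disjoint (s f) S then (1 : ℝ) else 0) := by
    simp [avoiding]
  have h2 : (F.card : ℝ) = ∑ f ∈ F, (1 : ℝ) := by simp
  rw [h1, h2, ← sum_sub_distrib]
  apply sum_le_sum
  intro f _
  split_ifs with h
  · have : 0 ≤ ∑ x ∈ s f, (if x ∈ S then (1 : ℝ) else 0) :=
      sum_nonneg fun x _ => by split_ifs <;> norm_num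
    linarith
  · rw [Finset.not_disjoint_iff] at h
    obtain ⟨x, hx, hxS⟩ := h
    have : (if x ∈ S then (1 : ℝ) else 0) ≤ ∑ x ∈ s f, (if x ∈ S then (1 : ℝ) else 0) :=
      single_le_sum (f := fun x => if x ∈ S then (1 : ℝ) else 0)
        (fun x _ => by split_ifs <;> norm_num) hx
    simp only [hxS, if_true] at this
    linarith

/-- The number of hyperedges at `x` destroyed by deleting the set `S`, if `x` itself survives. -/
noncomputable def lossAt (F : Finset ι) (s : ι → Finset X) (x : X) (S : Finset X) : ℝ :=
  if x ∈ S then 0 else ((F.filter fun f => x ∈ s f ∧ ¬ Disjoint (s f) S).card : ℝ)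

lemma lossAt_nonneg (F : Finset ι) (s : ι → Finset X) (x : X) (S : Finset X) :
    0 ≤ lossAt F s x S := by
  unfold lossAt; split_ifs <;> positivity

lemma excess_avoiding_le (F : Finset ι) (s : ι → Finset X) (x : X) (S : Finset X) (D' : ℝ)
    (hD' : 0 ≤ D') :
    (max ((hdeg (avoiding F s S) s x : ℝ) - D') 0) ^ 2
      ≤ ((hdeg F s x : ℝ) - D' - lossAt F s x S) ^ 2 := by
  by_cases hx : x ∈ S
  · have : hdeg (avoiding F s S) s x = 0 := by
      unfold hdeg avoiding
      rw [card_eq_zero, filter_eq_empty_iff]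
      intro e he hxe
      exact (Finset.disjoint_left.1 (mem_filter.1 he).2) hxe hx
    rw [this]
    have : max (((0 : ℕ) : ℝ) - D') 0 = 0 := by
      apply max_eq_right; simp [hD']
    rw [this, zero_pow two_ne_zero]; exact sq_nonneg _
  · have key : (hdeg F s x : ℝ) = hdeg (avoiding F s S) s x + lossAt F s x S := by
      unfold lossAt hdeg avoiding
      rw [if_neg hx, filter_filter]
      norm_cast
      rw [← card_filter_add_card_filter_not (s := F.filter fun e => x ∈ s e)
        (fun e => Disjoint (s e) S), filter_filter, filter_filter]
      congr 2
      ext e; simp only [mem_filter]; tauto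
    rw [key]
    rcases le_total ((hdeg (avoiding F s S) s x : ℝ) - D') 0 with h | h
    · rw [max_eq_right h, zero_pow two_ne_zero]; exact sq_nonneg _
    · rw [max_eq_left h]
      apply le_of_eq; ring

lemma lossAt_le_sum (F : Finset ι) (s : ι → Finset X) (x : X) (S : Finset X) :
    lossAt F s x S ≤ ∑ f ∈ F.filter (fun f => x ∈ s f), ∑ z ∈ (s f).erase x,
      (if z ∈ S then (1 : ℝ) else 0) := by
  have hnn : ∀ f : ι, 0 ≤ ∑ z ∈ (s f).erase x, (if z ∈ S then (1 : ℝ) else 0) := fun f =>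
    sum_nonneg fun x _ => by split_ifs <;> norm_num
  unfold lossAt
  split_ifs with hx
  · exact sum_nonneg fun f _ => hnn f
  · have : ((F.filter fun f => x ∈ s f ∧ ¬ Disjoint (s f) S).card : ℝ)
        = ∑ f ∈ F.filter (fun f => x ∈ s f), (if Disjoint (s f) S then (0 : ℝ) else 1) := by
      rw [← filter_filter]
      simp [Finset.sum_ite]
    rw [this]
    apply sum_le_sum
    intro f hf
    split_ifs with h
    · exact hnn f
    · rw [Finset.not_disjoint_iff] at h
      obtain ⟨z, hz, hzS⟩ := h
      have hzx : z ≠ x := fun h => hx (h ▸ hzS)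
      have := single_le_sum (f := fun z => if z ∈ S then (1 : ℝ) else 0)
        (fun x _ => by split_ifs <;> norm_num) (mem_erase.2 ⟨hzx, hz⟩)
      simpa [hzS] using this

lemma le_lossAt (F : Finset ι) (s : ι → Finset X) (x : X) (S : Finset X) :
    ∑ f ∈ F.filter (fun f => x ∈ s f), ((∑ z ∈ (s f).erase x, (if z ∈ S then (1 : ℝ) else 0))
      - ∑ p ∈ (s f).offDiag, (if p.1 ∈ S ∧ p.2 ∈ S then (1 : ℝ) else 0)) ≤ lossAt F s x S := by
  have hrw : lossAt F s x S = ∑ f ∈ F.filter (fun f => x ∈ s f),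
      (if x ∈ S then 0 else if Disjoint (s f) S then (0 : ℝ) else 1) := by
    unfold lossAt
    split_ifs with hx
    · simp
    · rw [← filter_filter]
      simp [Finset.sum_ite]
  rw [hrw]
  apply sum_le_sum
  intro f hf
  have hxf : x ∈ s f := (mem_filter.1 hf).2
  have h1 : ∑ p ∈ (s f).offDiag, (if p.1 ∈ S ∧ p.2 ∈ S then (1 : ℝ) else 0)
      = (((s f ∩ S).card * (s f ∩ S).card - (s f ∩ S).card : ℕ) : ℝ) := by
    rw [← offDiag_card, Finset.sum_boole]
    congr 2
    ext ⟨a, b⟩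
    simp only [mem_filter, mem_offDiag, mem_inter]; tauto
  have h2 : ∑ z ∈ (s f).erase x, (if z ∈ S then (1 : ℝ) else 0)
      = (((s f ∩ S).erase x).card : ℝ) := by
    rw [Finset.sum_boole]
    congr 2
    ext a
    simp only [mem_filter, mem_erase, mem_inter]; tauto
  rw [h1, h2]
  set k := (s f ∩ S).card with hk
  have hkk : ((k * k - k : ℕ) : ℝ) = (k : ℝ) * k - k := by
    rw [Nat.cast_sub (Nat.le_mul_self k)]; push_cast; ring
  rw [hkk]
  split_ifs with hx hd
  · have hmem : x ∈ s f ∩ S := mem_inter.2 ⟨hxf, hx⟩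
    rw [card_erase_of_mem hmem, ← hk]
    have : 1 ≤ k := card_pos.2 ⟨x, hmem⟩
    rw [Nat.cast_sub this]
    have : (1 : ℝ) ≤ k := by exact_mod_cast this
    push_cast; nlinarith
  · have : s f ∩ S = ∅ := disjoint_iff_inter_eq_empty.1 hd
    have hk0 : k = 0 := by rw [hk, this]; simp
    simp [hk0, this]
  · have hmem : x ∉ s f ∩ S := fun h => hx (mem_inter.1 h).2
    rw [erase_eq_of_notMem hmem, ← hk]
    have : 1 ≤ k := by
      rw [hk]; apply card_pos.2
      rwa [nonempty_iff_ne_empty, ne_eq, ← disjoint_iff_inter_eq_empty]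
    have : (1 : ℝ) ≤ k := by exact_mod_cast this
    nlinarith [mul_nonneg (sub_nonneg.2 this) (sub_nonneg.2 this)]

lemma lossAt_le_mul (F : Finset ι) (s : ι → Finset X) (x : X) (S : Finset X) {K : ℝ} {r : ℕ}
    (hK : 0 ≤ K) (hS : S.card ≤ r) (hco : ∀ y, y ≠ x → (hcodeg F s x y : ℝ) ≤ K) :
    lossAt F s x S ≤ r * K := by
  unfold lossAt
  split_ifs with hx
  · positivity
  · have hsub : (F.filter fun f => x ∈ s f ∧ ¬ Disjoint (s f) S) ⊆
        S.biUnion fun y => F.filter fun f => x ∈ s f ∧ y ∈ s f := by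
      intro f hf
      simp only [mem_filter] at hf
      obtain ⟨hfF, hxf, hd⟩ := hf
      rw [Finset.not_disjoint_iff] at hd
      obtain ⟨z, hz, hzS⟩ := hd
      simp only [mem_biUnion, mem_filter]
      exact ⟨z, hzS, hfF, hxf, hz⟩
    calc ((F.filter fun f => x ∈ s f ∧ ¬ Disjoint (s f) S).card : ℝ)
        ≤ ((S.biUnion fun y => F.filter fun f => x ∈ s f ∧ y ∈ s f).card : ℝ) := by
          exact_mod_cast card_le_card hsub
      _ ≤ ∑ y ∈ S, ((F.filter fun f => x ∈ s f ∧ y ∈ s f).card : ℝ) := by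
          exact_mod_cast card_biUnion_le
      _ ≤ ∑ y ∈ S, K := sum_le_sum fun y hy => hco y (fun h => hx (h ▸ hy))
      _ = S.card * K := by simp
      _ ≤ r * K := by gcongr

end Nibble

section NibbleStep
variable {ι X μ : Type*}

lemma sum_vertices_eq (F : Finset ι) (s : ι → Finset X) (Y : Finset X)
    (hY : ∀ f ∈ F, s f ⊆ Y) (g : X → ℝ) :
    ∑ f ∈ F, ∑ x ∈ s f, g x = ∑ x ∈ Y, (hdeg F s x : ℝ) * g x := by
  have h1 : ∀ x ∈ Y, (hdeg F s x : ℝ) * g x = ∑ f ∈ F, if x ∈ s f then g x else 0 := by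
    intro x _
    rw [← sum_filter, sum_const, nsmul_eq_mul, hdeg]
  rw [sum_congr rfl h1, sum_comm]
  apply sum_congr rfl
  intro f hf
  rw [← sum_filter]
  apply sum_congr _ (fun _ _ => rfl)
  ext x
  simp only [mem_filter]
  exact ⟨fun h => ⟨hY f hf h, h⟩, fun h => h.2⟩

/-- The weight of the moves in `𝓜` whose deleted set contains `x`. -/
noncomputable def killWeight (𝓜 : Finset μ) (w : μ → ℝ) (S : μ → Finset X) (x : X) : ℝ :=
  ∑ m ∈ 𝓜, w m * (if x ∈ S m then 1 else 0)

lemma expected_card_avoiding (F : Finset ι) (s : ι → Finset X) (𝓜 : Finset μ) (w : μ → ℝ)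
    (S : μ → Finset X) (hw : ∀ m ∈ 𝓜, 0 ≤ w m) (hw1 : ∑ m ∈ 𝓜, w m = 1) (Y : Finset X)
    (hY : ∀ f ∈ F, s f ⊆ Y) :
    (F.card : ℝ) - ∑ x ∈ Y, (hdeg F s x : ℝ) * killWeight 𝓜 w S x
      ≤ ∑ m ∈ 𝓜, w m * ((avoiding F s (S m)).card : ℝ) := by
  have h : ∑ m ∈ 𝓜, w m * ((F.card : ℝ) - ∑ f ∈ F, ∑ x ∈ s f, (if x ∈ S m then (1 : ℝ) else 0))
      ≤ ∑ m ∈ 𝓜, w m * ((avoiding F s (S m)).card : ℝ) :=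
    sum_le_sum fun m hm => mul_le_mul_of_nonneg_left (card_avoiding_ge F s (S m)) (hw m hm)
  refine le_trans (le_of_eq ?_) h
  rw [← sum_vertices_eq F s Y hY]
  simp_rw [mul_sub]
  rw [sum_sub_distrib, ← sum_mul, hw1, one_mul]
  congr 1
  simp_rw [killWeight, mul_sum]
  conv_rhs => rw [sum_comm]
  apply sum_congr rfl
  intro f _
  rw [sum_comm]

lemma expected_loss_bounds (F : Finset ι) (s : ι → Finset X) (𝓜 : Finset μ) (w : μ → ℝ)
    (S : μ → Finset X) (hw : ∀ m ∈ 𝓜, 0 ≤ w m) {r : ℕ} (hr : 1 ≤ r)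
    (hs : ∀ f ∈ F, (s f).card = r) {θ P κ : ℝ} (hκ : 0 ≤ κ) (hP0 : 0 ≤ P)
    (hθ : ∀ f ∈ F, ∀ x ∈ s f, θ ≤ killWeight 𝓜 w S x)
    (hP : ∀ f ∈ F, ∀ x ∈ s f, killWeight 𝓜 w S x ≤ P)
    (hpair : ∀ x y, x ≠ y →
      ∑ m ∈ 𝓜, w m * (if x ∈ S m ∧ y ∈ S m then (1 : ℝ) else 0) ≤ κ) (x : X) :
    (hdeg F s x : ℝ) * ((r - 1) * θ - r ^ 2 * κ) ≤ ∑ m ∈ 𝓜, w m * lossAt F s x (S m) ∧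
    ∑ m ∈ 𝓜, w m * lossAt F s x (S m) ≤ hdeg F s x * (r * P) := by
  have hr1 : (1 : ℝ) ≤ r := by exact_mod_cast hr
  constructor
  · have h : ∑ m ∈ 𝓜, w m * (∑ f ∈ F.filter (fun f => x ∈ s f),
        ((∑ z ∈ (s f).erase x, (if z ∈ S m then (1 : ℝ) else 0))
        - ∑ p ∈ (s f).offDiag, (if p.1 ∈ S m ∧ p.2 ∈ S m then (1 : ℝ) else 0)))
        ≤ ∑ m ∈ 𝓜, w m * lossAt F s x (S m) :=
      sum_le_sum fun m hm => mul_le_mul_of_nonneg_left (le_lossAt F s x (S m)) (hw m hm)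
    refine le_trans ?_ h
    simp_rw [mul_sum]
    rw [sum_comm]
    rw [hdeg, ← nsmul_eq_mul]
    apply card_nsmul_le_sum
    intro f hf
    obtain ⟨hfF, hxf⟩ := mem_filter.1 hf
    simp_rw [mul_sub]
    rw [sum_sub_distrib]
    have e1 : ((r : ℝ) - 1) * θ ≤ ∑ m ∈ 𝓜, w m * ∑ z ∈ (s f).erase x,
        (if z ∈ S m then (1 : ℝ) else 0) := by
      simp_rw [mul_sum]
      rw [sum_comm]
      have hc : ((r : ℝ) - 1) * θ = ((s f).erase x).card • θ := by
        rw [card_erase_of_mem hxf, hs f hfF, nsmul_eq_mul, Nat.cast_sub hr]; simp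
      rw [hc]
      apply card_nsmul_le_sum
      intro z hz
      exact hθ f hfF z (mem_of_mem_erase hz)
    have e2 : ∑ m ∈ 𝓜, w m * ∑ p ∈ (s f).offDiag,
        (if p.1 ∈ S m ∧ p.2 ∈ S m then (1 : ℝ) else 0) ≤ r ^ 2 * κ := by
      simp_rw [mul_sum]
      rw [sum_comm]
      calc _ ≤ (s f).offDiag.card • κ := by
            apply sum_le_card_nsmul
            intro p hp
            exact hpair _ _ (mem_offDiag.1 hp).2.2
        _ ≤ r ^ 2 * κ := by
            rw [nsmul_eq_mul]
            gcongr
            rw [offDiag_card, hs f hfF]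
            have : ((r * r - r : ℕ) : ℝ) ≤ ((r * r : ℕ) : ℝ) := by
              exact_mod_cast Nat.sub_le _ _
            refine this.trans (le_of_eq ?_)
            push_cast; ring
    linarith
  · have h : ∑ m ∈ 𝓜, w m * lossAt F s x (S m) ≤
        ∑ m ∈ 𝓜, w m * (∑ f ∈ F.filter (fun f => x ∈ s f),
        (∑ z ∈ (s f).erase x, (if z ∈ S m then (1 : ℝ) else 0))) :=
      sum_le_sum fun m hm => mul_le_mul_of_nonneg_left (lossAt_le_sum F s x (S m)) (hw m hm)
    refine h.trans ?_
    simp_rw [mul_sum]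
    rw [sum_comm]
    rw [hdeg, ← nsmul_eq_mul]
    apply sum_le_card_nsmul
    intro f hf
    obtain ⟨hfF, hxf⟩ := mem_filter.1 hf
    rw [sum_comm]
    calc _ ≤ ((s f).erase x).card • P := by
            apply sum_le_card_nsmul
            intro z hz
            exact hP f hfF z (mem_of_mem_erase hz)
      _ ≤ r * P := by
          rw [nsmul_eq_mul]
          gcongr
          exact_mod_cast (card_erase_le.trans (hs f hfF).le)

lemma expected_excess (F : Finset ι) (s : ι → Finset X) (𝓜 : Finset μ) (w : μ → ℝ)
    (S : μ → Finset X) (hw : ∀ m ∈ 𝓜, 0 ≤ w m) (hw1 : ∑ m ∈ 𝓜, w m = 1) {r : ℕ} (hr : 1 ≤ r)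
    (hs : ∀ f ∈ F, (s f).card = r) {θ P κ K : ℝ} (hκ : 0 ≤ κ) (hP0 : 0 ≤ P) (hK : 0 ≤ K)
    (hθ : ∀ f ∈ F, ∀ x ∈ s f, θ ≤ killWeight 𝓜 w S x)
    (hP : ∀ f ∈ F, ∀ x ∈ s f, killWeight 𝓜 w S x ≤ P)
    (hpair : ∀ x y, x ≠ y →
      ∑ m ∈ 𝓜, w m * (if x ∈ S m ∧ y ∈ S m then (1 : ℝ) else 0) ≤ κ)
    (hS : ∀ m ∈ 𝓜, (S m).card ≤ r) (hco : ∀ x y, y ≠ x → (hcodeg F s x y : ℝ) ≤ K)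
    (x : X) {D' : ℝ} (hD' : 0 ≤ D') (hu : D' ≤ hdeg F s x) :
    ∑ m ∈ 𝓜, w m * (max ((hdeg (avoiding F s (S m)) s x : ℝ) - D') 0) ^ 2
      ≤ (hdeg F s x - D') ^ 2
        - 2 * (hdeg F s x - D') * (hdeg F s x * ((r - 1) * θ - r ^ 2 * κ))
        + r * K * (hdeg F s x * (r * P)) := by
  obtain ⟨h1, h2⟩ := expected_loss_bounds F s 𝓜 w S hw hr hs hκ hP0 hθ hP hpair x
  set u := (hdeg F s x : ℝ) - D' with hudef
  have hu0 : 0 ≤ u := by rw [hudef]; linarith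
  have hb : ∀ m ∈ 𝓜, w m * (max ((hdeg (avoiding F s (S m)) s x : ℝ) - D') 0) ^ 2
      ≤ w m * u ^ 2 - 2 * u * (w m * lossAt F s x (S m))
        + r * K * (w m * lossAt F s x (S m)) := by
    intro m hm
    have e1 := excess_avoiding_le F s x (S m) D' hD'
    have e2 := lossAt_le_mul F s x (S m) hK (hS m hm) (hco x)
    have e3 := lossAt_nonneg F s x (S m)
    set l := lossAt F s x (S m)
    have : (max ((hdeg (avoiding F s (S m)) s x : ℝ) - D') 0) ^ 2
      ≤ u ^ 2 - 2 * u * l + r * K * l := by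
      refine e1.trans ?_
      rw [← hudef]
      nlinarith
    have := mul_le_mul_of_nonneg_left this (hw m hm)
    linarith
  refine (sum_le_sum hb).trans ?_
  rw [sum_add_distrib, sum_sub_distrib, ← sum_mul, hw1, ← mul_sum, ← mul_sum]
  have : (0 : ℝ) ≤ r * K := by positivity
  have e4 := mul_le_mul_of_nonneg_left h1 (by linarith : 0 ≤ 2 * u)
  have e5 := mul_le_mul_of_nonneg_left h2 this
  linarith

end NibbleStep

section NibbleMove
variable {ι X : Type*}

/-- The squared excess of the degrees over `D`. -/
noncomputable def excessSq (Y : Finset X) (F : Finset ι) (s : ι → Finset X) (D : ℝ) : ℝ :=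
  ∑ x ∈ Y, (max ((hdeg F s x : ℝ) - D) 0) ^ 2

lemma excessSq_nonneg (Y : Finset X) (F : Finset ι) (s : ι → Finset X) (D : ℝ) :
    0 ≤ excessSq Y F s D := sum_nonneg fun _ _ => sq_nonneg _

/-- The vertex set deleted by a move: nothing, a hyperedge, or a single vertex. -/
def moveSet (s : ι → Finset X) : Option (ι ⊕ X) → Finset X
  | none => ∅
  | some (Sum.inl e) => s e
  | some (Sum.inr x) => {x}

lemma excess_sq_step {d D D₀ θ p K R r : ℝ} (hD : 0 < D) (hr : 1 ≤ r) (hθ : 0 ≤ θ)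
    (hp : p = θ / D) (hK : 0 ≤ K) (hdD : d ≤ D₀) (hhalf : r * θ ≤ 1 / 2)
    (hu : D * (1 - (r - 1) * θ) ≤ d) 
    (hR : R = (d - D * (1 - (r - 1) * θ)) ^ 2
        - 2 * (d - D * (1 - (r - 1) * θ)) * (d * ((r - 1) * θ - r ^ 2 * (p * K)))
        + r * K * (d * (r * (p * D₀)))) :
    R ≤ (max (d - D) 0) ^ 2 + d * (4 * r ^ 2 * θ ^ 2 * D + 5 * r ^ 2 * p * K * D₀) := by
  have hp0 : 0 ≤ p := hp ▸ by positivity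
  set t := (r - 1) * θ with ht
  have ht0 : 0 ≤ t := by rw [ht]; apply mul_nonneg <;> linarith
  have htr : t ≤ r * θ := by rw [ht]; nlinarith
  have hd2 : D / 2 ≤ d := by nlinarith
  have hd0 : 0 ≤ d := by linarith
  have hsq : (d - D) ^ 2 ≤ (max (d - D) 0) ^ 2 + (t * D) ^ 2 := by
    rcases le_total (d - D) 0 with h | h
    · rw [max_eq_right h]; nlinarith
    · rw [max_eq_left h]; nlinarith [sq_nonneg (t * D)]
  have htD : (t * D) ^ 2 ≤ r ^ 2 * θ ^ 2 * D ^ 2 := by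
    have : (t * D) ^ 2 ≤ (r * θ * D) ^ 2 := by gcongr
    linarith [this]
  have hDd : r ^ 2 * θ ^ 2 * D ^ 2 ≤ r ^ 2 * θ ^ 2 * D * (2 * d) := by
    have : 0 ≤ r ^ 2 * θ ^ 2 * D := by positivity
    nlinarith
  have hud : d - D * (1 - t) ≤ D₀ := by nlinarith
  have h1 : 2 * (d - D * (1 - t)) * (d * (r ^ 2 * (p * K))) ≤ 2 * D₀ * (d * (r ^ 2 * (p * K))) := by
    gcongr
  have h3 : 0 ≤ d * r ^ 2 * p * K * D₀ := by
    have : 0 ≤ D₀ := by linarith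
    positivity
  rw [hR]
  have expand : (d - D * (1 - t)) ^ 2 - 2 * (d - D * (1 - t)) * (d * t)
      = (d - D) ^ 2 - 2 * t * (d - D) ^ 2 + (t * D) ^ 2 - 2 * t ^ 2 * D * d := by ring
  have h4 : 0 ≤ 2 * t * (d - D) ^ 2 := by positivity
  have h5 : 0 ≤ 2 * t ^ 2 * D * d := by positivity
  nlinarith

lemma matchNum_step (F : Finset ι) (s : ι → Finset X) (Y : Finset X) (hY : ∀ f ∈ F, s f ⊆ Y)
    {r : ℕ} (hr : 1 ≤ r) (hs : ∀ f ∈ F, (s f).card = r) {θ D D₀ K p a b c : ℝ}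
    (hθ : 0 ≤ θ) (hD : 0 < D) (hDD : D ≤ D₀) (hp : p = θ / D) (hK : 0 ≤ K)
    (hdeg₀ : ∀ x, (hdeg F s x : ℝ) ≤ D₀) (hco : ∀ x y, y ≠ x → (hcodeg F s x y : ℝ) ≤ K)
    (hhalf : r * θ ≤ 1 / 2)
    (hw1 : p * ((F.card : ℝ) + ∑ x ∈ Y, max (D - hdeg F s x) 0) ≤ 1)
    (ha : 0 ≤ a) (hb : 0 ≤ b)
    (hV : ∀ S, a * (avoiding F s S).card
        - b * excessSq Y (avoiding F s S) s (D * (1 - (r - 1) * θ)) - c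
      ≤ matchNum (avoiding F s S) s) :
    p * F.card + a * (F.card * (1 - r * θ)
        - p * ∑ x ∈ Y, (hdeg F s x : ℝ) * max ((hdeg F s x : ℝ) - D) 0)
      - b * (excessSq Y F s D
        + r * F.card * (4 * r ^ 2 * θ ^ 2 * D + 5 * r ^ 2 * p * K * D₀)) - c
      ≤ matchNum F s := by
  have hp0 : 0 ≤ p := hp ▸ by positivity
  have hr1 : (1 : ℝ) ≤ r := by exact_mod_cast hr
  set 𝓜 : Finset (Option (ι ⊕ X)) := insertNone (F.disjSum Y) with h𝓜
  set w : Option (ι ⊕ X) → ℝ := fun m => match m with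
    | none => 1 - p * ((F.card : ℝ) + ∑ x ∈ Y, max (D - hdeg F s x) 0)
    | some (Sum.inl _) => p
    | some (Sum.inr x) => p * max (D - hdeg F s x) 0 with hwdef
  have hsum : ∀ g : Option (ι ⊕ X) → ℝ, ∑ m ∈ 𝓜, g m =
      g none + (∑ e ∈ F, g (some (Sum.inl e)) + ∑ x ∈ Y, g (some (Sum.inr x))) := by
    intro g
    rw [h𝓜, sum_insertNone, sum_disjSum]
  have hw : ∀ m ∈ 𝓜, 0 ≤ w m := by
    rintro (_ | _ | x) _
    · simp only [hwdef]; linarith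
    · exact hp0
    · exact mul_nonneg hp0 (le_max_right _ _)
  have hwsum : ∑ m ∈ 𝓜, w m = 1 := by
    rw [hsum]
    simp only [hwdef, sum_const, nsmul_eq_mul]
    rw [← mul_sum]; ring
  have hkill : ∀ x ∈ Y, killWeight 𝓜 w (moveSet s) x = p * max (hdeg F s x : ℝ) D := by
    intro x hx
    unfold killWeight
    rw [hsum]
    simp only [hwdef, moveSet, notMem_empty, if_false, mul_zero, mem_singleton, zero_add]
    have e1 : ∑ e ∈ F, p * (if x ∈ s e then (1 : ℝ) else 0) = p * hdeg F s x := by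
      rw [← mul_sum, sum_boole, hdeg]
    have e2 : ∑ z ∈ Y, p * max (D - hdeg F s z) 0 * (if x = z then (1 : ℝ) else 0)
        = p * max (D - hdeg F s x) 0 := by
      simp [hx]
    refine (congrArg₂ (· + ·) e1 e2).trans ?_
    rw [← mul_add]
    congr 1
    rcases le_total (hdeg F s x : ℝ) D with h | h
    · rw [max_eq_left (by linarith), max_eq_right h]; ring
    · rw [max_eq_right (by linarith), max_eq_left h]; ring
  have hpD : p * D = θ := by rw [hp]; field_simp
  have hpair : ∀ x y, x ≠ y →
      ∑ m ∈ 𝓜, w m * (if x ∈ moveSet s m ∧ y ∈ moveSet s m then (1 : ℝ) else 0) ≤ p * K := by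
    intro x y hxy
    rw [hsum]
    simp only [hwdef, moveSet, notMem_empty, if_false, mul_zero, mem_singleton, zero_add,
      false_and]
    have e1 : ∑ e ∈ F, p * (if x ∈ s e ∧ y ∈ s e then (1 : ℝ) else 0) = p * hcodeg F s x y := by
      rw [← mul_sum, sum_boole, hcodeg]
    have e2 : ∑ z ∈ Y, p * max (D - hdeg F s z) 0 * (if x = z ∧ y = z then (1 : ℝ) else 0)
        = 0 := by
      apply sum_eq_zero
      intro z _
      rw [if_neg, mul_zero]
      rintro ⟨h1, h2⟩
      exact hxy (h1.trans h2.symm)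
    have e3 := mul_le_mul_of_nonneg_left (hco x y hxy.symm) hp0
    rw [← add_zero (p * (hcodeg F s x y : ℝ))] at e3
    exact le_trans (le_of_eq (congrArg₂ (· + ·) e1 e2)) e3
  have hSr : ∀ m ∈ 𝓜, (moveSet s m).card ≤ r := by
    rintro (_ | e | x) hm
    · simp [moveSet]
    · have : e ∈ F := by simpa [h𝓜] using hm
      exact (hs e this).le
    · simpa [moveSet] using hr
  have hθk : ∀ f ∈ F, ∀ x ∈ s f, θ ≤ killWeight 𝓜 w (moveSet s) x := by
    intro f hf x hx
    rw [hkill x (hY f hf hx), ← hpD]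
    exact mul_le_mul_of_nonneg_left (le_max_right _ _) hp0
  have hPk : ∀ f ∈ F, ∀ x ∈ s f, killWeight 𝓜 w (moveSet s) x ≤ p * D₀ := by
    intro f hf x hx
    rw [hkill x (hY f hf hx)]
    exact mul_le_mul_of_nonneg_left (max_le (hdeg₀ x) hDD) hp0
  have hD₀ : 0 < D₀ := hD.trans_le hDD
  -- expected number of surviving hyperedges
  have hcount := expected_card_avoiding F s 𝓜 w (moveSet s) hw hwsum Y hY
  have hcount' : ∑ x ∈ Y, (hdeg F s x : ℝ) * killWeight 𝓜 w (moveSet s) x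
      = F.card * (r * θ) + p * ∑ x ∈ Y, (hdeg F s x : ℝ) * max ((hdeg F s x : ℝ) - D) 0 := by
    have e1 : (F.card : ℝ) * (r * θ) = ∑ x ∈ Y, (hdeg F s x : ℝ) * θ := by
      rw [← sum_vertices_eq F s Y hY (fun _ => θ)]
      rw [sum_congr rfl (g := fun _ => (r : ℝ) * θ) (fun f hf => by simp [hs f hf])]
      simp
    rw [e1, mul_sum, ← sum_add_distrib]
    apply sum_congr rfl
    intro x hx
    rw [hkill x hx, ← hpD]
    rcases le_total (hdeg F s x : ℝ) D with h | h
    · rw [max_eq_right h, max_eq_right (by linarith)]; ring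
    · rw [max_eq_left h, max_eq_left (by linarith)]; ring
  -- expected excess
  set D' := D * (1 - (r - 1) * θ) with hD'
  have hD'0 : 0 ≤ D' := by
    rw [hD']; apply mul_nonneg hD.le; nlinarith
  have hexc : ∑ m ∈ 𝓜, w m * excessSq Y (avoiding F s (moveSet s m)) s D'
      ≤ excessSq Y F s D + r * F.card * (4 * r ^ 2 * θ ^ 2 * D + 5 * r ^ 2 * p * K * D₀) := by
    have e1 : (r * F.card : ℝ) * (4 * r ^ 2 * θ ^ 2 * D + 5 * r ^ 2 * p * K * D₀)
        = ∑ x ∈ Y, (hdeg F s x : ℝ) * (4 * r ^ 2 * θ ^ 2 * D + 5 * r ^ 2 * p * K * D₀) := by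
      rw [← sum_vertices_eq F s Y hY (fun _ => (4 * r ^ 2 * θ ^ 2 * D + 5 * r ^ 2 * p * K * D₀))]
      rw [sum_congr rfl (g := fun _ => (r : ℝ) * (4 * r ^ 2 * θ ^ 2 * D + 5 * r ^ 2 * p * K * D₀))
        (fun f hf => by rw [sum_const, hs f hf, nsmul_eq_mul])]
      rw [sum_const, nsmul_eq_mul]; ring
    rw [e1]
    unfold excessSq
    rw [← sum_add_distrib]
    simp_rw [mul_sum]
    rw [sum_comm]
    apply sum_le_sum
    intro x _
    have hnn : 0 ≤ (hdeg F s x : ℝ) * (4 * r ^ 2 * θ ^ 2 * D + 5 * r ^ 2 * p * K * D₀) := by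
      positivity
    rcases le_total D' (hdeg F s x : ℝ) with hu | hu
    · refine (expected_excess F s 𝓜 w (moveSet s) hw hwsum hr hs (mul_nonneg hp0 hK)
        (mul_nonneg hp0 hD₀.le) hK hθk hPk hpair hSr hco x hD'0 hu).trans ?_
      exact excess_sq_step hD hr1 hθ hp hK (hdeg₀ x) hhalf hu rfl
    · have : ∀ m ∈ 𝓜, w m * (max ((hdeg (avoiding F s (moveSet s m)) s x : ℝ) - D') 0) ^ 2 = 0 := by
        intro m _
        have : (hdeg (avoiding F s (moveSet s m)) s x : ℝ) ≤ hdeg F s x := by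
          unfold hdeg avoiding
          exact_mod_cast card_le_card (filter_subset_filter _ (filter_subset _ _))
        rw [max_eq_right (by linarith)]; simp
      rw [sum_eq_zero this]
      have := sq_nonneg (max ((hdeg F s x : ℝ) - D) 0)
      linarith
  -- averaging
  have havg : ∑ m ∈ 𝓜, w m * (a * (avoiding F s (moveSet s m)).card
        - b * excessSq Y (avoiding F s (moveSet s m)) s D' - c) + p * F.card
      ≤ matchNum F s := by
    have e1 : (matchNum F s : ℝ) = ∑ m ∈ 𝓜, w m * (matchNum F s : ℝ) := by
      rw [← sum_mul, hwsum, one_mul]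
    rw [e1, hsum, hsum]
    have e2 : p * (F.card : ℝ) = ∑ e ∈ F, p := by simp [mul_comm]
    have t1 : w none * (a * (avoiding F s (moveSet s none)).card
        - b * excessSq Y (avoiding F s (moveSet s none)) s D' - c) ≤ w none * matchNum F s := by
      apply mul_le_mul_of_nonneg_left _ (hw none (by simp [h𝓜]))
      exact (hV _).trans (by exact_mod_cast matchNum_avoiding_le F s _)
    have t3 : ∑ x ∈ Y, w (some (Sum.inr x)) * (a * (avoiding F s (moveSet s (some (Sum.inr x)))).card
        - b * excessSq Y (avoiding F s (moveSet s (some (Sum.inr x)))) s D' - c)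
        ≤ ∑ x ∈ Y, w (some (Sum.inr x)) * matchNum F s := by
      apply sum_le_sum
      intro x hx
      have hwx : 0 ≤ w (some (Sum.inr x)) := mul_nonneg hp0 (le_max_right _ _)
      exact mul_le_mul_of_nonneg_left
        ((hV _).trans (by exact_mod_cast matchNum_avoiding_le F s _)) hwx
    have t2 : ∑ e ∈ F, w (some (Sum.inl e)) * (a * (avoiding F s (moveSet s (some (Sum.inl e)))).card
        - b * excessSq Y (avoiding F s (moveSet s (some (Sum.inl e)))) s D' - c) + ∑ e ∈ F, p
        ≤ ∑ e ∈ F, w (some (Sum.inl e)) * matchNum F s := by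
      rw [← sum_add_distrib]
      apply sum_le_sum
      intro e he
      have hne : (s e).Nonempty := by rw [← card_pos, hs e he]; exact hr
      have h1 := hV (s e)
      have h2 : (matchNum (avoiding F s (s e)) s : ℝ) + 1 ≤ matchNum F s := by
        exact_mod_cast matchNum_avoiding_add_one_le he hne
      have : w (some (Sum.inl e)) = p := rfl
      rw [this]
      have h3 := mul_le_mul_of_nonneg_left (h1.trans (by linarith : _ ≤ (matchNum F s : ℝ) - 1)) hp0
      change p * (a * (avoiding F s (s e)).card - b * excessSq Y (avoiding F s (s e)) s D' - c) + p ≤ _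
      linarith
    linarith
  have hlin : ∑ m ∈ 𝓜, w m * (a * (avoiding F s (moveSet s m)).card
        - b * excessSq Y (avoiding F s (moveSet s m)) s D' - c)
      = a * ∑ m ∈ 𝓜, w m * (avoiding F s (moveSet s m)).card
        - b * ∑ m ∈ 𝓜, w m * excessSq Y (avoiding F s (moveSet s m)) s D' - c := by
    have : c = ∑ m ∈ 𝓜, w m * c := by rw [← sum_mul, hwsum, one_mul]
    conv_rhs => rw [this]
    rw [mul_sum, mul_sum, ← sum_sub_distrib, ← sum_sub_distrib]
    apply sum_congr rfl
    intro m _; ring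
  rw [hlin] at havg
  rw [hcount'] at hcount
  have f1 := mul_le_mul_of_nonneg_left hcount ha
  have f2 := mul_le_mul_of_nonneg_left hexc hb
  have : (F.card : ℝ) * (1 - r * θ) = F.card - F.card * (r * θ) := by ring
  rw [this]
  linarith

end NibbleMove

section NibbleIteration
variable {ι X : Type*}

lemma nibble_arith {al n N₀ D D₀ ρ θ τ ε' Ψ Sm K T r B C p : ℝ} {j : ℕ}
    (hal : 0 ≤ al) (hal1 : al ≤ 1) (hn0 : 0 ≤ n) (hn : n ≤ N₀) (hD₀ : 0 < D₀) (hDD : D ≤ D₀)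
    (hε' : 0 < ε') (hε1 : ε' ≤ 1) (hD : ε' * D₀ ≤ D) (hDρ : ε' * D₀ ≤ D * ρ) (hρ : 0 < ρ)
    (hθ : 0 ≤ θ) (hτ : 0 < τ) (hΨ : 0 ≤ Ψ) (hS : Sm ≤ τ * D₀ * (r * n) + Ψ / (τ * ε'))
    (hK : θ * D₀ ≤ K) (hr : 1 ≤ r) (hjT : j * θ ≤ T) (hB : B = 1 / (τ * ε' ^ 3))
    (hC : C = τ * r / ε' ^ 2 + 9 * B * T * r ^ 3 * (K / D₀) / ε') (hp : p = θ / D) :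
    (θ + al * ((1 - r * θ) / ρ)) * n / D - B * (j + 1 : ℕ) * θ * Ψ / D₀ ^ 2
        - C * (j + 1 : ℕ) * θ * N₀ / D₀
      ≤ p * n + al / (D * ρ) * (n * (1 - r * θ) - p * Sm)
        - B * j * θ / D₀ ^ 2 * (Ψ + r * n * (4 * r ^ 2 * θ ^ 2 * D + 5 * r ^ 2 * p * K * D₀))
        - C * j * θ * N₀ / D₀ := by
  have hε0 : 0 < ε' * D₀ := by positivity
  have hD0 : 0 < D := hε0.trans_le hD
  have hDρ0 : 0 < D * ρ := by positivity
  have hB0 : 0 < B := by rw [hB]; positivity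
  have hN0 : 0 ≤ N₀ := hn0.trans hn
  have hK0 : 0 ≤ K := le_trans (by positivity) hK
  have hT0 : 0 ≤ T := le_trans (by positivity) hjT
  have ha : al / (D * ρ) ≤ 1 / (ε' * D₀) := by
    rw [div_le_div_iff₀ hDρ0 hε0]; nlinarith
  have hp' : p ≤ θ / (ε' * D₀) := by
    rw [hp]; gcongr
  have hp0 : 0 ≤ p := by rw [hp]; positivity
  have h1 : al / (D * ρ) * (p * Sm) ≤ θ * (τ * r / ε' ^ 2 * N₀ / D₀) + B * θ * Ψ / D₀ ^ 2 := by
    calc al / (D * ρ) * (p * Sm) ≤ al / (D * ρ) * (p * (τ * D₀ * (r * N₀) + Ψ / (τ * ε'))) := by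
          have : Sm ≤ τ * D₀ * (r * N₀) + Ψ / (τ * ε') := hS.trans (by gcongr)
          gcongr
      _ ≤ 1 / (ε' * D₀) * (θ / (ε' * D₀) * (τ * D₀ * (r * N₀) + Ψ / (τ * ε'))) := by
          gcongr
      _ = _ := by rw [hB]; field_simp
  have h2 : B * j * θ / D₀ ^ 2 * (r * n * (4 * r ^ 2 * θ ^ 2 * D + 5 * r ^ 2 * p * K * D₀))
      ≤ θ * (9 * B * T * r ^ 3 * (K / D₀) / ε' * N₀ / D₀) := by
    have e1 : 4 * r ^ 2 * θ ^ 2 * D ≤ 4 * r ^ 2 * θ * K / ε' := by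
      have : θ * D ≤ K := le_trans (by gcongr) hK
      have : 4 * r ^ 2 * θ ^ 2 * D ≤ 4 * r ^ 2 * θ * K := by
        calc 4 * r ^ 2 * θ ^ 2 * D = 4 * r ^ 2 * θ * (θ * D) := by ring
          _ ≤ _ := by gcongr
      refine this.trans (le_div_self (by positivity) hε' hε1)
    have e2 : 5 * r ^ 2 * p * K * D₀ ≤ 5 * r ^ 2 * θ * K / ε' := by
      calc 5 * r ^ 2 * p * K * D₀ ≤ 5 * r ^ 2 * (θ / (ε' * D₀)) * K * D₀ := by gcongr
        _ = _ := by field_simp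
    have e3 : B * j * θ / D₀ ^ 2 ≤ B * T / D₀ ^ 2 := by
      rw [mul_assoc]; gcongr
    have e4 : (0 : ℝ) ≤ B * j * θ / D₀ ^ 2 := by positivity
    calc _ ≤ B * T / D₀ ^ 2 * (r * N₀ * (4 * r ^ 2 * θ * K / ε' + 5 * r ^ 2 * θ * K / ε')) := by
          gcongr
      _ = _ := by field_simp; ring
  have h3 : (θ + al * ((1 - r * θ) / ρ)) * n / D = p * n + al / (D * ρ) * (n * (1 - r * θ)) := by
    rw [hp]; field_simp
  have h4 : C * (j + 1 : ℕ) * θ * N₀ / D₀ = C * j * θ * N₀ / D₀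
      + (θ * (τ * r / ε' ^ 2 * N₀ / D₀) + θ * (9 * B * T * r ^ 3 * (K / D₀) / ε' * N₀ / D₀)) := by
    rw [hC]; push_cast; ring
  have h5 : B * (j + 1 : ℕ) * θ * Ψ / D₀ ^ 2 = B * j * θ * Ψ / D₀ ^ 2 + B * θ * Ψ / D₀ ^ 2 := by
    push_cast; ring
  rw [h3, h4, h5]
  have h6 : al / (D * ρ) * (n * (1 - r * θ) - p * Sm) = al / (D * ρ) * (n * (1 - r * θ))
    - al / (D * ρ) * (p * Sm) := by ring
  have h7 : B * j * θ / D₀ ^ 2 * (Ψ + r * n * (4 * r ^ 2 * θ ^ 2 * D + 5 * r ^ 2 * p * K * D₀))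
    = B * j * θ * Ψ / D₀ ^ 2
      + B * j * θ / D₀ ^ 2 * (r * n * (4 * r ^ 2 * θ ^ 2 * D + 5 * r ^ 2 * p * K * D₀)) := by ring
  rw [h6, h7]
  linarith

/-- The matching densities guaranteed by `j` steps of the nibble. -/
noncomputable def nibbleDensity (r θ : ℝ) : ℕ → ℝ
  | 0 => 0
  | j + 1 => θ + nibbleDensity r θ j * ((1 - r * θ) / (1 - (r - 1) * θ))

lemma nibbleDensity_bounds {r θ : ℝ} (hr : 1 ≤ r) (hθ : 0 ≤ θ) (hhalf : r * θ ≤ 1 / 2) (j : ℕ) :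
    0 ≤ nibbleDensity r θ j ∧ nibbleDensity r θ j ≤ 1 ∧
      1 - (1 - θ) ^ j - 2 * r * θ ^ 2 * j ≤ nibbleDensity r θ j := by
  have hρ : 1 / 2 ≤ 1 - (r - 1) * θ := by nlinarith
  have hρ0 : 0 < 1 - (r - 1) * θ := by linarith
  have hq0 : 0 ≤ (1 - r * θ) / (1 - (r - 1) * θ) := div_nonneg (by linarith) hρ0.le
  have hq1 : (1 - r * θ) / (1 - (r - 1) * θ) ≤ 1 - θ := by
    rw [div_le_iff₀ hρ0]; nlinarith [mul_nonneg (sub_nonneg.2 hr) (sq_nonneg θ)]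
  have hq2 : 1 - θ - 2 * r * θ ^ 2 ≤ (1 - r * θ) / (1 - (r - 1) * θ) := by
    rw [le_div_iff₀ hρ0]
    have h1 : 0 ≤ r * θ ^ 2 := by positivity
    have h2 : 0 ≤ (r - 1) * θ ^ 2 := mul_nonneg (by linarith) (sq_nonneg _)
    have : (2 * r * θ ^ 2) * (1 / 2) ≤ 2 * r * θ ^ 2 * (1 - (r - 1) * θ) := by gcongr
    nlinarith
  have hθ1 : θ ≤ 1 := by nlinarith
  induction j with
  | zero => simp [nibbleDensity]
  | succ j ih =>
    obtain ⟨h0, h1, h2⟩ := ih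
    simp only [nibbleDensity]
    set q := (1 - r * θ) / (1 - (r - 1) * θ)
    set x := nibbleDensity r θ j
    refine ⟨by positivity, by nlinarith, ?_⟩
    have h3 : x * (1 - θ - 2 * r * θ ^ 2) ≤ x * q := by gcongr
    have h4 : x * (2 * r * θ ^ 2) ≤ 1 * (2 * r * θ ^ 2) := by gcongr
    have h5 : (1 - (1 - θ) ^ j - 2 * r * θ ^ 2 * j) * (1 - θ) ≤ x * (1 - θ) := by
      apply mul_le_mul_of_nonneg_right h2; linarith
    have h6 : 0 ≤ 2 * r * θ ^ 2 * j * θ := by positivity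
    push_cast
    rw [pow_succ]
    nlinarith

lemma mul_excess_le {d D D₀ τ ε' : ℝ} (hd0 : 0 ≤ d) (hx : d ≤ D₀) (hD₀ : 0 < D₀) (hτ : 0 < τ)
    (hε' : 0 < ε') (hε1 : ε' ≤ 1) :
    d * max (d - D) 0 ≤ τ * D₀ * (d * 1) + (max (d - D) 0) ^ 2 / (τ * ε') := by
  set y := max (d - D) 0
  have hy0 : 0 ≤ y := le_max_right _ _
  rcases le_total y (τ * D₀) with h | h
  · have : 0 ≤ y ^ 2 / (τ * ε') := by positivity
    have := mul_le_mul_of_nonneg_left h hd0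
    linarith
  · have h7 : d * y ≤ y ^ 2 / (τ * ε') := by
      rw [le_div_iff₀ (by positivity)]
      have h8 : d * (τ * ε') ≤ y := by
        calc d * (τ * ε') ≤ D₀ * (τ * 1) := by gcongr
          _ ≤ y := by linarith
      have := mul_le_mul_of_nonneg_right h8 hy0
      linarith
    have : 0 ≤ τ * D₀ * (d * 1) := by positivity
    linarith

lemma matchNum_iterate (E : Finset ι) (s : ι → Finset X)
    {r : ℕ} (hr : 1 ≤ r) (hs : ∀ f ∈ E, (s f).card = r) {θ D₀ K ε' τ T B C : ℝ} (J : ℕ)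
    (hθ : 0 ≤ θ) (hD₀ : 0 < D₀) (hε' : 0 < ε') (hε1 : ε' ≤ 1) (hτ : 0 < τ)
    (hρJ : ε' ≤ (1 - (r - 1) * θ) ^ J) (hJ : J * θ ≤ T) (hK : θ * D₀ ≤ K)
    (hdeg₀ : ∀ x, (hdeg E s x : ℝ) ≤ D₀) (hco : ∀ x y, y ≠ x → (hcodeg E s x y : ℝ) ≤ K)
    (hhalf : r * θ ≤ 1 / 2)
    (hw : θ * (E.card + (E.biUnion s).card * D₀) ≤ ε' * D₀)
    (hB : B = 1 / (τ * ε' ^ 3))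
    (hC : C = τ * r / ε' ^ 2 + 9 * B * T * r ^ 3 * (K / D₀) / ε') :
    ∀ j ≤ J, ∀ F ⊆ E, nibbleDensity r θ j * F.card / (D₀ * (1 - (r - 1) * θ) ^ (J - j))
      - B * j * θ * excessSq (E.biUnion s) F s (D₀ * (1 - (r - 1) * θ) ^ (J - j)) / D₀ ^ 2
      - C * j * θ * E.card / D₀ ≤ matchNum F s := by
  have hr1 : (1 : ℝ) ≤ r := by exact_mod_cast hr
  have hρ : (1 : ℝ) / 2 ≤ 1 - (r - 1) * θ := by nlinarith
  have hρ1 : 1 - ((r : ℝ) - 1) * θ ≤ 1 := by nlinarith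
  set ρ := 1 - ((r : ℝ) - 1) * θ with hρdef
  have hρ0 : 0 < ρ := by linarith
  have hpow : ∀ k ≤ J, ε' * D₀ ≤ D₀ * ρ ^ k := by
    intro k hk
    rw [mul_comm]
    gcongr
    exact hρJ.trans (pow_le_pow_of_le_one hρ0.le hρ1 hk)
  intro j
  induction j with
  | zero => intro _ F _; simp [nibbleDensity]
  | succ j ih =>
    intro hj F hF
    have ih' := ih (by omega)
    set D := D₀ * ρ ^ (J - (j + 1)) with hD
    have hDρ : D₀ * ρ ^ (J - j) = D * ρ := by
      rw [hD, mul_assoc, ← pow_succ]; congr 2; omega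
    have hDpos : 0 < D := by positivity
    have hDD : D ≤ D₀ := by
      rw [hD]; exact mul_le_of_le_one_right hD₀.le (pow_le_one₀ hρ0.le hρ1)
    have hcodF : ∀ x y, y ≠ x → (hcodeg F s x y : ℝ) ≤ K := fun x y h =>
      le_trans (by exact_mod_cast card_le_card (filter_subset_filter _ hF)) (hco x y h)
    have hdegF : ∀ x, (hdeg F s x : ℝ) ≤ D₀ := fun x =>
      le_trans (by exact_mod_cast card_le_card (filter_subset_filter _ hF)) (hdeg₀ x)
    obtain ⟨ha0, ha1, -⟩ := nibbleDensity_bounds hr1 hθ hhalf j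
    have hFE : (F.card : ℝ) ≤ E.card := by exact_mod_cast card_le_card hF
    have hB0 : 0 < B := by rw [hB]; positivity
    have hYF : ∀ f ∈ F, s f ⊆ E.biUnion s := fun f hf => subset_biUnion_of_mem s (hF hf)
    have hstep := matchNum_step F s (E.biUnion s) hYF hr
      (fun f hf => hs f (hF hf)) (θ := θ) (D := D) (D₀ := D₀) (K := K) (p := θ / D)
      (a := nibbleDensity r θ j / (D * ρ)) (b := B * j * θ / D₀ ^ 2)
      (c := C * j * θ * E.card / D₀) hθ hDpos hDD rfl
      (le_trans (by positivity) hK) hdegF hcodF hhalf ?_ (by positivity) (by positivity) ?_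
    · refine le_trans ?_ hstep
      have hjT : (j : ℝ) * θ ≤ T := le_trans (by gcongr; omega) hJ
      refine nibble_arith ha0 ha1 (by positivity) hFE hD₀ hDD hε' hε1 (hpow _ (by omega))
        (hDρ ▸ hpow _ (by omega)) hρ0 hθ hτ (excessSq_nonneg _ _ _ _) ?_ hK hr1 hjT hB hC rfl
      have e1 : (r : ℝ) * F.card = ∑ x ∈ E.biUnion s, (hdeg F s x : ℝ) * 1 := by
        rw [← sum_vertices_eq F s _ hYF (fun _ => 1)]
        rw [sum_congr rfl (g := fun _ => (r : ℝ)) (fun f hf => by simp [hs f (hF hf)])]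
        simp [mul_comm]
      rw [e1, mul_sum, excessSq, sum_div, ← sum_add_distrib]
      apply sum_le_sum
      intro x _
      exact mul_excess_le (by positivity) (hdegF x) hD₀ hτ hε' hε1
    · have h1 : ∑ x ∈ E.biUnion s, max (D - hdeg F s x) 0 ≤ (E.biUnion s).card * D₀ := by
        rw [← nsmul_eq_mul]
        apply sum_le_card_nsmul
        intro x _
        apply max_le _ hD₀.le
        have : (0 : ℝ) ≤ hdeg F s x := by positivity
        linarith
      rw [div_mul_eq_mul_div, div_le_one hDpos]
      calc _ ≤ θ * (E.card + (E.biUnion s).card * D₀) := by gcongr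
        _ ≤ _ := hw.trans (hpow _ (by omega))
    · intro S
      have := ih' (avoiding F s S) ((filter_subset _ _).trans hF)
      rw [hDρ] at this
      refine le_trans (le_of_eq ?_) this
      ring

lemma exists_matching {r : ℕ} (hr : 1 ≤ r) {ε : ℝ} (hε : 0 < ε) :
    ∃ η : ℝ, 0 < η ∧ ∀ (ι X : Type) (E : Finset ι) (s : ι → Finset X) (D : ℝ), 0 < D →
      (∀ f ∈ E, (s f).card = r) → (∀ x, (hdeg E s x : ℝ) ≤ D) →
      (∀ x y, y ≠ x → (hcodeg E s x y : ℝ) ≤ η * D) →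
      ∃ M ⊆ E, (M : Set ι).PairwiseDisjoint s ∧ (1 - ε) * (E.card / D) ≤ M.card := by
  have hr1 : (1 : ℝ) ≤ r := by exact_mod_cast hr
  set T : ℝ := 4 / ε with hT
  have hT0 : 0 < T := by positivity
  set ε' : ℝ := Real.exp (-(2 * r * T)) with hε'
  have hε0 : 0 < ε' := Real.exp_pos _
  have hε1 : ε' ≤ 1 := by
    rw [hε', Real.exp_le_one_iff]
    have : 0 ≤ 2 * r * T := by positivity
    linarith
  set τ : ℝ := ε * ε' ^ 2 / (4 * r * T) with hτ
  have hτ0 : 0 < τ := by positivity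
  set B : ℝ := 1 / (τ * ε' ^ 3) with hB
  have hB0 : 0 < B := by positivity
  set η : ℝ := ε * ε' / (36 * B * T ^ 2 * r ^ 3) with hη
  have hη0 : 0 < η := by positivity
  refine ⟨η, hη0, ?_⟩
  intro ι X E s D hD hs hdegD hco
  set Z : ℝ := E.card + (E.biUnion s).card * D with hZ
  have hZ0 : 0 ≤ Z := by positivity
  obtain ⟨J, hJ⟩ := exists_nat_gt (T / min (min η (1 / (2 * r))) (min (ε / (8 * r * T)) (ε' * D / (Z + 1))))
  set m := min (min η (1 / (2 * r))) (min (ε / (8 * r * T)) (ε' * D / (Z + 1))) with hm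
  have hm0 : 0 < m := by
    rw [hm]
    refine lt_min (lt_min hη0 (by positivity)) (lt_min (by positivity) (by positivity))
  have hJ0 : (0 : ℝ) < J := lt_of_le_of_lt (by positivity) hJ
  set θ : ℝ := T / J with hθ
  have hθ0 : 0 < θ := by positivity
  have hθm : θ ≤ m := by
    rw [hθ, div_le_iff₀ hJ0]
    rw [div_lt_iff₀ hm0] at hJ; linarith
  have h1 : θ ≤ η := hθm.trans ((min_le_left _ _).trans (min_le_left _ _))
  have h2 : θ ≤ 1 / (2 * r) := hθm.trans ((min_le_left _ _).trans (min_le_right _ _))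
  have h3 : θ ≤ ε / (8 * r * T) := hθm.trans ((min_le_right _ _).trans (min_le_left _ _))
  have h4 : θ ≤ ε' * D / (Z + 1) := hθm.trans ((min_le_right _ _).trans (min_le_right _ _))
  have hhalf : r * θ ≤ 1 / 2 := by
    rw [le_div_iff₀ (by positivity)] at h2; linarith
  have hJT : J * θ = T := by rw [hθ]; field_simp
  have hρJ : ε' ≤ (1 - ((r : ℝ) - 1) * θ) ^ J := by
    have : Real.exp (-(2 * r * θ)) ≤ 1 - ((r : ℝ) - 1) * θ := by
      have h5 : Real.exp (-(2 * r * θ)) ≤ 1 - r * θ := by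
        rw [Real.exp_neg, inv_le_iff_one_le_mul₀ (Real.exp_pos _)]
        have := Real.add_one_le_exp (2 * r * θ)
        have h6 : 0 ≤ r * θ := by positivity
        nlinarith
      linarith
    calc ε' = Real.exp (-(2 * r * θ)) ^ J := by
          rw [← Real.exp_nat_mul, hε', ← hJT]; congr 1; ring
      _ ≤ _ := by gcongr
  obtain ⟨M, hME, hMd, hMc⟩ := exists_matchNum E s
  refine ⟨M, hME, hMd, ?_⟩
  rw [hMc]
  have main := matchNum_iterate E s hr hs (θ := θ) (D₀ := D) (K := η * D) (ε' := ε') (τ := τ)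
    (T := T) (B := B) J hθ0.le hD hε0 hε1 hτ0 hρJ hJT.le (by gcongr) hdegD hco hhalf
    (by rw [le_div_iff₀ (by positivity)] at h4; linarith) hB rfl J le_rfl E subset_rfl
  rw [Nat.sub_self, pow_zero, mul_one] at main
  have hΨ : excessSq (E.biUnion s) E s D = 0 := by
    apply sum_eq_zero
    intro x _
    rw [max_eq_right (by linarith [hdegD x])]; simp
  rw [hΨ] at main
  obtain ⟨-, -, hnd⟩ := nibbleDensity_bounds hr1 hθ0.le hhalf J
  have hexp : (1 - θ) ^ J ≤ ε / 4 := by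
    have hθ1 : θ ≤ 1 := by nlinarith
    calc (1 - θ) ^ J ≤ Real.exp (-θ) ^ J := by
          gcongr
          have := Real.add_one_le_exp (-θ); linarith
      _ = Real.exp (-T) := by rw [← Real.exp_nat_mul, ← hJT]; congr 1; ring
      _ ≤ ε / 4 := by
          rw [Real.exp_neg, inv_le_comm₀ (Real.exp_pos _) (by positivity)]
          have := Real.add_one_le_exp T
          have : (ε / 4)⁻¹ = T := by rw [hT]; field_simp
          linarith
  have hsq : 2 * r * θ ^ 2 * J ≤ ε / 4 := by
    have : 2 * r * θ ^ 2 * J = 2 * r * T * θ := by rw [← hJT]; ring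
    rw [this]
    rw [le_div_iff₀ (by positivity)] at h3; linarith
  have hCJ : (τ * r / ε' ^ 2 + 9 * B * T * r ^ 3 * (η * D / D) / ε') * J * θ = ε / 2 := by
    rw [mul_assoc, hJT, hη, hτ]
    field_simp
    ring
  rw [hCJ] at main
  have hnd' : 1 - ε / 2 ≤ nibbleDensity r θ J := by linarith
  have : (1 - ε / 2) * E.card / D ≤ nibbleDensity r θ J * E.card / D := by gcongr
  have e : (1 - ε) * ((E.card : ℝ) / D) = (1 - ε / 2) * E.card / D - ε / 2 * E.card / D := by ring
  rw [e]
  have e0 : B * J * θ * 0 / D ^ 2 = 0 := by simp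
  linarith

end NibbleIteration

section SecondMoment
variable {Z K J : Type}

/-- The indicator weight at coordinate `z` of the cylinder event described by the list `l`. -/
noncomputable def cylWeight (l : List (Z × Finset K)) (z : Z) (k : K) : ℝ :=
  (l.map fun p => if z = p.1 then (if k ∈ p.2 then (1 : ℝ) else 0) else 1).prod

/-- The cylinder event described by the list `l`. -/
def Cyl (l : List (Z × Finset K)) (ω : Z → K) : Prop := ∀ p ∈ l, ω p.1 ∈ p.2

/-- The probability of a cylinder event. -/
noncomputable def cylProb [Fintype K] (l : List (Z × Finset K)) : ℝ :=
  (l.map fun p => (p.2.card : ℝ) / Fintype.card K).prod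

lemma cylWeight_cons (p : Z × Finset K) (l : List (Z × Finset K)) (z : Z) (k : K) :
    cylWeight (p :: l) z k
      = (if z = p.1 then (if k ∈ p.2 then (1 : ℝ) else 0) else 1) * cylWeight l z k := rfl

lemma cylWeight_eq_one {l : List (Z × Finset K)} {z : Z} (h : ∀ p ∈ l, p.1 ≠ z) (k : K) :
    cylWeight l z k = 1 := by
  induction l with
  | nil => rfl
  | cons p l ih =>
    rw [cylWeight_cons, if_neg (fun e => h p (by simp) e.symm),
      ih (fun p' hp' => h p' (by simp [hp'])), one_mul]

lemma prod_cylWeight [Fintype Z] (l : List (Z × Finset K)) (ω : Z → K) :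
    ∏ z, cylWeight l z (ω z) = if Cyl l ω then 1 else 0 := by
  induction l with
  | nil => simp [cylWeight, Cyl]
  | cons p l ih =>
    simp_rw [cylWeight_cons]
    rw [prod_mul_distrib, ih]
    simp only [prod_ite_eq', mem_univ, if_true]
    by_cases h1 : ω p.1 ∈ p.2 <;> by_cases h2 : Cyl l ω <;> simp [Cyl, h1]

lemma prod_sum_cylWeight [Fintype Z] [Fintype K] [Nonempty K] {l : List (Z × Finset K)} (h : (l.map Prod.fst).Nodup) :
    ∏ z, ((∑ k, cylWeight l z k) / Fintype.card K) = cylProb l := by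
  have hK : (Fintype.card K : ℝ) ≠ 0 := by
    have := Fintype.card_pos (α := K); positivity
  induction l with
  | nil => simp [cylWeight, cylProb, hK]
  | cons p l ih =>
    rw [List.map_cons, List.nodup_cons] at h
    have hp : ∀ p' ∈ l, p'.1 ≠ p.1 := fun p' hp' e => h.1 (List.mem_map.2 ⟨p', hp', e⟩)
    have key : ∀ z, (∑ k, cylWeight (p :: l) z k) / Fintype.card K
        = (if z = p.1 then (p.2.card : ℝ) / Fintype.card K else 1)
          * ((∑ k, cylWeight l z k) / Fintype.card K) := by
      intro z
      simp_rw [cylWeight_cons]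
      split_ifs with hz
      · subst hz
        simp_rw [cylWeight_eq_one hp, mul_one]
        simp [hK]
      · simp
    simp_rw [key]
    rw [prod_mul_distrib, ih h.2]
    simp [cylProb]

lemma sum_cyl [DecidableEq Z] [Fintype Z] [Fintype K] [Nonempty K] {l : List (Z × Finset K)} (h : (l.map Prod.fst).Nodup) :
    ∑ ω : Z → K, (if Cyl l ω then (1 : ℝ) else 0) = Fintype.card (Z → K) * cylProb l := by
  have hK : (Fintype.card K : ℝ) ≠ 0 := by
    have := Fintype.card_pos (α := K); positivity
  simp_rw [← prod_cylWeight]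
  have e := prod_univ_sum (fun _ : Z => (univ : Finset K)) (fun z k => cylWeight l z k)
  rw [Fintype.piFinset_univ] at e
  rw [← e, ← prod_sum_cylWeight h, prod_div_distrib]
  simp only [prod_const, card_univ, Fintype.card_fun, Nat.cast_pow]
  field_simp

lemma cylProb_mem [Fintype K] {l : List (Z × Finset K)} : 0 ≤ cylProb l ∧ cylProb l ≤ 1 := by
  induction l with
  | nil => simp [cylProb]
  | cons p l ih =>
    have e : cylProb (p :: l) = (p.2.card : ℝ) / Fintype.card K * cylProb l := rfl
    have h0 : 0 ≤ (p.2.card : ℝ) / Fintype.card K := by positivity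
    have h1 : (p.2.card : ℝ) / Fintype.card K ≤ 1 :=
      div_le_one_of_le₀ (by exact_mod_cast card_le_univ _) (by positivity)
    rw [e]
    exact ⟨mul_nonneg h0 ih.1, mul_le_one₀ h1 ih.1 ih.2⟩

/-- Two cylinder events that share a coordinate. -/
def Dep (l l' : List (Z × Finset K)) : Prop := ∃ p ∈ l, ∃ p' ∈ l', p.1 = p'.1

lemma sum_cyl_sub_sq_le [DecidableEq Z] [Fintype Z] [Fintype K] [Nonempty K] (I : Finset J) (l : J → List (Z × Finset K)) {μ : ℝ}
    (hl : ∀ j ∈ I, ((l j).map Prod.fst).Nodup) (hμ : ∀ j ∈ I, cylProb (l j) = μ) :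
    ∑ ω : Z → K, (((I.filter fun j => Cyl (l j) ω).card : ℝ) - μ * I.card) ^ 2
      ≤ Fintype.card (Z → K) * ∑ j ∈ I, ((I.filter fun j' => Dep (l j) (l j')).card : ℝ) := by
  have e1 : ∀ ω : Z → K, (((I.filter fun j => Cyl (l j) ω).card : ℝ) - μ * I.card) ^ 2
      = ∑ j ∈ I, ∑ j' ∈ I, ((if Cyl (l j) ω then (1 : ℝ) else 0) - μ)
          * ((if Cyl (l j') ω then (1 : ℝ) else 0) - μ) := by
    intro ω
    rw [← sum_mul_sum, ← sq, sum_sub_distrib, sum_boole, sum_const, nsmul_eq_mul, mul_comm μ]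
  simp_rw [e1]
  rw [sum_comm, mul_sum]
  apply sum_le_sum
  intro j hj
  rw [sum_comm]
  have e2 : (Fintype.card (Z → K) : ℝ) * ((I.filter fun j' => Dep (l j) (l j')).card : ℝ)
      = ∑ j' ∈ I, if Dep (l j) (l j') then (Fintype.card (Z → K) : ℝ) else 0 := by
    rw [← sum_filter, sum_const, nsmul_eq_mul, mul_comm]
  rw [e2]
  apply sum_le_sum
  intro j' hj'
  split_ifs with hd
  · have hμ01 : 0 ≤ μ ∧ μ ≤ 1 := hμ j hj ▸ cylProb_mem
    have : ∀ ω ∈ (univ : Finset (Z → K)), ((if Cyl (l j) ω then (1 : ℝ) else 0) - μ)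
          * ((if Cyl (l j') ω then (1 : ℝ) else 0) - μ) ≤ 1 := by
      intro ω _
      split_ifs <;> nlinarith
    refine (sum_le_card_nsmul _ _ _ this).trans ?_
    simp
  · have hn : ((l j ++ l j').map Prod.fst).Nodup := by
      rw [List.map_append, List.nodup_append]
      refine ⟨hl j hj, hl j' hj', ?_⟩
      intro a ha b hb hab
      obtain ⟨p, hp, rfl⟩ := List.mem_map.1 ha
      obtain ⟨p', hp', rfl⟩ := List.mem_map.1 hb
      exact hd ⟨p, hp, p', hp', hab⟩
    have hprod : cylProb (l j ++ l j') = μ * μ := by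
      rw [← hμ j hj]
      nth_rewrite 2 [hμ j hj]
      rw [← hμ j' hj']
      simp [cylProb]
    have e3 : ∀ ω : Z → K, ((if Cyl (l j) ω then (1 : ℝ) else 0) - μ)
          * ((if Cyl (l j') ω then (1 : ℝ) else 0) - μ)
        = (if Cyl (l j ++ l j') ω then (1 : ℝ) else 0)
          - μ * (if Cyl (l j) ω then (1 : ℝ) else 0)
          - μ * (if Cyl (l j') ω then (1 : ℝ) else 0) + μ * μ := by
      intro ω
      have : Cyl (l j ++ l j') ω ↔ Cyl (l j) ω ∧ Cyl (l j') ω := by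
        simp only [Cyl, List.mem_append]
        exact ⟨fun h => ⟨fun p hp => h p (Or.inl hp), fun p hp => h p (Or.inr hp)⟩,
          fun h p hp => hp.elim (h.1 p) (h.2 p)⟩
      by_cases h1 : Cyl (l j) ω <;> by_cases h2 : Cyl (l j') ω <;> simp [this, h1, h2] <;> ring
    simp_rw [e3]
    rw [sum_add_distrib, sum_sub_distrib, sum_sub_distrib, ← mul_sum, ← mul_sum, sum_cyl hn,
      sum_cyl (hl j hj), sum_cyl (hl j' hj'), hprod, hμ j hj, hμ j' hj', sum_const, nsmul_eq_mul,
      card_univ]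
    apply le_of_eq; ring

end SecondMoment

section Moments
variable {V C K : Type} [Fintype V]

lemma card_pairs_fst_le (P : V → V → Prop) [∀ a b, Decidable (P a b)] (x : V) :
    (univ.filter fun p : V × V => p.1 = x ∧ P p.1 p.2).card ≤ (univ.filter fun y => P x y).card := by
  apply card_le_card_of_injOn Prod.snd
  · rintro ⟨a, b⟩ h
    simp only [coe_filter, mem_univ, true_and, Set.mem_ofPred_eq] at h ⊢
    exact h.1 ▸ h.2
  · rintro ⟨a, b⟩ h ⟨a', b'⟩ h' e
    simp only [coe_filter, mem_univ, true_and, Set.mem_ofPred_eq] at h h' e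
    rw [h.1, h'.1, e]

lemma card_pairs_snd_le (P : V → V → Prop) [∀ a b, Decidable (P a b)] (x : V) :
    (univ.filter fun p : V × V => p.2 = x ∧ P p.1 p.2).card ≤ (univ.filter fun y => P y x).card := by
  apply card_le_card_of_injOn Prod.fst
  · rintro ⟨a, b⟩ h
    simp only [coe_filter, mem_univ, true_and, Set.mem_ofPred_eq] at h ⊢
    exact h.1 ▸ h.2
  · rintro ⟨a, b⟩ h ⟨a', b'⟩ h' e
    simp only [coe_filter, mem_univ, true_and, Set.mem_ofPred_eq] at h h' e
    rw [h.1, h'.1, e]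

lemma card_le_four_mul {α : Type*} {s s₁ s₂ s₃ s₄ : Finset α} {M : ℝ}
    (h : ∀ a ∈ s, (a ∈ s₁ ∨ a ∈ s₂) ∨ (a ∈ s₃ ∨ a ∈ s₄)) (h₁ : (s₁.card : ℝ) ≤ M)
    (h₂ : (s₂.card : ℝ) ≤ M) (h₃ : (s₃.card : ℝ) ≤ M) (h₄ : (s₄.card : ℝ) ≤ M) :
    (s.card : ℝ) ≤ 4 * M := by
  have hsub : s ⊆ (s₁ ∪ s₂) ∪ (s₃ ∪ s₄) := fun a ha => by simpa only [mem_union] using h a ha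
  have := (card_le_card hsub).trans ((card_union_le _ _).trans
    (Nat.add_le_add (card_union_le _ _) (card_union_le _ _)))
  refine (Nat.cast_le (α := ℝ).2 this).trans ?_
  push_cast
  linarith

lemma card_le_five_mul {α : Type*} {s s₁ s₂ s₃ s₄ s₅ : Finset α} {M : ℝ}
    (h : ∀ a ∈ s, ((a ∈ s₁ ∨ a ∈ s₂) ∨ (a ∈ s₃ ∨ a ∈ s₄)) ∨ a ∈ s₅) (h₁ : (s₁.card : ℝ) ≤ M)
    (h₂ : (s₂.card : ℝ) ≤ M) (h₃ : (s₃.card : ℝ) ≤ M) (h₄ : (s₄.card : ℝ) ≤ M)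
    (h₅ : (s₅.card : ℝ) ≤ M) :
    (s.card : ℝ) ≤ 5 * M := by
  have hsub : s ⊆ ((s₁ ∪ s₂) ∪ (s₃ ∪ s₄)) ∪ s₅ := fun a ha => by
    simpa only [mem_union] using h a ha
  have h6 := card_le_four_mul (s := (s₁ ∪ s₂) ∪ (s₃ ∪ s₄))
    (fun a ha => by simpa only [mem_union] using ha) h₁ h₂ h₃ h₄
  have := (card_le_card hsub).trans (card_union_le _ _)
  refine (Nat.cast_le (α := ℝ).2 this).trans ?_
  push_cast
  linarith

variable (G : SimpleGraph V) (φ : Sym2 V → C)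

lemma card_pairs_colour_le {M : ℝ}
    (hloc : ∀ v c, ((univ.filter fun u => G.Adj v u ∧ φ s(v, u) = c).card : ℝ) ≤ M) (c : C) :
    ((univ.filter fun p : V × V => G.Adj p.1 p.2 ∧ φ s(p.1, p.2) = c).card : ℝ)
      ≤ Fintype.card V * M := by
  have h : (univ.filter fun p : V × V => G.Adj p.1 p.2 ∧ φ s(p.1, p.2) = c) =
      univ.biUnion fun x => univ.filter fun p : V × V => p.1 = x ∧ (G.Adj p.1 p.2 ∧ φ s(p.1, p.2) = c) := by
    ext p; simp
  rw [h]
  calc _ ≤ ∑ x : V, ((univ.filter fun p : V × V =>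
        p.1 = x ∧ (G.Adj p.1 p.2 ∧ φ s(p.1, p.2) = c)).card : ℝ) := by
        exact_mod_cast card_biUnion_le
    _ ≤ ∑ x : V, M := sum_le_sum fun x _ => le_trans
        (by exact_mod_cast card_pairs_fst_le (fun a b => G.Adj a b ∧ φ s(a, b) = c) x) (hloc x c)
    _ = _ := by simp

variable [Fintype C] [Fintype K] [Nonempty K]

lemma star_moment {M : ℝ}
    (hloc : ∀ v c, ((univ.filter fun u => G.Adj v u ∧ φ s(v, u) = c).card : ℝ) ≤ M)
    (u : V) (A B : Finset K) :
    ∑ ω : V ⊕ C → K, (((univ.filter fun v => G.Adj u v ∧ ω (Sum.inl v) ∈ A ∧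
        ω (Sum.inr (φ s(u, v))) ∈ B).card : ℝ)
        - ((A.card : ℝ) / Fintype.card K * (B.card / Fintype.card K))
          * (univ.filter fun v => G.Adj u v).card) ^ 2
      ≤ Fintype.card (V ⊕ C → K) * (Fintype.card V * M) := by
  have h := sum_cyl_sub_sq_le (univ.filter fun v => G.Adj u v)
    (fun v => [((Sum.inl v : V ⊕ C), A), (Sum.inr (φ s(u, v)), B)])
    (μ := (A.card : ℝ) / Fintype.card K * (B.card / Fintype.card K))
    (fun v _ => by simp) (fun v _ => by simp [cylProb])
  simp only [filter_filter] at h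
  have e : ∀ ω : V ⊕ C → K, (univ.filter fun v => G.Adj u v ∧ ω (Sum.inl v) ∈ A ∧
        ω (Sum.inr (φ s(u, v))) ∈ B) = (univ.filter fun v => G.Adj u v ∧
        Cyl [((Sum.inl v : V ⊕ C), A), (Sum.inr (φ s(u, v)), B)] ω) := by
    intro ω; ext v; simp [Cyl]
  simp_rw [e]
  refine h.trans ?_
  gcongr
  have hM : 0 ≤ M := le_trans (by positivity) (hloc u (φ s(u, u)))
  calc _ ≤ ∑ v ∈ univ.filter (fun v => G.Adj u v), M := by
        apply sum_le_sum
        intro v hv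
        refine le_trans ?_ (hloc u (φ s(u, v)))
        norm_cast
        apply card_le_card
        intro v'
        simp only [mem_filter, mem_univ, true_and, Dep, List.mem_cons, List.not_mem_nil, or_false,
          exists_eq_or_imp, exists_eq_left, Sum.inl.injEq, Sum.inr.injEq, reduceCtorEq, false_or]
        rintro ⟨h1, rfl | h2⟩
        · exact ⟨h1, rfl⟩
        · exact ⟨h1, h2.symm⟩
    _ ≤ _ := by
        rw [sum_const, nsmul_eq_mul]
        gcongr
        exact_mod_cast card_le_univ _

lemma vertex_moment (A : Finset K) :
    ∑ ω : V ⊕ C → K, (((univ.filter fun v => ω (Sum.inl v) ∈ A).card : ℝ)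
        - ((A.card : ℝ) / Fintype.card K) * Fintype.card V) ^ 2
      ≤ Fintype.card (V ⊕ C → K) * Fintype.card V := by
  have h := sum_cyl_sub_sq_le (univ : Finset V)
    (fun v => [((Sum.inl v : V ⊕ C), A)])
    (μ := (A.card : ℝ) / Fintype.card K)
    (fun v _ => by simp) (fun v _ => by simp [cylProb])
  simp only [Cyl, List.mem_singleton, forall_eq, Dep, exists_eq_left, Sum.inl.injEq, card_univ] at h
  refine h.trans (le_of_eq ?_)
  simp [filter_eq]

lemma codeg_moment {M : ℝ}
    (hloc : ∀ v c, ((univ.filter fun u => G.Adj v u ∧ φ s(v, u) = c).card : ℝ) ≤ M)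
    (x x' : V) (A : Finset K) :
    ∑ ω : V ⊕ C → K, (((univ.filter fun w => (G.Adj x w ∧ G.Adj x' w ∧ φ s(x, w) ≠ φ s(x', w)) ∧
        ω (Sum.inr (φ s(x, w))) ∈ A ∧ ω (Sum.inr (φ s(x', w))) ∈ A).card : ℝ)
        - ((A.card : ℝ) / Fintype.card K * (A.card / Fintype.card K))
          * (univ.filter fun w => G.Adj x w ∧ G.Adj x' w ∧ φ s(x, w) ≠ φ s(x', w)).card) ^ 2
      ≤ Fintype.card (V ⊕ C → K) * (Fintype.card V * (4 * M)) := by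
  have h := sum_cyl_sub_sq_le
    (univ.filter fun w => G.Adj x w ∧ G.Adj x' w ∧ φ s(x, w) ≠ φ s(x', w))
    (fun w => [((Sum.inr (φ s(x, w)) : V ⊕ C), A), (Sum.inr (φ s(x', w)), A)])
    (μ := (A.card : ℝ) / Fintype.card K * (A.card / Fintype.card K))
    (fun w hw => by simpa using (mem_filter.1 hw).2.2.2) (fun v _ => by simp [cylProb])
  simp only [filter_filter] at h
  have e : ∀ ω : V ⊕ C → K, (univ.filter fun w =>
        (G.Adj x w ∧ G.Adj x' w ∧ φ s(x, w) ≠ φ s(x', w)) ∧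
        ω (Sum.inr (φ s(x, w))) ∈ A ∧ ω (Sum.inr (φ s(x', w))) ∈ A) =
      (univ.filter fun w => (G.Adj x w ∧ G.Adj x' w ∧ φ s(x, w) ≠ φ s(x', w)) ∧
        Cyl [((Sum.inr (φ s(x, w)) : V ⊕ C), A), (Sum.inr (φ s(x', w)), A)] ω) := by
    intro ω; ext v; simp [Cyl]
  simp_rw [e]
  refine h.trans ?_
  gcongr
  have hM : 0 ≤ M := le_trans (by positivity) (hloc x (φ s(x, x)))
  calc _ ≤ ∑ w ∈ univ.filter (fun w => G.Adj x w ∧ G.Adj x' w ∧ φ s(x, w) ≠ φ s(x', w)), 4 * M := by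
        apply sum_le_sum
        intro w hw
        refine card_le_four_mul (fun w' => ?_) (hloc x (φ s(x, w))) (hloc x' (φ s(x, w)))
          (hloc x (φ s(x', w))) (hloc x' (φ s(x', w)))
        simp only [mem_filter, mem_univ, true_and, Dep, List.mem_cons, List.not_mem_nil, or_false,
          exists_eq_or_imp, exists_eq_left, Sum.inr.injEq]
        tauto
    _ ≤ _ := by
        rw [sum_const, nsmul_eq_mul]
        gcongr
        exact_mod_cast card_le_univ _

lemma colour_moment {M : ℝ}
    (hloc : ∀ v c, ((univ.filter fun u => G.Adj v u ∧ φ s(v, u) = c).card : ℝ) ≤ M)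
    (c : C) (A B : Finset K) :
    ∑ ω : V ⊕ C → K, (((univ.filter fun p : V × V => (G.Adj p.1 p.2 ∧ φ s(p.1, p.2) = c) ∧
        ω (Sum.inl p.1) ∈ A ∧ ω (Sum.inl p.2) ∈ B).card : ℝ)
        - ((A.card : ℝ) / Fintype.card K * (B.card / Fintype.card K))
          * (univ.filter fun p : V × V => G.Adj p.1 p.2 ∧ φ s(p.1, p.2) = c).card) ^ 2
      ≤ Fintype.card (V ⊕ C → K) * 
        ((univ.filter fun p : V × V => G.Adj p.1 p.2 ∧ φ s(p.1, p.2) = c).card * (4 * M)) := by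
  have h := sum_cyl_sub_sq_le (univ.filter fun p : V × V => G.Adj p.1 p.2 ∧ φ s(p.1, p.2) = c)
    (fun p => [((Sum.inl p.1 : V ⊕ C), A), (Sum.inl p.2, B)])
    (μ := (A.card : ℝ) / Fintype.card K * (B.card / Fintype.card K))
    (fun p hp => by simpa using (mem_filter.1 hp).2.1.ne) (fun v _ => by simp [cylProb])
  simp only [filter_filter] at h
  have e : ∀ ω : V ⊕ C → K, (univ.filter fun p : V × V => (G.Adj p.1 p.2 ∧ φ s(p.1, p.2) = c) ∧
        ω (Sum.inl p.1) ∈ A ∧ ω (Sum.inl p.2) ∈ B) = (univ.filter fun p : V × V =>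
          (G.Adj p.1 p.2 ∧ φ s(p.1, p.2) = c) ∧
        Cyl [((Sum.inl p.1 : V ⊕ C), A), (Sum.inl p.2, B)] ω) := by
    intro ω; ext v; simp [Cyl]
  simp_rw [e]
  refine h.trans ?_
  gcongr
  rw [← nsmul_eq_mul]
  apply sum_le_card_nsmul
  intro p hp
  have hf : ∀ x, ((univ.filter fun p : V × V => p.1 = x ∧ G.Adj p.1 p.2 ∧ φ s(p.1, p.2) = c).card : ℝ)
      ≤ M := fun x => le_trans
        (by exact_mod_cast card_pairs_fst_le (fun a b => G.Adj a b ∧ φ s(a, b) = c) x) (hloc x c)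
  have hg : ∀ x, ((univ.filter fun p : V × V => p.2 = x ∧ G.Adj p.1 p.2 ∧ φ s(p.1, p.2) = c).card : ℝ)
      ≤ M := by
    intro x
    have h1 := hloc x c
    simp_rw [G.adj_comm x, Sym2.eq_swap (a := x)] at h1
    refine le_trans ?_ h1
    exact_mod_cast card_pairs_snd_le (fun a b => G.Adj a b ∧ φ s(a, b) = c) x
  refine card_le_four_mul (fun p' => ?_) (hf p.1) (hg p.1) (hf p.2) (hg p.2)
  simp only [mem_filter, mem_univ, true_and, Dep, List.mem_cons, List.not_mem_nil, or_false,
    exists_eq_or_imp, exists_eq_left, Sum.inl.injEq]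
  rintro ⟨h0, (h1 | h1) | (h1 | h1)⟩
  · exact Or.inl (Or.inl ⟨h1.symm, h0⟩)
  · exact Or.inl (Or.inr ⟨h1.symm, h0⟩)
  · exact Or.inr (Or.inl ⟨h1.symm, h0⟩)
  · exact Or.inr (Or.inr ⟨h1.symm, h0⟩)

lemma pair_moment {M : ℝ} (hM1 : 1 ≤ M)
    (hloc : ∀ v c, ((univ.filter fun u => G.Adj v u ∧ φ s(v, u) = c).card : ℝ) ≤ M)
    (A B D : Finset K) :
    ∑ ω : V ⊕ C → K, (((univ.filter fun p : V × V => G.Adj p.1 p.2 ∧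
        ω (Sum.inl p.1) ∈ A ∧ ω (Sum.inl p.2) ∈ B ∧ ω (Sum.inr (φ s(p.1, p.2))) ∈ D).card : ℝ)
        - ((A.card : ℝ) / Fintype.card K * (B.card / Fintype.card K * (D.card / Fintype.card K)))
          * (univ.filter fun p : V × V => G.Adj p.1 p.2).card) ^ 2
      ≤ Fintype.card (V ⊕ C → K) * (Fintype.card V ^ 3 * (5 * M)) := by
  have h := sum_cyl_sub_sq_le (univ.filter fun p : V × V => G.Adj p.1 p.2)
    (fun p => [((Sum.inl p.1 : V ⊕ C), A), (Sum.inl p.2, B), (Sum.inr (φ s(p.1, p.2)), D)])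
    (μ := (A.card : ℝ) / Fintype.card K * (B.card / Fintype.card K * (D.card / Fintype.card K)))
    (fun p hp => by simpa using (mem_filter.1 hp).2.ne) (fun v _ => by simp [cylProb])
  simp only [filter_filter] at h
  have e : ∀ ω : V ⊕ C → K, (univ.filter fun p : V × V => G.Adj p.1 p.2 ∧
        ω (Sum.inl p.1) ∈ A ∧ ω (Sum.inl p.2) ∈ B ∧ ω (Sum.inr (φ s(p.1, p.2))) ∈ D) =
      (univ.filter fun p : V × V => G.Adj p.1 p.2 ∧
        Cyl [((Sum.inl p.1 : V ⊕ C), A), (Sum.inl p.2, B), (Sum.inr (φ s(p.1, p.2)), D)] ω) := by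
    intro ω; ext v; simp [Cyl]
  simp_rw [e]
  refine h.trans ?_
  gcongr
  have hN : (0 : ℝ) ≤ Fintype.card V := by positivity
  have hpt : ∀ p ∈ univ.filter (fun p : V × V => G.Adj p.1 p.2),
      ((univ.filter fun p' : V × V => G.Adj p'.1 p'.2 ∧
      Dep [((Sum.inl p.1 : V ⊕ C), A), (Sum.inl p.2, B), (Sum.inr (φ s(p.1, p.2)), D)]
        [((Sum.inl p'.1 : V ⊕ C), A), (Sum.inl p'.2, B), (Sum.inr (φ s(p'.1, p'.2)), D)]).card : ℝ)
      ≤ Fintype.card V * (5 * M) := by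
    intro p hp
    have hf : ∀ x, ((univ.filter fun p : V × V => p.1 = x ∧ True).card : ℝ)
        ≤ Fintype.card V * M := fun x => le_trans (b := (Fintype.card V : ℝ))
          (by exact_mod_cast (card_pairs_fst_le (fun _ _ => True) x).trans (card_le_univ _))
          (le_mul_of_one_le_right hN hM1)
    have hg : ∀ x, ((univ.filter fun p : V × V => p.2 = x ∧ True).card : ℝ)
        ≤ Fintype.card V * M := fun x => le_trans (b := (Fintype.card V : ℝ))
          (by exact_mod_cast (card_pairs_snd_le (fun _ _ => True) x).trans (card_le_univ _))
          (le_mul_of_one_le_right hN hM1)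
    rw [mul_left_comm]
    refine card_le_five_mul (fun p' => ?_) (hf p.1) (hg p.1) (hf p.2) (hg p.2)
      (card_pairs_colour_le G φ hloc (φ s(p.1, p.2)))
    simp only [mem_filter, mem_univ, true_and, Dep, List.mem_cons, List.not_mem_nil, or_false,
      exists_eq_or_imp, exists_eq_left, Sum.inl.injEq, Sum.inr.injEq, reduceCtorEq, false_or,
      and_true]
    rintro ⟨h0, (h1 | h1) | (h1 | h1) | h1⟩
    · exact Or.inl (Or.inl (Or.inl h1.symm))
    · exact Or.inl (Or.inl (Or.inr h1.symm))
    · exact Or.inl (Or.inr (Or.inl h1.symm))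
    · exact Or.inl (Or.inr (Or.inr h1.symm))
    · exact Or.inr ⟨h0, h1.symm⟩
  refine (sum_le_card_nsmul _ _ _ hpt).trans ?_
  rw [nsmul_eq_mul]
  have : ((univ.filter fun p : V × V => G.Adj p.1 p.2).card : ℝ) ≤ Fintype.card V ^ 2 := by
    have := card_le_univ (univ.filter fun p : V × V => G.Adj p.1 p.2)
    rw [Fintype.card_prod] at this
    rw [sq]; exact_mod_cast this
  calc _ ≤ (Fintype.card V : ℝ) ^ 2 * (Fintype.card V * (5 * M)) := by gcongr
    _ = _ := by ring

end Moments

section Labelling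
variable {V C : Type} [Fintype V] [Fintype C]

lemma card_label_fst (q L : ℕ) [NeZero q] [NeZero L] (a : ZMod q) :
    (((univ.filter fun k : ZMod q × Fin L => k.1 = a ∧ k.2 ≠ 0).card : ℝ)
      / Fintype.card (ZMod q × Fin L)) = (1 - 1 / L) / q := by
  have h : (univ.filter fun k : ZMod q × Fin L => k.1 = a ∧ k.2 ≠ 0)
      = {a} ×ˢ (univ.erase 0) := by
    ext ⟨x, y⟩; simp only [mem_filter, mem_univ, true_and, mem_product, mem_singleton, mem_erase, and_true, ne_eq]
  have hL : (L : ℝ) ≠ 0 := NeZero.ne _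
  have hq : (q : ℝ) ≠ 0 := NeZero.ne _
  have h1 : ((L - 1 : ℕ) : ℝ) = L - 1 := by
    rw [Nat.cast_sub (Nat.one_le_iff_ne_zero.2 (NeZero.ne L))]; simp
  rw [h, card_product, card_erase_of_mem (mem_univ _)]
  simp only [card_singleton, one_mul, card_univ, Fintype.card_fin, Fintype.card_prod, ZMod.card, Nat.cast_mul, h1]
  field_simp

lemma card_label_zero (q L : ℕ) [NeZero q] [NeZero L] :
    (((univ.filter fun k : ZMod q × Fin L => k.2 = 0).card : ℝ)
      / Fintype.card (ZMod q × Fin L)) = 1 / L := by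
  have h : (univ.filter fun k : ZMod q × Fin L => k.2 = 0)
      = univ ×ˢ {0} := by
    ext ⟨x, y⟩; simp only [mem_filter, mem_univ, true_and, mem_product, mem_singleton]
  have hL : (L : ℝ) ≠ 0 := NeZero.ne _
  have hq : (q : ℝ) ≠ 0 := NeZero.ne _
  rw [h, card_product]
  simp only [card_singleton, card_univ, Fintype.card_fin, Fintype.card_prod, ZMod.card]
  push_cast
  field_simp

lemma card_label_ne_zero (q L : ℕ) [NeZero q] [NeZero L] :
    (((univ.filter fun k : ZMod q × Fin L => k.2 ≠ 0).card : ℝ)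
      / Fintype.card (ZMod q × Fin L)) = 1 - 1 / L := by
  have h : (univ.filter fun k : ZMod q × Fin L => k.2 ≠ 0)
      = univ ×ˢ (univ.erase 0) := by
    ext ⟨x, y⟩; simp
  have hL : (L : ℝ) ≠ 0 := NeZero.ne _
  have hq : (q : ℝ) ≠ 0 := NeZero.ne _
  have h1 : ((L - 1 : ℕ) : ℝ) = L - 1 := by
    rw [Nat.cast_sub (Nat.one_le_iff_ne_zero.2 (NeZero.ne L))]; simp
  rw [h, card_product, card_erase_of_mem (mem_univ _)]
  simp only [card_univ, Fintype.card_fin, Fintype.card_prod, ZMod.card, Nat.cast_mul, h1]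
  field_simp

variable (G : SimpleGraph V) (φ : Sym2 V → C)

/-- Deviation of the degrees into each label class through non-reserved colours, for a labelling of
the vertices (by `ZMod q` and a reserve set `R`) and of the colours (by a reserve set `S`). -/
noncomputable def starDev (q : ℕ) [NeZero q] (μ : ℝ) (ρ : V → ZMod q) (R : V → Prop) (S : C → Prop) : ℝ :=
  ∑ u, ∑ a, (((univ.filter fun v => G.Adj u v ∧ (ρ v = a ∧ ¬ R v) ∧ ¬ S (φ s(u, v))).card : ℝ)
    - μ * (univ.filter fun v => G.Adj u v).card) ^ 2

/-- Deviation of the number of ordered pairs of each colour with prescribed end labels. -/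
noncomputable def colourDev₂ (q : ℕ) [NeZero q] (μ : ℝ) (ρ : V → ZMod q) (R : V → Prop) : ℝ :=
  ∑ c, ∑ a, ∑ b, (((univ.filter fun p : V × V => (G.Adj p.1 p.2 ∧ φ s(p.1, p.2) = c) ∧
      (ρ p.1 = a ∧ ¬ R p.1) ∧ (ρ p.2 = b ∧ ¬ R p.2)).card : ℝ)
    - μ * (univ.filter fun p : V × V => G.Adj p.1 p.2 ∧ φ s(p.1, p.2) = c).card) ^ 2

/-- Deviation of the number of non-reserved adjacent pairs with prescribed end labels. -/
noncomputable def pairDev (q : ℕ) [NeZero q] (μ : ℝ) (ρ : V → ZMod q) (R : V → Prop) (S : C → Prop) : ℝ :=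
  ∑ a, ∑ b, (((univ.filter fun p : V × V => G.Adj p.1 p.2 ∧
      (ρ p.1 = a ∧ ¬ R p.1) ∧ (ρ p.2 = b ∧ ¬ R p.2) ∧ ¬ S (φ s(p.1, p.2))).card : ℝ)
    - μ * (univ.filter fun p : V × V => G.Adj p.1 p.2).card) ^ 2

/-- Deviation of the degrees into the reserve through reserved colours. -/
noncomputable def reserveDev (μ : ℝ) (R : V → Prop) (S : C → Prop) : ℝ :=
  ∑ u, (((univ.filter fun v => G.Adj u v ∧ R v ∧ S (φ s(u, v))).card : ℝ)
    - μ * (univ.filter fun v => G.Adj u v).card) ^ 2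

/-- Deviation of the degrees through the colours in `S`. -/
noncomputable def degDev (μ : ℝ) (S : C → Prop) : ℝ :=
  ∑ u, (((univ.filter fun v => G.Adj u v ∧ S (φ s(u, v))).card : ℝ)
    - μ * (univ.filter fun v => G.Adj u v).card) ^ 2

/-- Deviation of the codegrees through the colours in `S`. -/
noncomputable def codegDev (μ : ℝ) (S : C → Prop) : ℝ :=
  ∑ x, ∑ x', (((univ.filter fun w => (G.Adj x w ∧ G.Adj x' w ∧ φ s(x, w) ≠ φ s(x', w)) ∧
      S (φ s(x, w)) ∧ S (φ s(x', w))).card : ℝ)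
    - μ * (univ.filter fun w => G.Adj x w ∧ G.Adj x' w ∧ φ s(x, w) ≠ φ s(x', w)).card) ^ 2

lemma exists_labelling_aux (q L : ℕ) [NeZero q] [NeZero L] {M : ℝ} (hM1 : 1 ≤ M)
    (hV : 0 < Fintype.card V)
    (hloc : ∀ v c, ((univ.filter fun u => G.Adj v u ∧ φ s(v, u) = c).card : ℝ) ≤ M) :
    ∃ (ρ : V → ZMod q) (R : V → Prop) (S : C → Prop),
      starDev G φ q ((1 - 1 / L) / q * (1 - 1 / L)) ρ R S ≤ 17 * q ^ 2 * M * Fintype.card V ^ 2 ∧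
      colourDev₂ G φ q ((1 - 1 / L) / q * ((1 - 1 / L) / q)) ρ R
        ≤ 17 * q ^ 2 * M * Fintype.card V ^ 2 ∧
      pairDev G φ q ((1 - 1 / L) / q * ((1 - 1 / L) / q * (1 - 1 / L))) ρ R S
        ≤ 17 * q ^ 2 * M * Fintype.card V ^ 3 ∧
      reserveDev G φ (1 / L * (1 / L)) R S ≤ 17 * q ^ 2 * M * Fintype.card V ^ 2 ∧
      degDev G φ (1 / L) S ≤ 17 * q ^ 2 * M * Fintype.card V ^ 2 ∧
      codegDev G φ (1 / L * (1 / L)) S ≤ 17 * q ^ 2 * M * Fintype.card V ^ 3 ∧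
      (((univ.filter fun v => ¬ R v).card : ℝ) - (1 - 1 / L) * Fintype.card V) ^ 2
        ≤ 17 * q ^ 2 * M * Fintype.card V := by
  obtain ⟨n, hn⟩ : ∃ n : ℝ, n = Fintype.card V := ⟨_, rfl⟩
  have hn0 : 0 < n := by rw [hn]; exact_mod_cast hV
  obtain ⟨N, hN⟩ : ∃ N : ℝ, N = Fintype.card (V ⊕ C → ZMod q × Fin L) := ⟨_, rfl⟩
  have hN0 : 0 < N := by
    have : Nonempty (V ⊕ C → ZMod q × Fin L) := ⟨fun _ => (0, 0)⟩
    rw [hN]; exact_mod_cast Fintype.card_pos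
  obtain ⟨ρ, hρ⟩ : ∃ ρ : (V ⊕ C → ZMod q × Fin L) → V → ZMod q, ∀ ω v, (ω (Sum.inl v)).1 = ρ ω v :=
    ⟨_, fun _ _ => rfl⟩
  obtain ⟨R, hR⟩ : ∃ R : (V ⊕ C → ZMod q × Fin L) → V → Prop,
    ∀ ω v, (ω (Sum.inl v)).2 = 0 ↔ R ω v := ⟨_, fun _ _ => Iff.rfl⟩
  obtain ⟨S, hS⟩ : ∃ S : (V ⊕ C → ZMod q × Fin L) → C → Prop,
    ∀ ω v, (ω (Sum.inr v)).2 = 0 ↔ S ω v := ⟨_, fun _ _ => Iff.rfl⟩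
  rw [← hn]
  have h1 : ∑ ω, starDev G φ q ((1 - 1 / L) / q * (1 - 1 / L)) (ρ ω) (R ω) (S ω)
      ≤ N * (q * n ^ 2 * M) := by
    unfold starDev
    rw [sum_comm]
    calc _ ≤ ∑ u : V, ∑ a : ZMod q, N * (n * M) := by
          refine sum_le_sum fun u _ => ?_
          rw [sum_comm]
          refine sum_le_sum fun a _ => ?_
          have := star_moment G φ hloc u (univ.filter fun k : ZMod q × Fin L => k.1 = a ∧ k.2 ≠ 0)
            (univ.filter fun k : ZMod q × Fin L => k.2 ≠ 0)
          rw [card_label_fst, card_label_ne_zero] at this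
          rw [← hN, ← hn] at this
          simpa [hρ, hR, hS] using this
      _ = _ := by simp [ZMod.card, ← hn]; ring
  have h2 : ∑ ω, colourDev₂ G φ q ((1 - 1 / L) / q * ((1 - 1 / L) / q)) (ρ ω) (R ω)
      ≤ N * (4 * q ^ 2 * n ^ 2 * M) := by
    unfold colourDev₂
    rw [sum_comm]
    calc _ ≤ ∑ c : C, ∑ a : ZMod q, ∑ b : ZMod q, N *
          ((univ.filter fun p : V × V => G.Adj p.1 p.2 ∧ φ s(p.1, p.2) = c).card * (4 * M)) := by
          refine sum_le_sum fun u _ => ?_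
          rw [sum_comm]
          refine sum_le_sum fun a _ => ?_
          rw [sum_comm]
          refine sum_le_sum fun b _ => ?_
          have := colour_moment G φ hloc u (univ.filter fun k : ZMod q × Fin L => k.1 = a ∧ k.2 ≠ 0)
            (univ.filter fun k : ZMod q × Fin L => k.1 = b ∧ k.2 ≠ 0)
          rw [card_label_fst, card_label_fst] at this
          rw [← hN] at this
          simpa [hρ, hR, hS] using this
      _ = N * (4 * q ^ 2 * M) * ∑ c : C,
          ((univ.filter fun p : V × V => G.Adj p.1 p.2 ∧ φ s(p.1, p.2) = c).card : ℝ) := by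
          rw [mul_sum]
          refine sum_congr rfl fun c _ => ?_
          simp [ZMod.card]; ring
      _ ≤ N * (4 * q ^ 2 * M) * n ^ 2 := by
          refine mul_le_mul_of_nonneg_left ?_ (by positivity)
          have : ∑ c : C, (univ.filter fun p : V × V => G.Adj p.1 p.2 ∧ φ s(p.1, p.2) = c).card
              = (univ.filter fun p : V × V => G.Adj p.1 p.2).card := by
            rw [card_eq_sum_card_fiberwise (f := fun p : V × V => φ s(p.1, p.2)) (t := univ)
              (fun _ _ => mem_coe.2 (mem_univ _))]
            simp only [filter_filter]
          have h3 : (univ.filter fun p : V × V => G.Adj p.1 p.2).card ≤ Fintype.card V ^ 2 := by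
            refine (card_filter_le _ _).trans ?_
            simp [sq]
          rw [hn]
          exact_mod_cast this.le.trans h3
      _ = _ := by ring
  have h3 : ∑ ω, pairDev G φ q ((1 - 1 / L) / q * ((1 - 1 / L) / q * (1 - 1 / L))) (ρ ω) (R ω) (S ω)
      ≤ N * (5 * q ^ 2 * n ^ 3 * M) := by
    unfold pairDev
    rw [sum_comm]
    calc _ ≤ ∑ a : ZMod q, ∑ b : ZMod q, N * (n ^ 3 * (5 * M)) := by
          refine sum_le_sum fun a _ => ?_
          rw [sum_comm]
          refine sum_le_sum fun b _ => ?_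
          have := pair_moment G φ hM1 hloc (univ.filter fun k : ZMod q × Fin L => k.1 = a ∧ k.2 ≠ 0)
            (univ.filter fun k : ZMod q × Fin L => k.1 = b ∧ k.2 ≠ 0) (univ.filter fun k : ZMod q × Fin L => k.2 ≠ 0)
          rw [card_label_fst, card_label_fst, card_label_ne_zero] at this
          rw [← hN, ← hn] at this
          simpa [hρ, hR, hS] using this
      _ = _ := by simp [ZMod.card]; ring
  have h4 : ∑ ω, reserveDev G φ (1 / L * (1 / L)) (R ω) (S ω) ≤ N * (n ^ 2 * M) := by
    unfold reserveDev
    rw [sum_comm]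
    calc _ ≤ ∑ u : V, N * (n * M) := by
          refine sum_le_sum fun u _ => ?_
          have := star_moment G φ hloc u (univ.filter fun k : ZMod q × Fin L => k.2 = 0)
            (univ.filter fun k : ZMod q × Fin L => k.2 = 0)
          rw [card_label_zero] at this
          rw [← hN, ← hn] at this
          simpa [hρ, hR, hS] using this
      _ = _ := by simp [← hn]; ring
  have h5 : ∑ ω, degDev G φ (1 / L) (S ω) ≤ N * (n ^ 2 * M) := by
    unfold degDev
    rw [sum_comm]
    calc _ ≤ ∑ u : V, N * (n * M) := by
          refine sum_le_sum fun u _ => ?_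
          have := star_moment G φ hloc u (univ : Finset (ZMod q × Fin L))
            (univ.filter fun k : ZMod q × Fin L => k.2 = 0)
          rw [card_label_zero, card_univ, div_self (by simp [NeZero.ne q, NeZero.ne L])] at this
          rw [← hN, ← hn] at this
          simpa [hρ, hR, hS] using this
      _ = _ := by simp [← hn]; ring
  have h6 : ∑ ω, codegDev G φ (1 / L * (1 / L)) (S ω) ≤ N * (4 * n ^ 3 * M) := by
    unfold codegDev
    rw [sum_comm]
    calc _ ≤ ∑ x : V, ∑ x' : V, N * (n * (4 * M)) := by
          refine sum_le_sum fun x _ => ?_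
          rw [sum_comm]
          refine sum_le_sum fun x' _ => ?_
          have := codeg_moment G φ hloc x x' (univ.filter fun k : ZMod q × Fin L => k.2 = 0)
          rw [card_label_zero] at this
          rw [← hN, ← hn] at this
          simpa [hρ, hR, hS] using this
      _ = _ := by simp [← hn]; ring
  have h7 : ∑ ω, (((univ.filter fun v => ¬ R ω v).card : ℝ) - (1 - 1 / L) * n) ^ 2 ≤ N * n := by
    have := vertex_moment (V := V) (C := C) (univ.filter fun k : ZMod q × Fin L => k.2 ≠ 0)
    rw [card_label_ne_zero] at this
    rw [← hN, ← hn] at this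
    simpa [hρ, hR, hS] using this
  have hex : ∃ ω, n * starDev G φ q ((1 - 1 / L) / q * (1 - 1 / L)) (ρ ω) (R ω) (S ω)
      + n * colourDev₂ G φ q ((1 - 1 / L) / q * ((1 - 1 / L) / q)) (ρ ω) (R ω)
      + pairDev G φ q ((1 - 1 / L) / q * ((1 - 1 / L) / q * (1 - 1 / L))) (ρ ω) (R ω) (S ω)
      + n * reserveDev G φ (1 / L * (1 / L)) (R ω) (S ω)
      + n * degDev G φ (1 / L) (S ω)
      + codegDev G φ (1 / L * (1 / L)) (S ω)
      + n ^ 2 * (((univ.filter fun v => ¬ R ω v).card : ℝ) - (1 - 1 / L) * n) ^ 2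
      ≤ 17 * q ^ 2 * M * n ^ 3 := by
    have hne : (univ : Finset (V ⊕ C → ZMod q × Fin L)).Nonempty := ⟨fun _ => (0, 0), mem_univ _⟩
    by_contra! hcon
    have hlt := sum_lt_sum_of_nonempty hne (fun ω _ => hcon ω)
    simp only [sum_add_distrib, ← mul_sum, sum_const, card_univ, nsmul_eq_mul, ← hN] at hlt
    have e1 := mul_le_mul_of_nonneg_left h1 hn0.le
    have e2 := mul_le_mul_of_nonneg_left h2 hn0.le
    have e4 := mul_le_mul_of_nonneg_left h4 hn0.le
    have e5 := mul_le_mul_of_nonneg_left h5 hn0.le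
    have e7 := mul_le_mul_of_nonneg_left h7 (sq_nonneg n)
    have hq1 : (1 : ℝ) ≤ q := by exact_mod_cast Nat.one_le_iff_ne_zero.2 (NeZero.ne q)
    have hq2 : (q : ℝ) ≤ q ^ 2 := by nlinarith
    have : q + 9 * (q : ℝ) ^ 2 + 6 + 1 / M ≤ 17 * q ^ 2 := by
      have : 1 / M ≤ 1 := by rw [div_le_one (by linarith)]; exact hM1
      linarith
    have h8 := mul_le_mul_of_nonneg_left this (a := N * n ^ 3 * M) (by positivity)
    have h9 : M * (1 / M) = 1 := by field_simp
    have h10 : N * n ^ 3 * M * (q + 9 * (q : ℝ) ^ 2 + 6 + 1 / M) =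
        N * n ^ 3 * M * (q + 9 * (q : ℝ) ^ 2 + 6) + N * n ^ 3 := by
      linear_combination (N * n ^ 3) * h9
    rw [h10] at h8
    refine absurd hlt (not_lt.2 ?_)
    refine (add_le_add (add_le_add (add_le_add (add_le_add (add_le_add (add_le_add e1 e2) h3) e4)
        e5) h6) e7).trans ?_
    refine (le_of_eq ?_).trans (h8.trans (le_of_eq ?_)) <;> ring
  obtain ⟨ω, h⟩ := hex
  have p1 : 0 ≤ starDev G φ q ((1 - 1 / L) / q * (1 - 1 / L)) (ρ ω) (R ω) (S ω) := by
    exact sum_nonneg fun _ _ => sum_nonneg fun _ _ => sq_nonneg _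
  have p2 : 0 ≤ colourDev₂ G φ q ((1 - 1 / L) / q * ((1 - 1 / L) / q)) (ρ ω) (R ω) := by
    exact sum_nonneg fun _ _ => sum_nonneg fun _ _ => sum_nonneg fun _ _ => sq_nonneg _
  have p3 : 0 ≤ pairDev G φ q ((1 - 1 / L) / q * ((1 - 1 / L) / q * (1 - 1 / L))) (ρ ω) (R ω) (S ω) := by
    exact sum_nonneg fun _ _ => sum_nonneg fun _ _ => sq_nonneg _
  have p4 : 0 ≤ reserveDev G φ (1 / L * (1 / L)) (R ω) (S ω) := by exact sum_nonneg fun _ _ => sq_nonneg _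
  have p5 : 0 ≤ degDev G φ (1 / L) (S ω) := by exact sum_nonneg fun _ _ => sq_nonneg _
  have p6 : 0 ≤ codegDev G φ (1 / L * (1 / L)) (S ω) := by exact sum_nonneg fun _ _ => sum_nonneg fun _ _ => sq_nonneg _
  have p7 : 0 ≤ (((univ.filter fun v => ¬ R ω v).card : ℝ) - (1 - 1 / L) * n) ^ 2 := sq_nonneg _
  have r1 := mul_nonneg hn0.le p1
  have r2 := mul_nonneg hn0.le p2
  have r4 := mul_nonneg hn0.le p4
  have r5 := mul_nonneg hn0.le p5
  have r7 := mul_nonneg (sq_nonneg n) p7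
  refine ⟨ρ ω, R ω, S ω, ?_, ?_, ?_, ?_, ?_, ?_, ?_⟩
  · refine le_of_mul_le_mul_left ?_ hn0
    linarith
  · refine le_of_mul_le_mul_left ?_ hn0
    linarith
  · linarith
  · refine le_of_mul_le_mul_left ?_ hn0
    linarith
  · refine le_of_mul_le_mul_left ?_ hn0
    linarith
  · linarith
  · refine le_of_mul_le_mul_left ?_ (pow_pos hn0 2)
    linarith

end Labelling

section Labelling
variable {V C : Type} [Fintype V]
variable (G : SimpleGraph V) (φ : Sym2 V → C)

/-- Deviation, over colours and differences of labels, of the number of non-reserved ordered pairs. -/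
noncomputable def colourDev [Fintype C] (q : ℕ) [NeZero q] (μ : ℝ) (ρ : V → ZMod q) (R : V → Prop) : ℝ :=
  ∑ c, ∑ l, (((univ.filter fun p : V × V => (G.Adj p.1 p.2 ∧ φ s(p.1, p.2) = c) ∧
      ρ p.2 = ρ p.1 + l ∧ ¬ R p.1 ∧ ¬ R p.2).card : ℝ)
    - μ * (univ.filter fun p : V × V => G.Adj p.1 p.2 ∧ φ s(p.1, p.2) = c).card) ^ 2

/-- The ordered pairs of adjacent vertices that are available for the main (non-reserved) part. -/
noncomputable def mainPairs {q : ℕ} (ρ : V → ZMod q) (R : V → Prop) (S : C → Prop) :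
    Finset (V × V) :=
  univ.filter fun p : V × V => G.Adj p.1 p.2 ∧ (ρ p.1 ≠ ρ p.2 ∧ ρ p.2 ≠ 0) ∧ ¬ R p.1 ∧ ¬ R p.2 ∧
    ¬ S (φ s(p.1, p.2))

lemma colourDev_le [Fintype C] (q : ℕ) [NeZero q] (μ : ℝ) (ρ : V → ZMod q) (R : V → Prop) :
    colourDev G φ q (q * μ) ρ R ≤ q * colourDev₂ G φ q μ ρ R := by
  unfold colourDev colourDev₂
  rw [mul_sum]
  refine sum_le_sum fun c _ => ?_
  set m : ℝ := ((univ.filter fun p : V × V => G.Adj p.1 p.2 ∧ φ s(p.1, p.2) = c).card : ℝ)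
  have h1 : ∀ l : ZMod q, (((univ.filter fun p : V × V => (G.Adj p.1 p.2 ∧ φ s(p.1, p.2) = c) ∧
      ρ p.2 = ρ p.1 + l ∧ ¬ R p.1 ∧ ¬ R p.2).card : ℝ) - q * μ * m)
      = ∑ a, (((univ.filter fun p : V × V => (G.Adj p.1 p.2 ∧ φ s(p.1, p.2) = c) ∧
      (ρ p.1 = a ∧ ¬ R p.1) ∧ (ρ p.2 = a + l ∧ ¬ R p.2)).card : ℝ) - μ * m) := by
    intro l
    rw [sum_sub_distrib]
    congr 1
    · rw [card_eq_sum_card_fiberwise (f := fun p : V × V => ρ p.1) (t := univ)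
              (fun _ _ => mem_coe.2 (mem_univ _))]
      push_cast
      refine sum_congr rfl fun a _ => ?_
      congr 2
      ext p
      simp only [mem_filter, mem_univ, true_and]
      constructor
      · rintro ⟨⟨h1, h2, h3, h4⟩, rfl⟩; exact ⟨h1, ⟨rfl, h3⟩, h2, h4⟩
      · rintro ⟨h1, ⟨rfl, h3⟩, h2, h4⟩; exact ⟨⟨h1, h2, h3, h4⟩, rfl⟩
    · simp [ZMod.card, mul_assoc]
  calc _ ≤ ∑ l : ZMod q, (q : ℝ) * ∑ a, (((univ.filter fun p : V × V =>
      (G.Adj p.1 p.2 ∧ φ s(p.1, p.2) = c) ∧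
      (ρ p.1 = a ∧ ¬ R p.1) ∧ (ρ p.2 = a + l ∧ ¬ R p.2)).card : ℝ) - μ * m) ^ 2 := by
        refine sum_le_sum fun l _ => ?_
        rw [h1]
        refine (sq_sum_le_card_mul_sum_sq).trans (le_of_eq ?_)
        simp [ZMod.card]
    _ = _ := by
        rw [← mul_sum, sum_comm]
        congr 1
        refine sum_congr rfl fun a _ => ?_
        exact Equiv.sum_comp (Equiv.addLeft a) (fun b => (((univ.filter fun p : V × V =>
          (G.Adj p.1 p.2 ∧ φ s(p.1, p.2) = c) ∧
          (ρ p.1 = a ∧ ¬ R p.1) ∧ (ρ p.2 = b ∧ ¬ R p.2)).card : ℝ) - μ * m) ^ 2)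

lemma mainPairs_dev_le (q : ℕ) [NeZero q] (μ : ℝ) (ρ : V → ZMod q) (R : V → Prop) (S : C → Prop) :
    (((mainPairs G φ ρ R S).card : ℝ)
      - (q - 1) ^ 2 * μ * (univ.filter fun p : V × V => G.Adj p.1 p.2).card) ^ 2
      ≤ q ^ 2 * pairDev G φ q μ ρ R S := by
  set m : ℝ := ((univ.filter fun p : V × V => G.Adj p.1 p.2).card : ℝ)
  set T : Finset (ZMod q × ZMod q) := univ.filter fun z => z.1 ≠ z.2 ∧ z.2 ≠ 0
  have hq1 : 1 ≤ q := Nat.one_le_iff_ne_zero.2 (NeZero.ne q)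
  have hT : (T.card : ℝ) = (q - 1) ^ 2 := by
    have h : T.card = ∑ b ∈ (univ : Finset (ZMod q)).erase 0, (univ.erase b).card := by
      rw [card_eq_sum_card_fiberwise (f := Prod.snd) (t := univ.erase 0)
        (fun z hz => by
          simp only [T, coe_filter, mem_univ, true_and, Set.mem_ofPred_eq] at hz
          simpa using hz.2)]
      refine sum_congr rfl fun b hb => ?_
      refine card_bij (fun z _ => z.1) ?_ ?_ ?_
      · rintro ⟨x, y⟩ hz
        simp only [T, mem_filter, mem_univ, true_and] at hz
        simp only [mem_erase, mem_univ, and_true]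
        exact hz.2 ▸ hz.1.1
      · rintro ⟨x, y⟩ hz ⟨x', y'⟩ hz' e
        simp only [T, mem_filter, mem_univ, true_and] at hz hz' e
        rw [e, hz.2, hz'.2]
      · intro x hx
        simp only [mem_erase, mem_univ, and_true] at hx hb
        exact ⟨(x, b), by simp only [T, mem_filter, mem_univ, true_and]; exact ⟨⟨hx, hb⟩, trivial⟩, rfl⟩
    rw [h]
    simp only [card_erase_of_mem (mem_univ _), card_univ, ZMod.card, sum_const, smul_eq_mul]
    rw [Nat.cast_mul, Nat.cast_sub hq1]; push_cast; ring
  have h1 : ((mainPairs G φ ρ R S).card : ℝ) - (q - 1) ^ 2 * μ * m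
      = ∑ z ∈ T, (((univ.filter fun p : V × V => G.Adj p.1 p.2 ∧
      (ρ p.1 = z.1 ∧ ¬ R p.1) ∧ (ρ p.2 = z.2 ∧ ¬ R p.2) ∧ ¬ S (φ s(p.1, p.2))).card : ℝ)
      - μ * m) := by
    rw [sum_sub_distrib]
    congr 1
    · rw [card_eq_sum_card_fiberwise (f := fun p : V × V => (ρ p.1, ρ p.2)) (t := T)]
      · push_cast
        refine sum_congr rfl fun z hz => ?_
        congr 2
        ext p
        simp only [T, mainPairs, mem_filter, mem_univ, true_and] at hz ⊢
        constructor
        · rintro ⟨⟨h1, h2, h3, h4, h5⟩, rfl⟩; exact ⟨h1, ⟨rfl, h3⟩, ⟨rfl, h4⟩, h5⟩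
        · rintro ⟨h1, ⟨h2, h3⟩, ⟨h4, h5⟩, h6⟩
          exact ⟨⟨h1, by rw [h2, h4]; exact hz, h3, h5, h6⟩, by rw [h2, h4]⟩
      · intro p hp
        simp only [T, mainPairs, coe_filter, mem_univ, true_and, Set.mem_ofPred_eq] at hp ⊢
        exact hp.2.1
    · simp [hT, mul_assoc]
  rw [h1]
  refine (sq_sum_le_card_mul_sum_sq).trans ?_
  unfold pairDev
  rw [hT, ← sum_product' (univ : Finset (ZMod q)) (univ : Finset (ZMod q)) (fun a b => 
    (((univ.filter fun p : V × V => G.Adj p.1 p.2 ∧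
      (ρ p.1 = a ∧ ¬ R p.1) ∧ (ρ p.2 = b ∧ ¬ R p.2) ∧ ¬ S (φ s(p.1, p.2))).card : ℝ)
    - μ * m) ^ 2)]
  refine mul_le_mul ?_ ?_ (sum_nonneg fun _ _ => sq_nonneg _) (sq_nonneg _)
  · have : (1 : ℝ) ≤ q := by exact_mod_cast hq1
    exact pow_le_pow_left₀ (by linarith) (by linarith) 2
  · exact sum_le_sum_of_subset_of_nonneg (fun z _ => by simp) (fun _ _ _ => sq_nonneg _)

lemma exists_labelling [Fintype C] (q L : ℕ) [NeZero q] [NeZero L] {M : ℝ} (hM1 : 1 ≤ M)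
    (hV : 0 < Fintype.card V)
    (hloc : ∀ v c, ((univ.filter fun u => G.Adj v u ∧ φ s(v, u) = c).card : ℝ) ≤ M) :
    ∃ (ρ : V → ZMod q) (R : V → Prop) (S : C → Prop),
      starDev G φ q ((1 - 1 / L) ^ 2 / q) ρ R S ≤ 17 * q ^ 4 * M * Fintype.card V ^ 2 ∧
      colourDev G φ q ((1 - 1 / L) ^ 2 / q) ρ R ≤ 17 * q ^ 4 * M * Fintype.card V ^ 2 ∧
      (((mainPairs G φ ρ R S).card : ℝ) - (q - 1) ^ 2 / q ^ 2 * (1 - 1 / L) ^ 3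
        * (univ.filter fun p : V × V => G.Adj p.1 p.2).card) ^ 2
        ≤ 17 * q ^ 4 * M * Fintype.card V ^ 3 ∧
      reserveDev G φ (1 / L * (1 / L)) R S ≤ 17 * q ^ 4 * M * Fintype.card V ^ 2 ∧
      degDev G φ (1 / L) S ≤ 17 * q ^ 4 * M * Fintype.card V ^ 2 ∧
      codegDev G φ (1 / L * (1 / L)) S ≤ 17 * q ^ 4 * M * Fintype.card V ^ 3 ∧
      (((univ.filter fun v => ¬ R v).card : ℝ) - (1 - 1 / L) * Fintype.card V) ^ 2
        ≤ 17 * q ^ 4 * M * Fintype.card V := by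
  obtain ⟨ρ, R, S, h1, h2, h3, h4, h5, h6, h7⟩ := exists_labelling_aux G φ q L hM1 hV hloc
  have hq1 : (1 : ℝ) ≤ q := by exact_mod_cast Nat.one_le_iff_ne_zero.2 (NeZero.ne q)
  have hq0 : (q : ℝ) ≠ 0 := by positivity
  have key : 17 * (q : ℝ) ^ 2 * M ≤ 17 * q ^ 4 * M := by
    have : (q : ℝ) ^ 2 ≤ q ^ 4 := pow_le_pow_right₀ hq1 (by norm_num)
    nlinarith
  have key1 : (q : ℝ) * (17 * (q : ℝ) ^ 2 * M) ≤ 17 * q ^ 4 * M := by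
    have : (q : ℝ) ^ 3 ≤ q ^ 4 := pow_le_pow_right₀ hq1 (by norm_num)
    nlinarith
  have up : ∀ k, 17 * (q : ℝ) ^ 2 * M * (Fintype.card V : ℝ) ^ k
      ≤ 17 * q ^ 4 * M * (Fintype.card V : ℝ) ^ k := fun k => by gcongr
  refine ⟨ρ, R, S, ?_, ?_, ?_, h4.trans (up 2), h5.trans (up 2), h6.trans (up 3), h7.trans ?_⟩
  · refine le_trans (le_of_eq ?_) (h1.trans (up 2)); congr 1; ring
  · have e : (1 - 1 / (L : ℝ)) ^ 2 / q = q * ((1 - 1 / L) / q * ((1 - 1 / L) / q)) := by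
      field_simp
    rw [e]
    refine (colourDev_le G φ q _ ρ R).trans ((mul_le_mul_of_nonneg_left h2 (by positivity)).trans ?_)
    rw [← mul_assoc]
    exact mul_le_mul_of_nonneg_right key1 (by positivity)
  · have e : (q - 1 : ℝ) ^ 2 / q ^ 2 * (1 - 1 / L) ^ 3
      = (q - 1) ^ 2 * ((1 - 1 / L) / q * ((1 - 1 / L) / q * (1 - 1 / L))) := by
      field_simp
    rw [e]
    refine (mainPairs_dev_le G φ q _ ρ R S).trans
      ((mul_le_mul_of_nonneg_left h3 (by positivity)).trans (le_of_eq ?_))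
    ring
  · simpa using up 1

end Labelling

lemma sum_abs_le_of_card_mul_sum_sq_le {ι : Type*} (s : Finset ι) (f : ι → ℝ) {b : ℝ} (hb : 0 ≤ b)
    (h : (s.card : ℝ) * ∑ i ∈ s, f i ^ 2 ≤ b ^ 2) : ∑ i ∈ s, |f i| ≤ b := by
  refine abs_le_of_sq_le_sq' ?_ hb |>.2
  refine (sq_sum_le_card_mul_sum_sq).trans ?_
  simpa using h

section Discrepancy
variable {V C : Type} [Fintype V]
variable (G : SimpleGraph V) (φ : Sym2 V → C)

lemma sum_card_mono_le {M : ℝ}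
    (hloc : ∀ v c, ((univ.filter fun u => G.Adj v u ∧ φ s(v, u) = c).card : ℝ) ≤ M) :
    ∑ x, ∑ x', ((univ.filter fun w => G.Adj x w ∧ G.Adj x' w ∧ φ s(x, w) = φ s(x', w)).card : ℝ)
      ≤ (Fintype.card V : ℝ) ^ 2 * M := by
  calc _ = ∑ x, ∑ w, ((univ.filter fun x' => G.Adj x w ∧ G.Adj x' w ∧
        φ s(x, w) = φ s(x', w)).card : ℝ) := by
        refine sum_congr rfl fun x _ => ?_
        simp only [card_filter]
        push_cast
        exact sum_comm
    _ ≤ ∑ x : V, ∑ w : V, M := by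
        refine sum_le_sum fun x _ => sum_le_sum fun w _ => ?_
        refine le_trans ?_ (hloc w (φ s(x, w)))
        refine Nat.cast_le.2 (card_le_card fun x' h => ?_)
        simp only [mem_filter, mem_univ, true_and] at h ⊢
        exact ⟨h.2.1.symm, by rw [h.2.2, Sym2.eq_swap]⟩
    _ = _ := by simp; ring

lemma discrepancy {S : C → Prop} {n d η γ θ : ℝ} (hn : n = Fintype.card V) (hn0 : 0 < n)
    (hd0 : 0 ≤ d) (hd2 : d ≤ 2) (hη : 0 ≤ η) (hηθ : η ≤ θ) (hγ0 : 0 ≤ γ) (hγ1 : γ ≤ 1)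
    (hloc : ∀ v c, ((univ.filter fun u => G.Adj v u ∧ φ s(v, u) = c).card : ℝ) ≤ η * n)
    (hdeg : ∀ u, (d - η) * n ≤ (univ.filter fun v => G.Adj u v).card)
    (hcodeg : ((univ.filter fun p : V × V => (d ^ 2 + η) * n <
      (univ.filter fun w => G.Adj p.1 w ∧ G.Adj p.2 w).card).card : ℝ) ≤ 3 * η * n ^ 2)
    (h5 : degDev G φ γ S ≤ θ ^ 2 * n ^ 3) (h6 : codegDev G φ (γ * γ) S ≤ θ ^ 2 * n ^ 4)
    (X Y : Finset V) :
    d * γ * X.card * Y.card - Real.sqrt (20 * θ) * n ^ 2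
      ≤ ((X ×ˢ Y).filter fun p => G.Adj p.1 p.2 ∧ S (φ s(p.1, p.2))).card := by
  have hθ : 0 ≤ θ := hη.trans hηθ
  have hXn : (X.card : ℝ) ≤ n := by rw [hn]; exact_mod_cast card_le_univ X
  have hYn : (Y.card : ℝ) ≤ n := by rw [hn]; exact_mod_cast card_le_univ Y
  obtain ⟨a, ha⟩ : ∃ a : V → V → ℝ, ∀ x y, a x y =
      if G.Adj x y ∧ S (φ s(x, y)) then 1 else 0 := ⟨_, fun _ _ => rfl⟩
  -- degrees
  have hsum1 : ∀ x, ∑ y, a x y = (univ.filter fun v => G.Adj x v ∧ S (φ s(x, v))).card := by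
    intro x; simp [ha]
  have hdeg' : X.card * (γ * (d - η) * n) - θ * n ^ 2 ≤ ∑ x ∈ X, ∑ y, a x y := by
    have h := sum_abs_le_of_card_mul_sum_sq_le univ (fun u : V =>
      (((univ.filter fun v => G.Adj u v ∧ S (φ s(u, v))).card : ℝ)
      - γ * (univ.filter fun v => G.Adj u v).card)) (b := θ * n ^ 2) (by positivity) (by
        rw [card_univ, ← hn]
        refine (mul_le_mul_of_nonneg_left h5 hn0.le).trans (le_of_eq (by ring)))
    calc _ ≤ X.card * (γ * (d - η) * n) - ∑ u ∈ X,
          |(((univ.filter fun v => G.Adj u v ∧ S (φ s(u, v))).card : ℝ)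
          - γ * (univ.filter fun v => G.Adj u v).card)| := by
          refine sub_le_sub_left (le_trans ?_ h) _
          exact sum_le_sum_of_subset_of_nonneg (subset_univ _) fun _ _ _ => abs_nonneg _
      _ = ∑ u ∈ X, (γ * ((d - η) * n) -
          |(((univ.filter fun v => G.Adj u v ∧ S (φ s(u, v))).card : ℝ)
          - γ * (univ.filter fun v => G.Adj u v).card)|) := by
          rw [sum_sub_distrib]; simp [mul_assoc]
      _ ≤ _ := by
          refine sum_le_sum fun x _ => ?_
          rw [hsum1]
          have h1 := mul_le_mul_of_nonneg_left (hdeg x) hγ0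
          have h2 := neg_abs_le (((univ.filter fun v => G.Adj x v ∧ S (φ s(x, v))).card : ℝ)
          - γ * (univ.filter fun v => G.Adj x v).card)
          linarith
  -- codegrees
  have hpair : ∀ x x', ∑ y, a x y * a x' y ≤
      (univ.filter fun w => G.Adj x w ∧ G.Adj x' w ∧ φ s(x, w) = φ s(x', w)).card
      + (univ.filter fun w => (G.Adj x w ∧ G.Adj x' w ∧ φ s(x, w) ≠ φ s(x', w)) ∧
      S (φ s(x, w)) ∧ S (φ s(x', w))).card := by
    intro x x'
    have : ∑ y, a x y * a x' y = (univ.filter fun w => (G.Adj x w ∧ S (φ s(x, w))) ∧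
        (G.Adj x' w ∧ S (φ s(x', w)))).card := by
      rw [card_filter]; push_cast
      refine sum_congr rfl fun y _ => ?_
      rw [ha, ha]
      by_cases h1 : G.Adj x y ∧ S (φ s(x, y)) <;> by_cases h2 : G.Adj x' y ∧ S (φ s(x', y)) <;>
        simp [h1, h2]
    rw [this, ← Nat.cast_add, Nat.cast_le]
    refine (card_le_card fun w hw => ?_).trans (card_union_le _ _)
    simp only [mem_union, mem_filter, mem_univ, true_and] at hw ⊢
    by_cases h : φ s(x, w) = φ s(x', w)
    · exact Or.inl ⟨hw.1.1, hw.2.1, h⟩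
    · exact Or.inr ⟨⟨hw.1.1, hw.2.1, h⟩, hw.1.2, hw.2.2⟩
  have hcod : ∑ x ∈ X, ∑ x' ∈ X, ∑ y, a x y * a x' y
      ≤ γ * γ * (d ^ 2 + η) * n * X.card ^ 2 + (4 * η + θ) * n ^ 3 := by
    set B := univ.filter fun p : V × V => (d ^ 2 + η) * n <
      (univ.filter fun w => G.Adj p.1 w ∧ G.Adj p.2 w).card with hB
    let e : V × V → ℝ := fun p => (((univ.filter fun w => (G.Adj p.1 w ∧ G.Adj p.2 w ∧ φ s(p.1, w) ≠ φ s(p.2, w)) ∧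
      S (φ s(p.1, w)) ∧ S (φ s(p.2, w))).card : ℝ)
    - γ * γ * (univ.filter fun w => G.Adj p.1 w ∧ G.Adj p.2 w ∧ φ s(p.1, w) ≠ φ s(p.2, w)).card)
    have h := sum_abs_le_of_card_mul_sum_sq_le (univ ×ˢ univ) e (b := θ * n ^ 3) (by positivity) (by
        rw [card_product, card_univ, sum_product]
        push_cast
        rw [← hn]
        refine (mul_le_mul_of_nonneg_left h6 (by positivity)).trans (le_of_eq (by ring)))
    have hm := sum_card_mono_le G φ hloc
    calc _ ≤ ∑ x ∈ X, ∑ x' ∈ X,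
          (((univ.filter fun w => G.Adj x w ∧ G.Adj x' w ∧ φ s(x, w) = φ s(x', w)).card : ℝ)
            + (γ * γ * (d ^ 2 + η) * n + n * (if (x, x') ∈ B then 1 else 0) + |e (x, x')|)) := by
          refine sum_le_sum fun x _ => sum_le_sum fun x' _ => (hpair x x').trans ?_
          refine add_le_add_right ?_ _
          have h2 := le_abs_self (e (x, x'))
          simp only [e] at h2
          have hγγ : γ * γ ≤ 1 := by nlinarith
          have h3 : γ * γ * ((univ.filter fun w => G.Adj x w ∧ G.Adj x' w ∧
              φ s(x, w) ≠ φ s(x', w)).card : ℝ) ≤ γ * γ * (d ^ 2 + η) * n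
                + n * (if (x, x') ∈ B then 1 else 0) := by
            have h4 : ((univ.filter fun w => G.Adj x w ∧ G.Adj x' w ∧
              φ s(x, w) ≠ φ s(x', w)).card : ℝ) ≤ (univ.filter fun w => G.Adj x w ∧ G.Adj x' w).card := by
              refine Nat.cast_le.2 (card_le_card fun w hw => ?_)
              simp only [mem_filter, mem_univ, true_and] at hw ⊢
              exact ⟨hw.1, hw.2.1⟩
            split_ifs with hb
            · have h5 : ((univ.filter fun w => G.Adj x w ∧ G.Adj x' w).card : ℝ) ≤ n := by
                rw [hn]; exact_mod_cast card_le_univ _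
              have h6 : 0 ≤ γ * γ * (d ^ 2 + η) * n := by positivity
              have h7 := mul_le_mul hγγ (h4.trans h5) (Nat.cast_nonneg _) zero_le_one
              linarith
            · simp only [hB, mem_filter, mem_univ, true_and, not_lt] at hb
              have := mul_le_mul_of_nonneg_left (h4.trans hb) (mul_self_nonneg γ)
              linarith
          linarith
      _ = ∑ x ∈ X, ∑ x' ∈ X,
          ((univ.filter fun w => G.Adj x w ∧ G.Adj x' w ∧ φ s(x, w) = φ s(x', w)).card : ℝ)
          + (X.card * (X.card * (γ * γ * (d ^ 2 + η) * n)) + n * ∑ x ∈ X, ∑ x' ∈ X,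
            (if (x, x') ∈ B then (1 : ℝ) else 0) + ∑ x ∈ X, ∑ x' ∈ X, |e (x, x')|) := by
          simp only [sum_add_distrib, sum_const, nsmul_eq_mul, mul_sum]
      _ ≤ n ^ 2 * (η * n) + (X.card * (X.card * (γ * γ * (d ^ 2 + η) * n)) + n * (3 * η * n ^ 2)
            + θ * n ^ 3) := by
          refine add_le_add ?_ (add_le_add (add_le_add_right (mul_le_mul_of_nonneg_left ?_ hn0.le) _) ?_)
          · rw [hn] at hm ⊢
            refine le_trans ?_ hm
            refine (sum_le_sum fun x _ => sum_le_sum_of_subset_of_nonneg (subset_univ _)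
              fun _ _ _ => Nat.cast_nonneg _).trans ?_
            exact sum_le_sum_of_subset_of_nonneg (subset_univ _)
              fun _ _ _ => sum_nonneg fun _ _ => Nat.cast_nonneg _
          · refine le_trans ?_ hcodeg
            rw [← sum_product' X X (fun x x' => if (x, x') ∈ B then (1 : ℝ) else 0)]
            simp only [Prod.mk.eta, ← sum_filter, sum_const, nsmul_eq_mul, mul_one]
            refine Nat.cast_le.2 (card_le_card fun p hp => (mem_filter.1 hp).2)
          · rw [← sum_product' X X (fun x x' => |e (x, x')|)]
            refine le_trans ?_ h
            exact sum_le_sum_of_subset_of_nonneg (fun p _ => by simp) fun _ _ _ => abs_nonneg _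
      _ = _ := by ring
  -- variance
  have hvar : ∑ y, (∑ x ∈ X, a x y - d * γ * X.card) ^ 2 ≤ 20 * θ * n ^ 3 := by
    have e1 : ∑ y, (∑ x ∈ X, a x y - d * γ * X.card) ^ 2 =
        ∑ x ∈ X, ∑ x' ∈ X, ∑ y, a x y * a x' y - 2 * (d * γ * X.card) * ∑ x ∈ X, ∑ y, a x y
          + n * (d * γ * X.card) ^ 2 := by
      have : ∀ y, (∑ x ∈ X, a x y - d * γ * X.card) ^ 2 = ∑ x ∈ X, ∑ x' ∈ X, a x y * a x' y
        - 2 * (d * γ * X.card) * ∑ x ∈ X, a x y + (d * γ * X.card) ^ 2 := by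
        intro y
        rw [sub_sq, sq (∑ x ∈ X, a x y), sum_mul_sum]; ring
      simp only [this, sum_add_distrib, sum_sub_distrib, ← mul_sum, sum_const, card_univ,
        nsmul_eq_mul, ← hn]
      rw [sum_comm (s := univ) (t := X), sum_comm (s := univ) (t := X)]
      congr 2
      refine sum_congr rfl fun x _ => ?_
      simp only [mul_sum]
      exact sum_comm
    rw [e1]
    have hX0 : (0 : ℝ) ≤ X.card := Nat.cast_nonneg _
    have h1 := mul_le_mul_of_nonneg_left hdeg' (a := 2 * (d * γ * X.card)) (by positivity)
    have hdγ : d * γ ≤ 2 := by nlinarith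
    have hXX : (X.card : ℝ) ^ 2 ≤ n ^ 2 := pow_le_pow_left₀ hX0 hXn 2
    have hγγ : γ * γ ≤ 1 := by nlinarith
    have t1 : γ * γ * η * n * (X.card : ℝ) ^ 2 ≤ θ * n ^ 3 := by
      calc _ ≤ 1 * θ * n * n ^ 2 := by gcongr
        _ = _ := by ring
    have t2 : 2 * (d * γ) * γ * η * n * (X.card : ℝ) ^ 2 ≤ 4 * θ * n ^ 3 := by
      calc _ ≤ 2 * 2 * 1 * θ * n * n ^ 2 := by gcongr
        _ = _ := by ring
    have t3 : 2 * (d * γ) * X.card * θ * n ^ 2 ≤ 4 * θ * n ^ 3 := by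
      calc _ ≤ 2 * 2 * n * θ * n ^ 2 := by gcongr
        _ = _ := by ring
    have t4 : η * n ^ 3 ≤ θ * n ^ 3 := by gcongr
    have t5 : 0 ≤ θ * n ^ 3 := by positivity
    nlinarith
  -- conclusion
  have hcount : (((X ×ˢ Y).filter fun p => G.Adj p.1 p.2 ∧ S (φ s(p.1, p.2))).card : ℝ)
      = ∑ y ∈ Y, ∑ x ∈ X, a x y := by
    rw [card_filter, sum_product_right]
    push_cast
    exact sum_congr rfl fun y _ => sum_congr rfl fun x _ => (ha x y).symm
  have hfin := sum_abs_le_of_card_mul_sum_sq_le Y (fun y => ∑ x ∈ X, a x y - d * γ * X.card)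
    (b := Real.sqrt (20 * θ) * n ^ 2) (by positivity) (by
      rw [mul_pow, Real.sq_sqrt (by positivity)]
      calc _ ≤ n * (20 * θ * n ^ 3) := by
            refine mul_le_mul hYn (le_trans ?_ hvar) (sum_nonneg fun _ _ => sq_nonneg _) hn0.le
            exact sum_le_sum_of_subset_of_nonneg (subset_univ _) fun _ _ _ => sq_nonneg _
        _ = _ := by ring)
  have h2 : -∑ y ∈ Y, |∑ x ∈ X, a x y - d * γ * X.card| ≤ ∑ y ∈ Y, (∑ x ∈ X, a x y - d * γ * X.card) := by
    rw [← sum_neg_distrib]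
    exact sum_le_sum fun y _ => neg_abs_le _
  rw [sum_sub_distrib, sum_const, nsmul_eq_mul, ← hcount] at h2
  linarith

end Discrepancy

lemma exists_matching_of_few_bad {r : ℕ} (hr : 1 ≤ r) {ε : ℝ} (hε : 0 < ε) (hε1 : ε ≤ 1) :
    ∃ η : ℝ, 0 < η ∧ ∀ (ι X : Type) [Fintype X] (E : Finset ι) (s : ι → Finset X) (D : ℝ), 0 < D →
      (∀ f ∈ E, (s f).card = r) → (∀ x y, y ≠ x → (hcodeg E s x y : ℝ) ≤ η * D) →
      ∃ M ⊆ E, (M : Set ι).PairwiseDisjoint s ∧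
        (1 - ε) * ((E.card - ∑ x, if D < hdeg E s x then (hdeg E s x : ℝ) else 0) / D) ≤ M.card := by
  obtain ⟨η, hη, h⟩ := exists_matching hr hε
  refine ⟨η, hη, fun ι X _ E s D hD hs hc => ?_⟩
  set E' := E.filter fun f => ∀ x ∈ s f, (hdeg E s x : ℝ) ≤ D with hE'
  have hsub : E' ⊆ E := filter_subset _ _
  have hA : ∀ x, (hdeg E' s x : ℝ) ≤ D := by
    intro x
    by_cases hx : ∃ f ∈ E', x ∈ s f
    · obtain ⟨f, hf, hxf⟩ := hx
      refine le_trans ?_ ((mem_filter.1 hf).2 x hxf)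
      exact Nat.cast_le.2 (card_le_card (filter_subset_filter _ hsub))
    · push Not at hx
      have : hdeg E' s x = 0 := card_eq_zero.2 (filter_eq_empty_iff.2 fun f hf => hx f hf)
      rw [this]; simpa using hD.le
  have hB : ∀ x y, y ≠ x → (hcodeg E' s x y : ℝ) ≤ η * D := fun x y hxy =>
    le_trans (Nat.cast_le.2 (card_le_card (filter_subset_filter _ hsub))) (hc x y hxy)
  obtain ⟨M, hM, hd, hcard⟩ := h ι X E' s D hD (fun f hf => hs f (hsub hf)) hA hB
  · refine ⟨M, hM.trans hsub, hd, le_trans ?_ hcard⟩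
    refine mul_le_mul_of_nonneg_left ?_ (by linarith)
    refine div_le_div_of_nonneg_right ?_ hD.le
    have h1 : E ⊆ E' ∪ (univ.filter fun x => D < hdeg E s x).biUnion fun x => E.filter fun f => x ∈ s f := by
      intro f hf
      by_cases hb : ∀ x ∈ s f, (hdeg E s x : ℝ) ≤ D
      · exact mem_union_left _ (mem_filter.2 ⟨hf, hb⟩)
      · push Not at hb
        obtain ⟨x, hx, hxD⟩ := hb
        refine mem_union_right _ (mem_biUnion.2 ⟨x, ?_, mem_filter.2 ⟨hf, hx⟩⟩)
        simpa using hxD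
    have h2 := (card_le_card h1).trans ((card_union_le _ _).trans (Nat.add_le_add_left card_biUnion_le _))
    have h3 : (E.card : ℝ) ≤ E'.card + ∑ x, if D < hdeg E s x then (hdeg E s x : ℝ) else 0 := by
      rw [← sum_filter]
      exact_mod_cast h2
    linarith

lemma hcodeg_le_of_forall {ι X : Type*} {E : Finset ι} {s : ι → Finset X} {x y : X} {B : ℝ}
    (h : ∀ T ⊆ E, (∀ f ∈ T, x ∈ s f ∧ y ∈ s f) → (T.card : ℝ) ≤ B) : (hcodeg E s x y : ℝ) ≤ B :=
  h _ (filter_subset _ _) fun _ hf => (mem_filter.1 hf).2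

section SlotHypergraph
variable {V C I : Type}

/-- The hyperedge recording that the ordered pair `f.2` is used by slot `f.1`. -/
noncomputable def slotEdge (φ : Sym2 V → C) (f : I × V × V) :
    Finset (Sym2 V ⊕ (I × V) ⊕ (I × V) ⊕ (I × C)) :=
  {Sum.inl s(f.2.1, f.2.2), Sum.inr (Sum.inl (f.1, f.2.1)), Sum.inr (Sum.inr (Sum.inl (f.1, f.2.2))),
    Sum.inr (Sum.inr (Sum.inr (f.1, φ s(f.2.1, f.2.2))))}

lemma card_slotEdge (φ : Sym2 V → C) (f : I × V × V) : (slotEdge φ f).card = 4 := by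
  unfold slotEdge
  rw [card_insert_of_notMem, card_insert_of_notMem, card_insert_of_notMem, card_singleton] <;> simp

lemma edge_mem_slotEdge (φ : Sym2 V → C) (f : I × V × V) (e : Sym2 V) :
    Sum.inl e ∈ slotEdge φ f ↔ e = s(f.2.1, f.2.2) := by simp [slotEdge]

lemma out_mem_slotEdge (φ : Sym2 V → C) (f : I × V × V) (z : I × V) :
    Sum.inr (Sum.inl z) ∈ slotEdge φ f ↔ z = (f.1, f.2.1) := by simp [slotEdge]

lemma in_mem_slotEdge (φ : Sym2 V → C) (f : I × V × V) (z : I × V) :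
    Sum.inr (Sum.inr (Sum.inl z)) ∈ slotEdge φ f ↔ z = (f.1, f.2.2) := by simp [slotEdge]

lemma colour_mem_slotEdge (φ : Sym2 V → C) (f : I × V × V) (z : I × C) :
    Sum.inr (Sum.inr (Sum.inr z)) ∈ slotEdge φ f ↔ z = (f.1, φ s(f.2.1, f.2.2)) := by
  simp [slotEdge]

variable [Fintype V] (G : SimpleGraph V)

lemma hcodeg_slotEdge_le (φ : Sym2 V → C) {M : ℝ} (hM : 2 ≤ M)
    (hloc : ∀ v c, ((univ.filter fun u => G.Adj v u ∧ φ s(v, u) = c).card : ℝ) ≤ M)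
    {E : Finset (I × V × V)} (hE : ∀ f ∈ E, G.Adj f.2.1 f.2.2)
    (x y : Sym2 V ⊕ (I × V) ⊕ (I × V) ⊕ (I × C)) (hxy : y ≠ x) :
    (hcodeg E (slotEdge φ) x y : ℝ) ≤ M := by
  have h1 : ∀ (T : Finset (I × V × V)) (i : I) (e : Sym2 V),
      (∀ f ∈ T, f.1 = i ∧ e = s(f.2.1, f.2.2)) → (T.card : ℝ) ≤ M := by
    intro T i e h
    induction e with | _ a b
    have : T ⊆ {(i, a, b), (i, b, a)} := by
      rintro ⟨j, u, v⟩ hf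
      obtain ⟨h1, h2⟩ := h _ hf
      simp only [Sym2.eq, Sym2.rel_iff', Prod.mk.injEq, Prod.swap_prod_mk] at h2
      simp only [mem_insert, mem_singleton, Prod.mk.injEq]
      rcases h2 with ⟨h3, h4⟩ | ⟨h3, h4⟩
      · exact Or.inl ⟨h1, h3.symm, h4.symm⟩
      · exact Or.inr ⟨h1, h4.symm, h3.symm⟩
    have := (card_le_card this).trans card_le_two
    exact le_trans (by exact_mod_cast this) hM
  have h2 : ∀ (T : Finset (I × V × V)) (i : I) (u : V) (c : C), T ⊆ E →
      (∀ f ∈ T, f.1 = i ∧ f.2.1 = u ∧ c = φ s(f.2.1, f.2.2)) → (T.card : ℝ) ≤ M := by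
    intro T i u c hT h
    refine le_trans (Nat.cast_le.2 (card_le_card_of_injOn (fun f => f.2.2) ?_ ?_)) (hloc u c)
    · intro f hf
      obtain ⟨h3, h4, h5⟩ := h f hf
      simp only [coe_filter, mem_univ, true_and, Set.mem_ofPred_eq]
      rw [← h4]
      exact ⟨hE f (hT hf), h5.symm⟩
    · rintro ⟨j, a, b⟩ hf ⟨j', a', b'⟩ hf' e
      obtain ⟨h3, h4, -⟩ := h _ hf
      obtain ⟨h3', h4', -⟩ := h _ hf'
      simp only at h3 h4 h3' h4' e
      rw [h3, h4, h3', h4', e]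
  have h3 : ∀ (T : Finset (I × V × V)) (i : I) (u : V) (c : C), T ⊆ E →
      (∀ f ∈ T, f.1 = i ∧ f.2.2 = u ∧ c = φ s(f.2.1, f.2.2)) → (T.card : ℝ) ≤ M := by
    intro T i u c hT h
    refine le_trans (Nat.cast_le.2 (card_le_card_of_injOn (fun f => f.2.1) ?_ ?_)) (hloc u c)
    · intro f hf
      obtain ⟨h3, h4, h5⟩ := h f hf
      simp only [coe_filter, mem_univ, true_and, Set.mem_ofPred_eq]
      rw [← h4]
      exact ⟨(hE f (hT hf)).symm, by rw [Sym2.eq_swap]; exact h5.symm⟩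
    · rintro ⟨j, a, b⟩ hf ⟨j', a', b'⟩ hf' e
      obtain ⟨h3, h4, -⟩ := h _ hf
      obtain ⟨h3', h4', -⟩ := h _ hf'
      simp only at h3 h4 h3' h4' e
      rw [h3, h4, h3', h4', e]
  have h4 : ∀ (T : Finset (I × V × V)) (i : I) (u v : V),
      (∀ f ∈ T, f.1 = i ∧ f.2.1 = u ∧ f.2.2 = v) → (T.card : ℝ) ≤ M := fun T i u v h =>
    h1 T i s(u, v) fun f hf => ⟨(h f hf).1, by rw [(h f hf).2.1, (h f hf).2.2]⟩
  refine hcodeg_le_of_forall fun T hsub hmem => ?_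
  have hzero : (∀ f ∈ T, False) → (T.card : ℝ) ≤ M := by
    intro h
    rw [card_eq_zero.2 (eq_empty_of_forall_notMem h)]; simp; linarith
  rcases x with e | z | z | z <;> rcases y with e' | z' | z' | z' <;>
    simp only [edge_mem_slotEdge, out_mem_slotEdge, in_mem_slotEdge, colour_mem_slotEdge] at hmem
  · exact hzero fun f hf => hxy (by rw [(hmem f hf).1, (hmem f hf).2])
  · exact h1 T z'.1 e fun f hf => ⟨by rw [(hmem f hf).2], (hmem f hf).1⟩
  · exact h1 T z'.1 e fun f hf => ⟨by rw [(hmem f hf).2], (hmem f hf).1⟩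
  · exact h1 T z'.1 e fun f hf => ⟨by rw [(hmem f hf).2], (hmem f hf).1⟩
  · exact h1 T z.1 e' fun f hf => ⟨by rw [(hmem f hf).1], (hmem f hf).2⟩
  · exact hzero fun f hf => hxy (by rw [(hmem f hf).1, (hmem f hf).2])
  · exact h4 T z.1 z.2 z'.2 fun f hf =>
      ⟨by rw [(hmem f hf).1], by rw [(hmem f hf).1], by rw [(hmem f hf).2]⟩
  · exact h2 T z.1 z.2 z'.2 hsub fun f hf =>
      ⟨by rw [(hmem f hf).1], by rw [(hmem f hf).1], by rw [(hmem f hf).2]⟩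
  · exact h1 T z.1 e' fun f hf => ⟨by rw [(hmem f hf).1], (hmem f hf).2⟩
  · exact h4 T z.1 z'.2 z.2 fun f hf =>
      ⟨by rw [(hmem f hf).1], by rw [(hmem f hf).2], by rw [(hmem f hf).1]⟩
  · exact hzero fun f hf => hxy (by rw [(hmem f hf).1, (hmem f hf).2])
  · exact h3 T z.1 z.2 z'.2 hsub fun f hf =>
      ⟨by rw [(hmem f hf).1], by rw [(hmem f hf).1], by rw [(hmem f hf).2]⟩
  · exact h1 T z.1 e' fun f hf => ⟨by rw [(hmem f hf).1], (hmem f hf).2⟩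
  · exact h2 T z.1 z'.2 z.2 hsub fun f hf =>
      ⟨by rw [(hmem f hf).1], by rw [(hmem f hf).2], by rw [(hmem f hf).1]⟩
  · exact h3 T z.1 z'.2 z.2 hsub fun f hf =>
      ⟨by rw [(hmem f hf).1], by rw [(hmem f hf).2], by rw [(hmem f hf).1]⟩
  · exact hzero fun f hf => hxy (by rw [(hmem f hf).1, (hmem f hf).2])

end SlotHypergraph

lemma ite_le_of_dev {h N μ D δ : ℝ} (hD : 0 < D) (hδ : 0 < δ) (hδ1 : δ ≤ 1) (hN : h ≤ N)
    (hμ : μ ≤ (1 + δ / 2) * D) :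
    (if (1 + δ) * D < h then h else 0) ≤ 8 / (δ ^ 2 * D) * (N - μ) ^ 2 := by
  split_ifs with hh
  · obtain ⟨z, hz⟩ : ∃ z, z = N - μ := ⟨_, rfl⟩
    rw [← hz, div_mul_eq_mul_div, le_div_iff₀ (by positivity)]
    have h1 : δ * D / 2 ≤ z := by nlinarith
    have hδD : 0 < δ * D := by positivity
    have h2 : h ≤ z + 3 / 2 * D := by nlinarith
    have h3 : h * (δ ^ 2 * D) ≤ (z + 3 / 2 * D) * (δ ^ 2 * D) :=
      mul_le_mul_of_nonneg_right h2 (by positivity)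
    have h4 : z * (δ ^ 2 * D) ≤ z * (δ * D) := by
      refine mul_le_mul_of_nonneg_left ?_ (by linarith)
      refine mul_le_mul_of_nonneg_right ?_ hD.le
      nlinarith
    have h5 : z * (δ * D) ≤ z * (2 * z) := mul_le_mul_of_nonneg_left (by linarith) (by linarith)
    have h6 : (δ * D) ^ 2 ≤ (2 * z) ^ 2 := pow_le_pow_left₀ hδD.le (by linarith) 2
    nlinarith
  · positivity

section Slots
variable {V C : Type} [Fintype V] (G : SimpleGraph V) (φ : Sym2 V → C)

/-- The candidates for the slot hypergraph: a slot `(l, k)` together with a main pair whose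
labels increase by `l`. -/
noncomputable def slotPairs {q : ℕ} [NeZero q] (s : ℕ) (ρ : V → ZMod q) (R : V → Prop) (S : C → Prop) :
    Finset ((ZMod q × Fin s) × V × V) :=
  univ.filter fun f => f.2 ∈ mainPairs G φ ρ R S ∧ ρ f.2.2 = ρ f.2.1 + f.1.1

variable {q : ℕ} [NeZero q] {s : ℕ} (ρ : V → ZMod q) (R : V → Prop) (S : C → Prop)

lemma le_card_slotPairs : s * (mainPairs G φ ρ R S).card ≤ (slotPairs G φ s ρ R S).card := by
  have : (Finset.univ (α := Fin s) ×ˢ mainPairs G φ ρ R S).card ≤ (slotPairs G φ s ρ R S).card := by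
    refine card_le_card_of_injOn (fun z => ((ρ z.2.2 - ρ z.2.1, z.1), z.2)) ?_ ?_
    · intro z hz
      have hz' := (mem_product.1 (mem_coe.1 hz)).2
      simp only [slotPairs, coe_filter, mem_univ, true_and, Set.mem_ofPred_eq]
      exact ⟨hz', by ring⟩
    · rintro ⟨k, p⟩ - ⟨k', p'⟩ - h
      simp only [Prod.mk.injEq] at h
      rw [h.1.2, h.2]
  simpa using this

lemma hdeg_slotPairs_edge_le (e : Sym2 V) :
    hdeg (slotPairs G φ s ρ R S) (slotEdge φ) (Sum.inl e) ≤ 2 * s := by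
  induction e with | _ a b
  have : ((slotPairs G φ s ρ R S).filter fun f => Sum.inl s(a, b) ∈ slotEdge φ f).card
      ≤ (({(a, b), (b, a)} : Finset (V × V)) ×ˢ (Finset.univ (α := Fin s))).card := by
    refine card_le_card_of_injOn (fun f => (f.2, f.1.2)) ?_ ?_
    · rintro ⟨⟨l, k⟩, u, v⟩ hf
      have hf' := (mem_filter.1 (mem_coe.1 hf)).2
      rw [edge_mem_slotEdge] at hf'
      simp only [Sym2.eq, Sym2.rel_iff', Prod.mk.injEq, Prod.swap_prod_mk] at hf'
      simp only [mem_coe, mem_product, mem_univ, and_true, mem_insert, mem_singleton, Prod.mk.injEq]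
      rcases hf' with ⟨h3, h4⟩ | ⟨h3, h4⟩
      · exact Or.inl ⟨h3.symm, h4.symm⟩
      · exact Or.inr ⟨h4.symm, h3.symm⟩
    · rintro ⟨⟨l, k⟩, u, v⟩ hf ⟨⟨l', k'⟩, u', v'⟩ hf' h
      have h1 := (mem_filter.1 (mem_filter.1 (mem_coe.1 hf)).1).2.2
      have h2 := (mem_filter.1 (mem_filter.1 (mem_coe.1 hf')).1).2.2
      simp only [Prod.mk.injEq] at h h1 h2
      obtain ⟨⟨rfl, rfl⟩, rfl⟩ := h
      rw [h1] at h2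
      rw [add_left_cancel h2]
  refine this.trans ?_
  rw [card_product, card_univ, Fintype.card_fin]
  exact Nat.mul_le_mul_right _ card_le_two

lemma hdeg_slotPairs_out_le (l : ZMod q) (k : Fin s) (u : V) :
    hdeg (slotPairs G φ s ρ R S) (slotEdge φ) (Sum.inr (Sum.inl ((l, k), u))) ≤
      (univ.filter fun v => G.Adj u v ∧ (ρ v = ρ u + l ∧ ¬ R v) ∧ ¬ S (φ s(u, v))).card := by
  refine card_le_card_of_injOn (fun f => f.2.2) ?_ ?_
  · rintro ⟨i, a, b⟩ hf
    have hf := mem_filter.1 (mem_coe.1 hf)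
    have h1 := hf.2
    rw [out_mem_slotEdge] at h1
    have h2 := (mem_filter.1 hf.1).2
    simp only [mainPairs, mem_filter, mem_univ, true_and, Prod.mk.injEq] at h1 h2
    simp only [coe_filter, mem_univ, true_and, Set.mem_ofPred_eq]
    obtain ⟨rfl, rfl⟩ := h1
    exact ⟨h2.1.1, ⟨h2.2, h2.1.2.2.2.1⟩, h2.1.2.2.2.2⟩
  · rintro ⟨i, a, b⟩ hf ⟨i', a', b'⟩ hf' h
    have h1 := (mem_filter.1 (mem_coe.1 hf)).2
    have h2 := (mem_filter.1 (mem_coe.1 hf')).2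
    rw [out_mem_slotEdge] at h1 h2
    rw [h1] at h2
    simp only [Prod.mk.injEq] at h h2 ⊢
    exact ⟨h2.1, h2.2, h⟩

lemma hdeg_slotPairs_in_le (l : ZMod q) (k : Fin s) (u : V) :
    hdeg (slotPairs G φ s ρ R S) (slotEdge φ) (Sum.inr (Sum.inr (Sum.inl ((l, k), u)))) ≤
      (univ.filter fun v => G.Adj u v ∧ (ρ v = ρ u - l ∧ ¬ R v) ∧ ¬ S (φ s(u, v))).card := by
  refine card_le_card_of_injOn (fun f => f.2.1) ?_ ?_
  · rintro ⟨i, a, b⟩ hf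
    have hf := mem_filter.1 (mem_coe.1 hf)
    have h1 := hf.2
    rw [in_mem_slotEdge] at h1
    have h2 := (mem_filter.1 hf.1).2
    simp only [mainPairs, mem_filter, mem_univ, true_and, Prod.mk.injEq] at h1 h2
    simp only [coe_filter, mem_univ, true_and, Set.mem_ofPred_eq]
    obtain ⟨rfl, rfl⟩ := h1
    refine ⟨h2.1.1.symm, ⟨by rw [h2.2]; ring, h2.1.2.2.1⟩, ?_⟩
    rw [Sym2.eq_swap]
    exact h2.1.2.2.2.2
  · rintro ⟨i, a, b⟩ hf ⟨i', a', b'⟩ hf' h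
    have h1 := (mem_filter.1 (mem_coe.1 hf)).2
    have h2 := (mem_filter.1 (mem_coe.1 hf')).2
    rw [in_mem_slotEdge] at h1 h2
    rw [h1] at h2
    simp only [Prod.mk.injEq] at h h2 ⊢
    exact ⟨h2.1, h, h2.2⟩

lemma hdeg_slotPairs_colour_le (l : ZMod q) (k : Fin s) (c : C) :
    hdeg (slotPairs G φ s ρ R S) (slotEdge φ) (Sum.inr (Sum.inr (Sum.inr ((l, k), c)))) ≤
      (univ.filter fun p : V × V => (G.Adj p.1 p.2 ∧ φ s(p.1, p.2) = c) ∧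
        ρ p.2 = ρ p.1 + l ∧ ¬ R p.1 ∧ ¬ R p.2).card := by
  refine card_le_card_of_injOn (fun f => f.2) ?_ ?_
  · rintro ⟨i, a, b⟩ hf
    have hf := mem_filter.1 (mem_coe.1 hf)
    have h1 := hf.2
    rw [colour_mem_slotEdge] at h1
    have h2 := (mem_filter.1 hf.1).2
    simp only [mainPairs, mem_filter, mem_univ, true_and, Prod.mk.injEq] at h1 h2
    simp only [coe_filter, mem_univ, true_and, Set.mem_ofPred_eq]
    obtain ⟨rfl, rfl⟩ := h1
    exact ⟨⟨h2.1.1, rfl⟩, h2.2, h2.1.2.2.1, h2.1.2.2.2.1⟩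
  · rintro ⟨i, a, b⟩ hf ⟨i', a', b'⟩ hf' h
    have h1 := (mem_filter.1 (mem_coe.1 hf)).2
    have h2 := (mem_filter.1 (mem_coe.1 hf')).2
    rw [colour_mem_slotEdge] at h1 h2
    rw [h1] at h2
    simp only [Prod.mk.injEq] at h h2 ⊢
    exact ⟨h2.1, h⟩

variable [Fintype C]

lemma sum_bad_slotPairs_le {μ D δ : ℝ} (hD : 0 < D) (hδ : 0 < δ) (hδ1 : δ ≤ 1) (hs : 2 * s ≤ D)
    (hdeg' : ∀ u, μ * (univ.filter fun v => G.Adj u v).card ≤ (1 + δ / 2) * D)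
    (hcol : ∀ c, μ * (univ.filter fun p : V × V => G.Adj p.1 p.2 ∧ φ s(p.1, p.2) = c).card
      ≤ (1 + δ / 2) * D) :
    (∑ x, if (1 + δ) * D < hdeg (slotPairs G φ s ρ R S) (slotEdge φ) x then
        (hdeg (slotPairs G φ s ρ R S) (slotEdge φ) x : ℝ) else 0)
      ≤ 8 / (δ ^ 2 * D) * (s * (2 * starDev G φ q μ ρ R S + colourDev G φ q μ ρ R)) := by
  have key : ∀ (x) (N : ℕ) (ν : ℝ), hdeg (slotPairs G φ s ρ R S) (slotEdge φ) x ≤ N →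
      ν ≤ (1 + δ / 2) * D → (if (1 + δ) * D < hdeg (slotPairs G φ s ρ R S) (slotEdge φ) x then
        (hdeg (slotPairs G φ s ρ R S) (slotEdge φ) x : ℝ) else 0) ≤ 8 / (δ ^ 2 * D) * (N - ν) ^ 2 :=
    fun x N ν h1 h2 => ite_le_of_dev hD hδ hδ1 (by exact_mod_cast h1) h2
  rw [Fintype.sum_sum_type, Fintype.sum_sum_type, Fintype.sum_sum_type]
  have h0 : ∀ e : Sym2 V, (if (1 + δ) * D < hdeg (slotPairs G φ s ρ R S) (slotEdge φ) (Sum.inl e) then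
        (hdeg (slotPairs G φ s ρ R S) (slotEdge φ) (Sum.inl e) : ℝ) else 0) = 0 := by
    intro e
    rw [if_neg]
    rw [not_lt]
    have := hdeg_slotPairs_edge_le G φ ρ R S (s := s) e
    have : (hdeg (slotPairs G φ s ρ R S) (slotEdge φ) (Sum.inl e) : ℝ) ≤ 2 * s := by exact_mod_cast this
    nlinarith
  rw [sum_eq_zero fun e _ => h0 e, zero_add]
  have h1 : (∑ z : (ZMod q × Fin s) × V,
      if (1 + δ) * D < hdeg (slotPairs G φ s ρ R S) (slotEdge φ) (Sum.inr (Sum.inl z)) then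
        (hdeg (slotPairs G φ s ρ R S) (slotEdge φ) (Sum.inr (Sum.inl z)) : ℝ) else 0)
      ≤ 8 / (δ ^ 2 * D) * (s * starDev G φ q μ ρ R S) := by
    refine le_trans (sum_le_sum fun z _ => key _ _ _ (hdeg_slotPairs_out_le G φ ρ R S z.1.1 z.1.2 z.2)
      (hdeg' z.2)) ?_
    rw [← mul_sum]
    refine mul_le_mul_of_nonneg_left (le_of_eq ?_) (by positivity)
    rw [Fintype.sum_prod_type, Fintype.sum_prod_type, sum_comm]
    simp only
    rw [sum_const, card_univ, Fintype.card_fin, nsmul_eq_mul, sum_comm]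
    unfold starDev
    congr 1
    refine sum_congr rfl fun u _ => ?_
    exact Fintype.sum_equiv (Equiv.addLeft (ρ u)) _ _ fun l => rfl
  have h2 : (∑ z : (ZMod q × Fin s) × V,
      if (1 + δ) * D < hdeg (slotPairs G φ s ρ R S) (slotEdge φ) (Sum.inr (Sum.inr (Sum.inl z))) then
        (hdeg (slotPairs G φ s ρ R S) (slotEdge φ) (Sum.inr (Sum.inr (Sum.inl z))) : ℝ) else 0)
      ≤ 8 / (δ ^ 2 * D) * (s * starDev G φ q μ ρ R S) := by
    refine le_trans (sum_le_sum fun z _ => key _ _ _ (hdeg_slotPairs_in_le G φ ρ R S z.1.1 z.1.2 z.2)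
      (hdeg' z.2)) ?_
    rw [← mul_sum]
    refine mul_le_mul_of_nonneg_left (le_of_eq ?_) (by positivity)
    rw [Fintype.sum_prod_type, Fintype.sum_prod_type, sum_comm]
    simp only
    rw [sum_const, card_univ, Fintype.card_fin, nsmul_eq_mul, sum_comm]
    unfold starDev
    congr 1
    refine sum_congr rfl fun u _ => ?_
    exact Fintype.sum_equiv (Equiv.subLeft (ρ u)) _ _ fun l => by simp
  have h3 : (∑ z : (ZMod q × Fin s) × C,
      if (1 + δ) * D < hdeg (slotPairs G φ s ρ R S) (slotEdge φ) (Sum.inr (Sum.inr (Sum.inr z))) then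
        (hdeg (slotPairs G φ s ρ R S) (slotEdge φ) (Sum.inr (Sum.inr (Sum.inr z))) : ℝ) else 0)
      ≤ 8 / (δ ^ 2 * D) * (s * colourDev G φ q μ ρ R) := by
    refine le_trans (sum_le_sum fun z _ => key _ _ _ (hdeg_slotPairs_colour_le G φ ρ R S z.1.1 z.1.2 z.2)
      (hcol z.2)) ?_
    rw [← mul_sum]
    refine mul_le_mul_of_nonneg_left (le_of_eq ?_) (by positivity)
    rw [Fintype.sum_prod_type, Fintype.sum_prod_type, sum_comm]
    simp only
    rw [sum_const, card_univ, Fintype.card_fin, nsmul_eq_mul, sum_comm]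
    rfl
  linarith

end Slots

lemma exists_slot_matching {ε : ℝ} (hε : 0 < ε) (hε1 : ε ≤ 1) :
    ∃ η : ℝ, 0 < η ∧ ∀ (V C : Type) [Fintype V] [Fintype C] (G : SimpleGraph V) (φ : Sym2 V → C)
      (q : ℕ) [NeZero q] (s : ℕ) (ρ : V → ZMod q) (R : V → Prop) (S : C → Prop) (μ D δ M : ℝ),
      0 < D → 0 < δ → δ ≤ 1 → 2 * s ≤ D → 2 ≤ M → M ≤ η * D →
      (∀ v c, ((univ.filter fun u => G.Adj v u ∧ φ s(v, u) = c).card : ℝ) ≤ M) →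
      (∀ u, μ * (univ.filter fun v => G.Adj u v).card ≤ (1 + δ / 2) * D) →
      (∀ c, μ * (univ.filter fun p : V × V => G.Adj p.1 p.2 ∧ φ s(p.1, p.2) = c).card
        ≤ (1 + δ / 2) * D) →
      ∃ N ⊆ slotPairs G φ s ρ R S,
        (N : Set ((ZMod q × Fin s) × V × V)).PairwiseDisjoint (slotEdge φ) ∧
        (1 - ε) * ((s * (mainPairs G φ ρ R S).card - 8 / (δ ^ 2 * D) *
          (s * (2 * starDev G φ q μ ρ R S + colourDev G φ q μ ρ R))) / ((1 + δ) * D)) ≤ N.card := by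
  obtain ⟨η, hη, h⟩ := exists_matching_of_few_bad (r := 4) (by norm_num) hε hε1
  refine ⟨η, hη, ?_⟩
  intro V C _ _ G φ q _ s ρ R S μ D δ M hD hδ hδ1 hs hM hMD hloc hdeg' hcol
  have hDD : D ≤ (1 + δ) * D := by nlinarith
  obtain ⟨N, hN, hdis, hcard⟩ := h _ _ (slotPairs G φ s ρ R S) (slotEdge φ) ((1 + δ) * D) (by positivity)
    (fun f _ => card_slotEdge φ f)
    (fun x y hxy => (hcodeg_slotEdge_le G φ hM hloc
      (fun f hf => (mem_filter.1 (mem_filter.1 hf).2.1).2.1) x y hxy).trans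
        (hMD.trans (mul_le_mul_of_nonneg_left hDD hη.le)))
  refine ⟨N, hN, hdis, le_trans ?_ hcard⟩
  refine mul_le_mul_of_nonneg_left ?_ (by linarith)
  refine div_le_div_of_nonneg_right ?_ (by positivity)
  have h1 := sum_bad_slotPairs_le G φ ρ R S hD hδ hδ1 hs hdeg' hcol
  have h2 : (s * (mainPairs G φ ρ R S).card : ℝ) ≤ (slotPairs G φ s ρ R S).card := by
    exact_mod_cast le_card_slotPairs G φ ρ R S
  linarith

lemma main_term_le {n d d₀ κ q δ η θ : ℝ} (hn : 0 < n) (hd₀ : 0 < d₀) (hd : d₀ ≤ d)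
    (hκ : 1 / 2 ≤ κ) (hκ1 : κ ≤ 1) (hq2 : 2 ≤ q) (hqδ : 1 ≤ δ * q)
    (hη : 0 ≤ η) (hηθ : η ≤ θ) :
    (q - 1) * n * (κ - δ - θ / d₀) - θ * n * (4 * q / d₀) ≤
      ((q - 1) ^ 2 / q ^ 2 * κ ^ 3 * ((d - η) * n ^ 2) - θ * n ^ 2) / (d * n * (κ ^ 2 / q)) := by
  have hd0 : 0 < d := by linarith
  have hκ0 : 0 < κ := by linarith
  have hq0 : 0 < q := by linarith
  have hθ0 : 0 ≤ θ := hη.trans hηθ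
  have g2 : ((q - 1) ^ 2 / q ^ 2 * κ ^ 3 * ((d - η) * n ^ 2) - θ * n ^ 2) / (d * n * (κ ^ 2 / q))
      = (q - 1) * n * ((1 - 1 / q) * κ * (1 - η / d)) - θ * n * (q / (d * κ ^ 2)) := by
    field_simp
  have g3 : η / d ≤ θ / d₀ := div_le_div₀ hθ0 hηθ hd₀ hd
  have g3' : 0 ≤ η / d := by positivity
  have g4 : 1 / q ≤ δ := by rw [div_le_iff₀ hq0]; exact hqδ
  have g5 : κ - δ - θ / d₀ ≤ (1 - 1 / q) * κ * (1 - η / d) := by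
    have a1 : 0 ≤ 1 / q := by positivity
    have a2 : (1 / q) * κ ≤ (1 / q) * 1 := mul_le_mul_of_nonneg_left hκ1 a1
    have a4 : (1 - 1 / q) * κ ≤ 1 * 1 := mul_le_mul (by linarith) hκ1 hκ0.le zero_le_one
    have a3 : (1 - 1 / q) * κ * (η / d) ≤ 1 * 1 * (η / d) :=
      mul_le_mul_of_nonneg_right a4 g3'
    have a5 : (1 - 1 / q) * κ * (1 - η / d) = κ - 1 / q * κ - (1 - 1 / q) * κ * (η / d) := by ring
    rw [a5]; linarith
  have g6 : q / (d * κ ^ 2) ≤ 4 * q / d₀ := by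
    rw [div_le_div_iff₀ (by positivity) hd₀]
    have b1 : (1 / 2 : ℝ) ^ 2 ≤ κ ^ 2 := pow_le_pow_left₀ (by norm_num) hκ 2
    have b2 : d₀ * (1 / 2) ^ 2 ≤ d * κ ^ 2 := mul_le_mul hd b1 (by norm_num) hd0.le
    have b3 := mul_le_mul_of_nonneg_left b2 (by positivity : 0 ≤ 4 * q)
    linarith
  have g7 : (q - 1) * n * (κ - δ - θ / d₀) ≤ (q - 1) * n * ((1 - 1 / q) * κ * (1 - η / d)) :=
    mul_le_mul_of_nonneg_left g5 (mul_nonneg (by linarith) hn.le)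
  have g8 : θ * n * (q / (d * κ ^ 2)) ≤ θ * n * (4 * q / d₀) :=
    mul_le_mul_of_nonneg_left g6 (by positivity)
  rw [g2]; linarith

lemma error_term_le {n d d₀ κ q δ θ : ℝ} (hn : 0 < n) (hd₀ : 0 < d₀) (hd : d₀ ≤ d)
    (hκ : 1 / 2 ≤ κ) (hq0 : 0 < q) (hδ : 0 < δ) (hθ0 : 0 ≤ θ) (hθ1 : θ ≤ 1) :
    24 * (θ ^ 2 * n ^ 3) / (δ ^ 2 * (d * n * (κ ^ 2 / q))) / (d * n * (κ ^ 2 / q))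
      ≤ θ * n * (384 * q ^ 2 / (δ ^ 2 * d₀ ^ 2)) := by
  have hd0 : 0 < d := by linarith
  have hκ0 : 0 < κ := by linarith
  have g2 : 24 * (θ ^ 2 * n ^ 3) / (δ ^ 2 * (d * n * (κ ^ 2 / q))) / (d * n * (κ ^ 2 / q))
      = θ ^ 2 * n * (24 * q ^ 2 / (δ ^ 2 * (d ^ 2 * κ ^ 4))) := by
    field_simp
  rw [g2]
  have h2 : θ ^ 2 ≤ θ := by nlinarith
  refine mul_le_mul (mul_le_mul_of_nonneg_right h2 hn.le) ?_ (by positivity) (by positivity)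
  rw [div_le_div_iff₀ (by positivity) (by positivity)]
  have b1 : (1 / 2 : ℝ) ^ 4 ≤ κ ^ 4 := pow_le_pow_left₀ (by norm_num) hκ 4
  have b3 : d₀ ^ 2 ≤ d ^ 2 := pow_le_pow_left₀ hd₀.le hd 2
  have b2 : d₀ ^ 2 * (1 / 2) ^ 4 ≤ d ^ 2 * κ ^ 4 := mul_le_mul b3 b1 (by norm_num) (by positivity)
  have b4 : 384 * q ^ 2 * δ ^ 2 * (d₀ ^ 2 * (1 / 2) ^ 4) ≤ 384 * q ^ 2 * δ ^ 2 * (d ^ 2 * κ ^ 4) :=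
    mul_le_mul_of_nonneg_left b2 (by positivity)
  linarith

lemma slot_count_bound {n d d₀ κ q δ η θ mp s N m D : ℝ} (hn : 0 < n) (hd₀ : 0 < d₀) (hd : d₀ ≤ d)
    (hκ : 1 / 2 ≤ κ) (hκ1 : κ ≤ 1) (hq2 : 2 ≤ q) (hδ : 0 < δ) (hδ1 : δ ≤ 1) (hqδ : 1 ≤ δ * q)
    (hη : 0 ≤ η) (hηθ : η ≤ θ) (hθ1 : θ ≤ 1)
    (hθ : θ * (1 / d₀ + 4 * q / d₀ + 384 * q ^ 2 / (δ ^ 2 * d₀ ^ 2) + 1) ≤ δ / 2) (hs : 0 ≤ s)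
    (hD : D = d * n * (κ ^ 2 / q))
    (hmp : (q - 1) ^ 2 / q ^ 2 * κ ^ 3 * ((d - η) * n ^ 2) - θ * n ^ 2 ≤ mp)
    (hN : (1 - δ) * ((s * mp - 8 / (δ ^ 2 * D) * (s * (3 * (θ ^ 2 * n ^ 3)))) / ((1 + δ) * D)) ≤ N)
    (hm : m ≤ κ * n + θ * n) : (q - 1) * s * (m - 8 * δ * n) ≤ N := by
  have hd0 : 0 < d := by linarith
  have hκ0 : 0 < κ := by linarith
  have hq0 : 0 < q := by linarith
  have hD0 : 0 < D := by rw [hD]; positivity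
  have hθ0 : 0 ≤ θ := hη.trans hηθ
  obtain ⟨X, hX⟩ : ∃ X, X = (mp - 24 * (θ ^ 2 * n ^ 3) / (δ ^ 2 * D)) / D := ⟨_, rfl⟩
  have e1 : (1 - δ) * ((s * mp - 8 / (δ ^ 2 * D) * (s * (3 * (θ ^ 2 * n ^ 3)))) / ((1 + δ) * D))
      = (1 - δ) / (1 + δ) * (s * X) := by
    rw [hX]; field_simp; ring
  rw [e1] at hN
  have f1 := (main_term_le hn hd₀ hd hκ hκ1 hq2 hqδ hη hηθ).trans
    (div_le_div_of_nonneg_right hmp (hD ▸ hD0.le))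
  have f2 := error_term_le hn hd₀ hd hκ hq0 hδ hθ0 hθ1
  rw [← hD] at f1 f2
  obtain ⟨P, hP⟩ : ∃ P, P = 4 * q / d₀ := ⟨_, rfl⟩
  obtain ⟨Q, hQ⟩ : ∃ Q, Q = 384 * q ^ 2 / (δ ^ 2 * d₀ ^ 2) := ⟨_, rfl⟩
  have hP0 : 0 ≤ P := by rw [hP]; positivity
  have hQ0 : 0 ≤ Q := by rw [hQ]; positivity
  rw [← hP] at f1 hθ
  rw [← hQ] at f2 hθ
  obtain ⟨y, hy⟩ : ∃ y, y = θ / d₀ + θ * (P + Q) := ⟨_, rfl⟩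
  have hy0 : 0 ≤ y := by rw [hy]; positivity
  have hyδ : y + θ ≤ δ / 2 := by
    refine le_trans (le_of_eq ?_) hθ
    rw [hy]; ring
  have f3 : (q - 1) * n * (κ - δ - y) ≤ X := by
    have c1 : θ * n * (P + Q) ≤ (q - 1) * (θ * n * (P + Q)) :=
      le_mul_of_one_le_left (by positivity) (by linarith)
    have c2 : (q - 1) * n * (κ - δ - y) = (q - 1) * n * (κ - δ - θ / d₀) - (q - 1) * (θ * n * (P + Q)) := by
      rw [hy]; ring
    rw [hX, sub_div, c2]
    linarith
  have f4 : κ - δ - y - 2 * δ ≤ (1 - δ) / (1 + δ) * (κ - δ - y) := by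
    have : (1 - δ) / (1 + δ) = 1 - 2 * δ / (1 + δ) := by field_simp; ring
    rw [this]
    have c1 : 2 * δ / (1 + δ) ≤ 2 * δ := div_le_self (by linarith) (by linarith)
    have c2 : 0 ≤ 2 * δ / (1 + δ) := by positivity
    have c3 : κ - δ - y ≤ 1 := by linarith
    have c4 : 2 * δ / (1 + δ) * (κ - δ - y) ≤ 2 * δ / (1 + δ) * 1 := mul_le_mul_of_nonneg_left c3 c2
    linarith
  have hc : 0 ≤ (1 - δ) / (1 + δ) := div_nonneg (by linarith) (by linarith)
  have f5 : (1 - δ) / (1 + δ) * (s * ((q - 1) * n * (κ - δ - y))) ≤ (1 - δ) / (1 + δ) * (s * X) :=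
    mul_le_mul_of_nonneg_left (mul_le_mul_of_nonneg_left f3 hs) hc
  have f6 : (q - 1) * s * n * (κ - δ - y - 2 * δ) ≤ (q - 1) * s * n * ((1 - δ) / (1 + δ) * (κ - δ - y)) :=
    mul_le_mul_of_nonneg_left f4 (mul_nonneg (mul_nonneg (by linarith) hs) hn.le)
  have f7 : (q - 1) * s * (m - 8 * δ * n) ≤ (q - 1) * s * (n * (κ - δ - y - 2 * δ)) := by
    refine mul_le_mul_of_nonneg_left ?_ (mul_nonneg (by linarith) hs)
    have : m - 8 * δ * n ≤ n * (κ + θ - 8 * δ) := by linarith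
    refine this.trans (mul_le_mul_of_nonneg_left ?_ hn.le)
    linarith
  calc _ ≤ _ := f7
    _ = (q - 1) * s * n * (κ - δ - y - 2 * δ) := by ring
    _ ≤ _ := f6
    _ = _ := by ring
    _ ≤ _ := f5
    _ ≤ _ := hN

/-- A family of rainbow linear forests of main pairs, indexed by slots. -/
structure SlotFamily {V C : Type} [Fintype V] (G : SimpleGraph V) (φ : Sym2 V → C) {q : ℕ} [NeZero q]
    {s : ℕ} (ρ : V → ZMod q) (R : V → Prop) (S : C → Prop)
    (Mt : ZMod q × Fin s → Finset (V × V)) : Prop where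
  mem : ∀ i, ∀ p ∈ Mt i, p ∈ mainPairs G φ ρ R S
  label : ∀ i, ∀ p ∈ Mt i, ρ p.2 = ρ p.1 + i.1
  out_inj : ∀ i, ∀ p ∈ Mt i, ∀ p' ∈ Mt i, p.1 = p'.1 → p = p'
  in_inj : ∀ i, ∀ p ∈ Mt i, ∀ p' ∈ Mt i, p.2 = p'.2 → p = p'
  colour_inj : ∀ i, ∀ p ∈ Mt i, ∀ p' ∈ Mt i, φ s(p.1, p.2) = φ s(p'.1, p'.2) → p = p'
  edge_inj : ∀ i j, ∀ p ∈ Mt i, ∀ p' ∈ Mt j, s(p.1, p.2) = s(p'.1, p'.2) → i = j ∧ p = p'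

lemma slotFamily_of_matching {V C : Type} [Fintype V] (G : SimpleGraph V) (φ : Sym2 V → C) {q : ℕ}
    [NeZero q] {s : ℕ} (ρ : V → ZMod q) (R : V → Prop) (S : C → Prop)
    {N : Finset ((ZMod q × Fin s) × V × V)} (hN : N ⊆ slotPairs G φ s ρ R S)
    (hdis : (N : Set ((ZMod q × Fin s) × V × V)).PairwiseDisjoint (slotEdge φ)) :
    ∃ Mt : ZMod q × Fin s → Finset (V × V), SlotFamily G φ ρ R S Mt ∧ ∑ i, (Mt i).card = N.card := by
  have hmem : ∀ i p, p ∈ (N.filter fun f => f.1 = i).image Prod.snd ↔ (i, p) ∈ N := by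
    intro i p
    simp only [mem_image, mem_filter]
    constructor
    · rintro ⟨⟨j, p'⟩, ⟨h1, h2⟩, h3⟩
      simp only at h2 h3
      rw [← h2, ← h3]; exact h1
    · intro h
      exact ⟨(i, p), ⟨h, rfl⟩, rfl⟩
  have hd : ∀ f ∈ N, ∀ f' ∈ N, ∀ x, x ∈ slotEdge φ f → x ∈ slotEdge φ f' → f = f' := by
    intro f hf f' hf' x h1 h2
    by_contra hne
    exact disjoint_left.1 (hdis hf hf' hne) h1 h2
  refine ⟨fun i => (N.filter fun f => f.1 = i).image Prod.snd, ⟨?_, ?_, ?_, ?_, ?_, ?_⟩, ?_⟩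
  · intro i p hp
    exact (mem_filter.1 (hN ((hmem _ _).1 hp))).2.1
  · intro i p hp
    exact (mem_filter.1 (hN ((hmem _ _).1 hp))).2.2
  · intro i p hp p' hp' h
    have := hd _ ((hmem _ _).1 hp) _ ((hmem _ _).1 hp') (Sum.inr (Sum.inl (i, p.1)))
      ((out_mem_slotEdge _ _ _).2 rfl) ((out_mem_slotEdge _ _ _).2 (by rw [h]))
    exact (Prod.mk.inj this).2
  · intro i p hp p' hp' h
    have := hd _ ((hmem _ _).1 hp) _ ((hmem _ _).1 hp') (Sum.inr (Sum.inr (Sum.inl (i, p.2))))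
      ((in_mem_slotEdge _ _ _).2 rfl) ((in_mem_slotEdge _ _ _).2 (by rw [h]))
    exact (Prod.mk.inj this).2
  · intro i p hp p' hp' h
    have := hd _ ((hmem _ _).1 hp) _ ((hmem _ _).1 hp')
      (Sum.inr (Sum.inr (Sum.inr (i, φ s(p.1, p.2)))))
      ((colour_mem_slotEdge _ _ _).2 rfl) ((colour_mem_slotEdge _ _ _).2 (by rw [h]))
    exact (Prod.mk.inj this).2
  · intro i j p hp p' hp' h
    have := hd _ ((hmem _ _).1 hp) _ ((hmem _ _).1 hp') (Sum.inl s(p.1, p.2))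
      ((edge_mem_slotEdge _ _ _).2 rfl) ((edge_mem_slotEdge _ _ _).2 h)
    exact Prod.mk.inj this
  · rw [card_eq_sum_card_fiberwise (f := Prod.fst) (t := univ) (fun _ _ => mem_coe.2 (mem_univ _))]
    refine sum_congr rfl fun i _ => card_image_of_injOn ?_
    rintro ⟨a, p⟩ h1 ⟨b, p'⟩ h2 h
    have h1 := (mem_filter.1 (mem_coe.1 h1)).2
    have h2 := (mem_filter.1 (mem_coe.1 h2)).2
    simp only at h1 h2 h
    rw [h1, h2, h]

lemma exists_good_slots {V C : Type} [Fintype V] {G : SimpleGraph V} {φ : Sym2 V → C} {q : ℕ}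
    [NeZero q] {s : ℕ} {ρ : V → ZMod q} {R : V → Prop} {S : C → Prop}
    {Mt : ZMod q × Fin s → Finset (V × V)} (h : SlotFamily G φ ρ R S Mt) {β n : ℝ} (hβ : 0 < β)
    (hn : 0 < n) (hsum : ((q : ℝ) - 1) * s * ((univ.filter fun v => ¬ R v).card - β ^ 2 * n)
      ≤ (∑ i, (Mt i).card : ℕ)) :
    ∃ I₀ : Finset (ZMod q × Fin s), (∀ i ∈ I₀, i.1 ≠ 0) ∧ (1 - β) * (((q : ℝ) - 1) * s) ≤ I₀.card ∧
      ∀ i ∈ I₀, ((univ.filter fun v => ¬ R v).card : ℝ) - β * n ≤ (Mt i).card := by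
  obtain ⟨m, hm⟩ : ∃ m, m = (univ.filter fun v => ¬ R v).card := ⟨_, rfl⟩
  rw [← hm] at hsum ⊢
  have hle : ∀ i, (Mt i).card ≤ m := by
    intro i
    rw [hm]
    refine card_le_card_of_injOn Prod.fst ?_ ?_
    · intro p hp
      have := (mem_filter.1 (h.mem i p hp)).2
      simp [this.2.2.1]
    · intro p hp p' hp' e
      exact h.out_inj i p hp p' hp' e
  have hz : ∀ i : ZMod q × Fin s, i.1 = 0 → (Mt i).card = 0 := by
    intro i hi
    rw [card_eq_zero]
    refine eq_empty_of_forall_notMem fun p hp => ?_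
    have h1 := (mem_filter.1 (h.mem i p hp)).2.2.1.1
    have h2 := h.label i p hp
    rw [hi, add_zero] at h2
    exact h1 h2.symm
  set J := (univ.filter fun i : ZMod q × Fin s => i.1 ≠ 0) with hJ
  have hJc : (J.card : ℝ) = ((q : ℝ) - 1) * s := by
    have : J = (univ.erase (0 : ZMod q)) ×ˢ (univ : Finset (Fin s)) := by
      ext i; simp [hJ]
    rw [this, card_product, card_erase_of_mem (mem_univ _), card_univ, card_univ, ZMod.card,
      Fintype.card_fin, Nat.cast_mul, Nat.cast_sub (Nat.one_le_iff_ne_zero.2 (NeZero.ne q)), Nat.cast_one]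
  refine ⟨J.filter fun i => (m : ℝ) - β * n ≤ (Mt i).card, fun i hi => ?_, ?_, fun i hi => (mem_filter.1 hi).2⟩
  · exact (mem_filter.1 (mem_filter.1 hi).1).2
  · have h1 : ((∑ i, (Mt i).card : ℕ) : ℝ) = ∑ i ∈ J, ((Mt i).card : ℝ) := by
      push_cast
      refine (sum_subset (subset_univ _) fun i _ hi => ?_).symm
      simp only [hJ, mem_filter, mem_univ, true_and, not_not] at hi
      rw [hz i hi, Nat.cast_zero]
    have h2 : ∑ i ∈ J, ((Mt i).card : ℝ) ≤ ∑ i ∈ J, ((m : ℝ) - β * n +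
        if (m : ℝ) - β * n ≤ (Mt i).card then β * n else 0) := by
      refine sum_le_sum fun i _ => ?_
      split_ifs with hh
      · have := hle i
        have : ((Mt i).card : ℝ) ≤ m := by exact_mod_cast this
        linarith
      · linarith
    rw [sum_add_distrib, sum_const, nsmul_eq_mul, ← sum_filter, sum_const, nsmul_eq_mul, hJc] at h2
    rw [h1] at hsum
    have h3 : β * n * ((1 - β) * (((q : ℝ) - 1) * s)) ≤
        β * n * (J.filter fun i => (m : ℝ) - β * n ≤ (Mt i).card).card := by nlinarith
    exact le_of_mul_le_mul_left h3 (by positivity)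

lemma exists_slotFamily {β d₀ : ℝ} (hβ : 0 < β) (hβ1 : β ≤ 1) (hd₀ : 0 < d₀) (q : ℕ) [NeZero q] (hq2 : 2 ≤ q)
    (hq : 8 / β ^ 2 ≤ q) :
    ∃ θ₀ : ℝ, 0 < θ₀ ∧ ∀ (V C : Type) [Fintype V] [Fintype C] (G : SimpleGraph V) (φ : Sym2 V → C)
      (s : ℕ) (ρ : V → ZMod q) (R : V → Prop) (S : C → Prop) (n d κ η θ : ℝ), 0 < n → d₀ ≤ d →
      1 / 2 ≤ κ → κ ≤ 1 → 0 < η → η ≤ θ → θ ≤ θ₀ → 2 ≤ η * n → 2 * s ≤ d * n * (κ ^ 2 / q) →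
      (∀ v c, ((univ.filter fun u => G.Adj v u ∧ φ s(v, u) = c).card : ℝ) ≤ η * n) →
      (∀ u, ((univ.filter fun v => G.Adj u v).card : ℝ) ≤ (d + η) * n) →
      (∀ c, ((univ.filter fun p : V × V => G.Adj p.1 p.2 ∧ φ s(p.1, p.2) = c).card : ℝ)
        ≤ (1 + η) * d * n) →
      ((d - η) * n ^ 2 ≤ (univ.filter fun p : V × V => G.Adj p.1 p.2).card) →
      starDev G φ q (κ ^ 2 / q) ρ R S ≤ θ ^ 2 * n ^ 3 →
      colourDev G φ q (κ ^ 2 / q) ρ R ≤ θ ^ 2 * n ^ 3 →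
      (((mainPairs G φ ρ R S).card : ℝ) - ((q : ℝ) - 1) ^ 2 / (q : ℝ) ^ 2 * κ ^ 3 *
        (univ.filter fun p : V × V => G.Adj p.1 p.2).card) ^ 2 ≤ θ ^ 2 * n ^ 4 →
      (((univ.filter fun v => ¬ R v).card : ℝ) - κ * n) ^ 2 ≤ θ ^ 2 * n ^ 2 →
      ∃ (Mt : ZMod q × Fin s → Finset (V × V)) (I₀ : Finset (ZMod q × Fin s)),
        SlotFamily G φ ρ R S Mt ∧ (∀ i ∈ I₀, i.1 ≠ 0) ∧
        (1 - β) * (((q : ℝ) - 1) * s) ≤ I₀.card ∧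
        ∀ i ∈ I₀, ((univ.filter fun v => ¬ R v).card : ℝ) - β * n ≤ (Mt i).card := by
  obtain ⟨δ, hδ⟩ : ∃ δ, δ = β ^ 2 / 8 := ⟨_, rfl⟩
  have hδ0 : 0 < δ := by rw [hδ]; positivity
  have hδ1 : δ ≤ 1 := by rw [hδ]; nlinarith
  obtain ⟨η₁, hη₁, hmatch⟩ := exists_slot_matching hδ0 hδ1
  have hq0 : (0 : ℝ) < q := by exact_mod_cast (by omega : 0 < q)
  have hq2' : (2 : ℝ) ≤ q := by exact_mod_cast hq2
  obtain ⟨K, hK⟩ : ∃ K, K = 1 / d₀ + 4 * (q : ℝ) / d₀ + 384 * (q : ℝ) ^ 2 / (δ ^ 2 * d₀ ^ 2) + 1 := ⟨_, rfl⟩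
  have hK0 : 0 < K := by rw [hK]; positivity
  have hK1 : 1 ≤ K := by rw [hK]; linarith [show 0 ≤ 1 / d₀ + 4 * (q : ℝ) / d₀ + 384 * (q : ℝ) ^ 2 / (δ ^ 2 * d₀ ^ 2) by positivity]
  have hK2 : 1 / d₀ ≤ K := by rw [hK]; linarith [show 0 ≤ 4 * (q : ℝ) / d₀ + 384 * (q : ℝ) ^ 2 / (δ ^ 2 * d₀ ^ 2) by positivity]
  refine ⟨min (δ / 2 / K) (η₁ * d₀ / (4 * q)), by positivity, ?_⟩
  intro V C _ _ G φ s ρ R S n d κ η θ hn hd hκ hκ1 hη hηθ hθ hηn hs hloc hdeg' hcol hadj h1 h2 h3 h7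
  have hd0 : 0 < d := by linarith
  have hκ0 : 0 < κ := by linarith
  have hθ0 : 0 < θ := by linarith
  have hθK : θ * K ≤ δ / 2 := by
    rw [← le_div_iff₀ hK0]; exact hθ.trans (min_le_left _ _)
  have hθδ : θ ≤ δ / 2 := by nlinarith
  have hθd : θ ≤ δ / 2 * d₀ := by
    have : θ * (1 / d₀) ≤ δ / 2 := (mul_le_mul_of_nonneg_left hK2 hθ0.le).trans hθK
    rw [mul_one_div, div_le_iff₀ hd₀] at this
    exact this
  obtain ⟨D, hD⟩ : ∃ D, D = d * n * (κ ^ 2 / q) := ⟨_, rfl⟩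
  have hD0 : 0 < D := by rw [hD]; positivity
  have hμ : 0 ≤ κ ^ 2 / q := by positivity
  have hηD : η * n ≤ η₁ * D := by
    have a1 : η ≤ η₁ * d₀ / (4 * q) := hηθ.trans (hθ.trans (min_le_right _ _))
    have b1 : (1 / 2 : ℝ) ^ 2 ≤ κ ^ 2 := pow_le_pow_left₀ (by norm_num) hκ 2
    have b2 : d₀ * (1 / 2) ^ 2 ≤ d * κ ^ 2 := mul_le_mul hd b1 (by norm_num) hd0.le
    have a2 : η₁ * d₀ / (4 * q) = η₁ * (d₀ * (1 / 2) ^ 2 / q) := by field_simp; norm_num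
    have a3 : η₁ * D = η₁ * (d * κ ^ 2 / q) * n := by rw [hD]; ring
    rw [a3]
    refine mul_le_mul_of_nonneg_right (a1.trans (a2.trans_le ?_)) hn.le
    exact mul_le_mul_of_nonneg_left (div_le_div_of_nonneg_right b2 hq0.le) hη₁.le
  obtain ⟨N, hN, hdis, hcard⟩ := hmatch V C G φ q s ρ R S (κ ^ 2 / q) D δ (η * n) hD0 hδ0 hδ1
    (by rw [hD]; exact hs) hηn hηD hloc (by
      intro u
      have hd' : δ / 2 * d₀ ≤ δ / 2 * d := mul_le_mul_of_nonneg_left hd (by positivity)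
      have : (d + η) * n ≤ (1 + δ / 2) * (d * n) := by
        rw [← mul_assoc]; exact mul_le_mul_of_nonneg_right (by linarith) hn.le
      have := mul_le_mul_of_nonneg_left ((hdeg' u).trans this) hμ
      rw [hD]; linarith) (by
      intro c
      have : (1 + η) * d * n ≤ (1 + δ / 2) * (d * n) := by
        rw [mul_assoc]; exact mul_le_mul_of_nonneg_right (by linarith) (by positivity)
      have := mul_le_mul_of_nonneg_left ((hcol c).trans this) hμ
      rw [hD]; linarith)
  obtain ⟨Mt, hMt, hsum⟩ := slotFamily_of_matching G φ ρ R S hN hdis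
  have hcard' : (1 - δ) * ((s * (mainPairs G φ ρ R S).card - 8 / (δ ^ 2 * D) *
      (s * (3 * (θ ^ 2 * n ^ 3)))) / ((1 + δ) * D)) ≤ N.card := by
    refine le_trans (mul_le_mul_of_nonneg_left (div_le_div_of_nonneg_right ?_ (by positivity)) (by linarith)) hcard
    refine sub_le_sub_left (mul_le_mul_of_nonneg_left (mul_le_mul_of_nonneg_left ?_ (Nat.cast_nonneg _)) (by positivity)) _
    linarith
  have hmp : ((q : ℝ) - 1) ^ 2 / (q : ℝ) ^ 2 * κ ^ 3 * ((d - η) * n ^ 2) - θ * n ^ 2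
      ≤ (mainPairs G φ ρ R S).card := by
    have a1 := abs_le_of_sq_le_sq' (h3.trans_eq (by ring : _ = (θ * n ^ 2) ^ 2)) (by positivity)
    have a2 := mul_le_mul_of_nonneg_left hadj (by positivity : 0 ≤ ((q : ℝ) - 1) ^ 2 / (q : ℝ) ^ 2 * κ ^ 3)
    linarith [a1.1]
  have hm : ((univ.filter fun v => ¬ R v).card : ℝ) ≤ κ * n + θ * n := by
    have a1 := abs_le_of_sq_le_sq' (h7.trans_eq (by ring : _ = (θ * n) ^ 2)) (by positivity)
    linarith [a1.2]
  have hfin := slot_count_bound hn hd₀ hd hκ hκ1 hq2' hδ0 hδ1 (by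
      rw [hδ]; rw [div_le_iff₀ (by positivity)] at hq; linarith) hη.le hηθ (by linarith)
    (by rw [← hK]; exact hθK) (Nat.cast_nonneg s) hD hmp hcard' hm
  obtain ⟨I₀, g1, g2, g3⟩ := exists_good_slots hMt hβ hn (by
    rw [hsum]
    refine le_trans (le_of_eq ?_) hfin
    rw [hδ]; ring)
  exact ⟨Mt, I₀, hMt, g1, g2, g3⟩

section Paths
variable {V : Type} {G : SimpleGraph V}

lemma eq_end_or_exists_dart_fst {a b v : V} (p : G.Walk a b) (hv : v ∈ p.support) :
    v = b ∨ ∃ d ∈ p.darts, d.fst = v := by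
  rw [← SimpleGraph.Walk.map_fst_darts_append, List.mem_append, List.mem_map, List.mem_singleton] at hv
  exact hv.symm

lemma eq_start_or_exists_dart_snd {a b v : V} (p : G.Walk a b) (hv : v ∈ p.support) :
    v = a ∨ ∃ d ∈ p.darts, d.snd = v := by
  rw [← SimpleGraph.Walk.cons_map_snd_darts, List.mem_cons, List.mem_map] at hv
  exact hv

lemma le_of_forall_dart {a b : V} (p : G.Walk a b) (f : V → ℕ)
    (h : ∀ d ∈ p.darts, f d.snd = f d.fst + 1) : f a ≤ f b := by
  induction p with
  | nil => exact le_rfl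
  | cons hadj p ih =>
    have h1 := h ⟨(_, _), hadj⟩ (by simp)
    have h2 := ih fun d hd => h d (by simp [hd])
    simp only at h1
    omega

/-- The support of a walk with unspecified endpoints. -/
def wsupport (w : Σ a b : V, G.Walk a b) : List V := w.2.2.support

lemma exists_path_partition (W : Finset V) (f : V → ℕ) (M : Finset (V × V)) :
    (∀ p ∈ M, G.Adj p.1 p.2 ∧ p.1 ∈ W ∧ p.2 ∈ W ∧ f p.2 = f p.1 + 1) →
    (∀ p ∈ M, ∀ p' ∈ M, p.1 = p'.1 → p = p') → (∀ p ∈ M, ∀ p' ∈ M, p.2 = p'.2 → p = p') →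
    ∃ l : List (Σ a b : V, G.Walk a b), (∀ w ∈ l, w.2.2.IsPath) ∧
      l.Pairwise (fun w w' => (wsupport w).Disjoint (wsupport w')) ∧
      (∀ v, v ∈ W ↔ ∃ w ∈ l, v ∈ wsupport w) ∧
      (∀ w ∈ l, ∀ d ∈ w.2.2.darts, d.toProd ∈ M) ∧ l.length + M.card = W.card := by
  induction M using Finset.induction_on with
  | empty =>
    intro _ _ _
    refine ⟨W.toList.map fun a => ⟨a, a, SimpleGraph.Walk.nil⟩, ?_, ?_, ?_, ?_, ?_⟩
    · intro w hw
      obtain ⟨a, -, rfl⟩ := List.mem_map.1 hw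
      exact SimpleGraph.Walk.IsPath.nil
    · rw [List.pairwise_map]
      refine W.nodup_toList.imp fun {a b} hab => ?_
      simp [wsupport, Ne.symm hab]
    · intro v
      simp [wsupport]
    · intro w hw
      obtain ⟨a, -, rfl⟩ := List.mem_map.1 hw
      simp
    · simp
  | insert p M hp ih =>
    intro hM hout hin
    obtain ⟨l, h1, h2, h3, h4, h5⟩ := ih (fun x hx => hM x (mem_insert_of_mem hx))
      (fun x hx y hy => hout x (mem_insert_of_mem hx) y (mem_insert_of_mem hy))
      (fun x hx y hy => hin x (mem_insert_of_mem hx) y (mem_insert_of_mem hy))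
    obtain ⟨u, v⟩ := p
    obtain ⟨hadj, hu, hv, hf⟩ := hM _ (mem_insert_self _ _)
    simp only at hadj hu hv hf
    obtain ⟨⟨a, b, P⟩, hP, huP⟩ := (h3 u).1 hu
    obtain ⟨⟨c, e, Q⟩, hQ, hvQ⟩ := (h3 v).1 hv
    simp only [wsupport] at huP hvQ
    have hub : u = b := by
      rcases eq_end_or_exists_dart_fst P huP with h | ⟨d, hd, hdu⟩
      · exact h
      · have hdM := h4 _ hP d hd
        have := hout _ (mem_insert_of_mem hdM) (u, v) (mem_insert_self _ _) hdu
        exact absurd (this ▸ hdM) hp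
    have hvc : v = c := by
      rcases eq_start_or_exists_dart_snd Q hvQ with h | ⟨d, hd, hdu⟩
      · exact h
      · have hdM := h4 _ hQ d hd
        have := hin _ (mem_insert_of_mem hdM) (u, v) (mem_insert_self _ _) hdu
        exact absurd (this ▸ hdM) hp
    subst hub hvc
    have hne : (⟨v, e, Q⟩ : Σ a b : V, G.Walk a b) ≠ ⟨a, u, P⟩ := by
      intro h
      have hva : v = a := congrArg Sigma.fst h
      have := le_of_forall_dart P f fun d hd => (hM _ (mem_insert_of_mem (h4 _ hP d hd))).2.2.2
      rw [← hva] at this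
      omega
    have hperm1 := List.perm_cons_erase hP
    have hQ' : (⟨v, e, Q⟩ : Σ a b : V, G.Walk a b) ∈ l.erase ⟨a, u, P⟩ :=
      (List.mem_erase_of_ne hne).2 hQ
    have hperm := hperm1.trans ((List.perm_cons_erase hQ').cons _)
    generalize (l.erase ⟨a, u, P⟩).erase ⟨v, e, Q⟩ = l' at hperm
    have hsymm : ∀ {w w' : Σ a b : V, G.Walk a b}, (wsupport w).Disjoint (wsupport w') →
        (wsupport w').Disjoint (wsupport w) := fun h => h.symm
    have h2' := (hperm.pairwise_iff hsymm).1 h2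
    simp only [List.pairwise_cons, List.mem_cons, forall_eq_or_imp] at h2'
    obtain ⟨⟨hPQ, hPl⟩, hQl, hl'⟩ := h2'
    have hmem : ∀ w, w ∈ l ↔ w = ⟨a, u, P⟩ ∨ w = ⟨v, e, Q⟩ ∨ w ∈ l' := fun w => by
      rw [hperm.mem_iff, List.mem_cons, List.mem_cons]
    have hsupp : (P.append (SimpleGraph.Walk.cons hadj Q)).support = P.support ++ Q.support := by
      rw [SimpleGraph.Walk.support_append, SimpleGraph.Walk.support_cons, List.tail_cons]
    refine ⟨⟨a, e, P.append (SimpleGraph.Walk.cons hadj Q)⟩ :: l', ?_, ?_, ?_, ?_, ?_⟩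
    · intro w hw
      rcases List.mem_cons.1 hw with rfl | hw
      · rw [SimpleGraph.Walk.isPath_def, hsupp]
        exact List.Nodup.append (h1 _ hP).support_nodup (h1 _ hQ).support_nodup hPQ
      · exact h1 w ((hmem w).2 (Or.inr (Or.inr hw)))
    · rw [List.pairwise_cons]
      refine ⟨fun w hw => ?_, hl'⟩
      unfold wsupport
      simp only
      rw [hsupp, List.disjoint_append_left]
      exact ⟨hPl w hw, hQl w hw⟩
    · intro x
      rw [h3 x]
      constructor
      · rintro ⟨w, hw, hx⟩
        rcases (hmem w).1 hw with rfl | rfl | hw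
        · refine ⟨_, List.mem_cons_self, ?_⟩
          unfold wsupport
          simp only
          rw [hsupp, List.mem_append]; exact Or.inl hx
        · refine ⟨_, List.mem_cons_self, ?_⟩
          unfold wsupport
          simp only
          rw [hsupp, List.mem_append]; exact Or.inr hx
        · exact ⟨w, List.mem_cons_of_mem _ hw, hx⟩
      · rintro ⟨w, hw, hx⟩
        rcases List.mem_cons.1 hw with rfl | hw
        · unfold wsupport at hx
          simp only at hx
          rw [hsupp, List.mem_append] at hx
          rcases hx with hx | hx
          · exact ⟨_, hP, hx⟩
          · exact ⟨_, hQ, hx⟩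
        · exact ⟨w, (hmem w).2 (Or.inr (Or.inr hw)), hx⟩
    · intro w hw d hd
      rcases List.mem_cons.1 hw with rfl | hw
      · simp only [SimpleGraph.Walk.darts_append, SimpleGraph.Walk.darts_cons, List.mem_append,
          List.mem_cons] at hd
        rcases hd with hd | rfl | hd
        · exact mem_insert_of_mem (h4 _ hP d hd)
        · exact mem_insert_self _ _
        · exact mem_insert_of_mem (h4 _ hQ d hd)
      · exact mem_insert_of_mem (h4 w ((hmem w).2 (Or.inr (Or.inr hw))) d hd)
    · rw [card_insert_of_notMem hp, ← h5, hperm.length_eq]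
      simp only [List.length_cons]
      ring

end Paths

section Linking
variable {V C : Type} {G : SimpleGraph V}

lemma exists_trim_start {a b : V} (p : G.Walk a b) (good : V → Prop) (hp : p.IsPath)
    (h : ∃ v ∈ p.support, good v) :
    ∃ (c : V) (p' : G.Walk c b), good c ∧ p'.IsPath ∧ p'.support.Sublist p.support ∧
      p'.edges.Sublist p.edges ∧ ∀ v ∈ p.support, good v → v ∈ p'.support := by
  induction p with
  | nil =>
    rename_i u
    obtain ⟨v, hv, hg⟩ := h
    simp only [SimpleGraph.Walk.support_nil, List.mem_singleton] at hv
    subst hv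
    exact ⟨v, SimpleGraph.Walk.nil, hg, hp, List.Sublist.refl _, List.Sublist.refl _, fun _ h _ => h⟩
  | cons hadj p ih =>
    rename_i u x y
    by_cases hu : good u
    · exact ⟨u, SimpleGraph.Walk.cons hadj p, hu, hp, List.Sublist.refl _, List.Sublist.refl _,
        fun _ h _ => h⟩
    · have hp' := (SimpleGraph.Walk.cons_isPath_iff hadj p).1 hp
      obtain ⟨v, hv, hg⟩ := h
      rw [SimpleGraph.Walk.support_cons, List.mem_cons] at hv
      obtain ⟨c, p', h1, h2, h3, h4, h5⟩ := ih hp'.1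
        ⟨v, hv.resolve_left fun e => hu (e ▸ hg), hg⟩
      refine ⟨c, p', h1, h2, h3.trans ?_, h4.trans ?_, fun w hw hgw => ?_⟩
      · rw [SimpleGraph.Walk.support_cons]; exact List.sublist_cons_self _ _
      · rw [SimpleGraph.Walk.edges_cons]; exact List.sublist_cons_self _ _
      · rw [SimpleGraph.Walk.support_cons, List.mem_cons] at hw
        exact h5 w (hw.resolve_left fun e => hu (e ▸ hgw)) hgw

lemma exists_trim_end {a b : V} (p : G.Walk a b) (good : V → Prop) (hp : p.IsPath)
    (h : ∃ v ∈ p.support, good v) :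
    ∃ (c : V) (p' : G.Walk a c), good c ∧ p'.IsPath ∧ p'.support ⊆ p.support ∧
      p'.edges.Sublist p.edges ∧ ∀ v ∈ p.support, good v → v ∈ p'.support := by
  obtain ⟨c, p', h1, h2, h3, h4, h5⟩ := exists_trim_start p.reverse good hp.reverse
    (by simpa using h)
  refine ⟨c, p'.reverse, h1, h2.reverse, fun v hv => ?_, ?_, fun v hv hg => ?_⟩
  · rw [SimpleGraph.Walk.support_reverse, List.mem_reverse] at hv
    simpa using h3.subset hv
  · simpa using h4.reverse
  · rw [SimpleGraph.Walk.support_reverse, List.mem_reverse]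
    exact h5 v (by simpa using hv) hg

/-- `a` and `b` can be joined by a three-edge path through reserved vertices outside `T`, using
distinct reserved colours outside `U` and edges outside `B`. -/
def Link (G : SimpleGraph V) (φ : Sym2 V → C) (R : V → Prop) (S : C → Prop) (B : Finset (Sym2 V))
    (U : Finset C) (T : Finset V) (a b : V) : Prop :=
  ∃ x y, (R x ∧ R y ∧ x ∉ T ∧ y ∉ T ∧ x ≠ y) ∧ (G.Adj a x ∧ G.Adj x y ∧ G.Adj y b) ∧
    (∀ e ∈ [s(a, x), s(x, y), s(y, b)], S (φ e) ∧ φ e ∉ U ∧ e ∉ B) ∧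
    ([s(a, x), s(x, y), s(y, b)].map φ).Nodup

/-- A rainbow path `Q` in the process of linking up linear-forest components: `X` is the set of
vertices of the components handled so far, `E` the set of main edges, `U` and `T` the reserved
colours and vertices used so far. -/
structure PathState (φ : Sym2 V → C) (R : V → Prop) (S : C → Prop) (B : Finset (Sym2 V))
    (E : Set (Sym2 V)) (Good : Finset C → Finset V → V → Prop) (X : Set V)
    {a b : V} (Q : G.Walk a b) (U : Finset C) (T : Finset V) : Prop where
  path : Q.IsPath
  supp : ∀ v ∈ Q.support, v ∈ X ∨ v ∈ T
  edge : ∀ e ∈ Q.edges, e ∈ E ∨ (e ∉ B ∧ φ e ∈ U)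
  nodup : (Q.edges.map φ).Nodup
  good : ∀ v ∈ X, Good U T v → v ∈ Q.support
  res : ∀ x ∈ T, R x
  colour : ∀ c ∈ U, S c

variable {φ : Sym2 V → C} {R : V → Prop} {S : C → Prop} {B : Finset (Sym2 V)}
  {E : Set (Sym2 V)} {Good : Finset C → Finset V → V → Prop}

lemma colour_disjoint {a b c e : V} {Q : G.Walk a b} {P : G.Walk c e} {U : Finset C}
    (hE : Set.InjOn φ E) (hES : ∀ e ∈ E, ¬ S (φ e)) (hU : ∀ c ∈ U, S c)
    (hQ : ∀ e ∈ Q.edges, e ∈ E ∨ (e ∉ B ∧ φ e ∈ U)) (hP : ∀ e ∈ P.edges, e ∈ E)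
    (hdis : ∀ v ∈ Q.support, v ∉ P.support) : (Q.edges.map φ).Disjoint (P.edges.map φ) := by
  intro k hk hk'
  obtain ⟨f, hf, rfl⟩ := List.mem_map.1 hk
  obtain ⟨g, hg, hfg⟩ := List.mem_map.1 hk'
  rcases hQ f hf with h | h
  · have := hE (hP g hg) h hfg
    subst this
    induction g with | _ x y
    exact hdis x (Q.fst_mem_support_of_mem_edges hf) (P.fst_mem_support_of_mem_edges hg)
  · exact hES g (hP g hg) (hfg ▸ hU _ h.2)

lemma PathState.step {X : Set V} {a b : V} {Q : G.Walk a b} {U : Finset C} {T : Finset V}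
    (h : PathState φ R S B E Good X Q U T)
    (hanti : ∀ U U' T T' v, U ⊆ U' → T ⊆ T' → Good U' T' v → Good U T v)
    (hlink : ∀ a b, a ≠ b → ¬ R a → ¬ R b → Good U T a → Good U T b → Link G φ R S B U T a b)
    (hE : Set.InjOn φ E) (hES : ∀ e ∈ E, ¬ S (φ e)) (hX : ∀ v ∈ X, ¬ R v)
    {c e : V} (P : G.Walk c e) (hP : P.IsPath) (hPE : ∀ f ∈ P.edges, f ∈ E)
    (hPR : ∀ v ∈ P.support, ¬ R v) (hPX : ∀ v ∈ P.support, v ∉ X) :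
    ∃ (a' b' : V) (Q' : G.Walk a' b') (U' : Finset C) (T' : Finset V),
      PathState φ R S B E Good (X ∪ {v | v ∈ P.support}) Q' U' T' ∧
      U'.card ≤ U.card + 3 ∧ T'.card ≤ T.card + 2 := by
  by_cases hPg : ∃ v ∈ P.support, Good U T v
  swap
  · push Not at hPg
    refine ⟨a, b, Q, U, T, ⟨h.path, fun v hv => ?_, h.edge, h.nodup, ?_, h.res, h.colour⟩, by omega, by omega⟩
    · exact (h.supp v hv).imp_left Or.inl
    · rintro v (hv | hv) hg
      · exact h.good v hv hg
      · exact absurd hg (hPg v hv)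
  have hPn : (P.edges.map φ).Nodup := by
    refine List.Nodup.map_on ?_ hP.isTrail.edges_nodup
    intro x hx y hy hxy
    exact hE (hPE x hx) (hPE y hy) hxy
  by_cases hQg : ∃ v ∈ Q.support, ¬ R v ∧ Good U T v
  swap
  · push Not at hQg
    refine ⟨c, e, P, U, T, ⟨hP, fun v hv => Or.inl (Or.inr hv), fun f hf => Or.inl (hPE f hf), hPn, ?_,
      h.res, h.colour⟩, by omega, by omega⟩
    rintro v (hv | hv) hg
    · exact absurd hg (hQg v (h.good v hv hg) (hX v hv))
    · exact hv
  obtain ⟨g, Q₁, ⟨hgR, hgG⟩, hQ₁, hQs, hQe, hQgood⟩ := exists_trim_end Q _ h.path hQg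
  obtain ⟨f, P₁, hfG, hP₁, hPs, hPe, hPgood⟩ := exists_trim_start P _ hP hPg
  have hfP : f ∈ P.support := hPs.subset P₁.start_mem_support
  have hQP : ∀ v ∈ Q.support, v ∉ P.support := by
    intro v hv hvP
    rcases h.supp v hv with hv | hv
    · exact hPX v hvP hv
    · exact hPR v hvP (h.res v hv)
  have hgQ : g ∈ Q.support := hQs Q₁.end_mem_support
  have hgf : g ≠ f := fun e => hQP g hgQ (e ▸ hfP)
  obtain ⟨x, y, ⟨hxR, hyR, hxT, hyT, hxy⟩, ⟨hax, hxy', hyb⟩, hcol, hnd⟩ :=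
    hlink g f hgf hgR (hPR f hfP) hgG hfG
  have hxQ : x ∉ Q.support := fun hx => (h.supp x hx).elim (fun h' => hX x h' hxR) hxT
  have hyQ : y ∉ Q.support := fun hx => (h.supp y hx).elim (fun h' => hX y h' hyR) hyT
  have hxP : x ∉ P.support := fun hx => hPR x hx hxR
  have hyP : y ∉ P.support := fun hx => hPR y hx hyR
  set L : List (Sym2 V) := [s(g, x), s(x, y), s(y, f)] with hL
  have hsupp : (Q₁.append (SimpleGraph.Walk.cons hax (SimpleGraph.Walk.cons hxy'
      (SimpleGraph.Walk.cons hyb P₁)))).support = Q₁.support ++ ([x, y] ++ P₁.support) := by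
    simp [SimpleGraph.Walk.support_append]
  have hedges : (Q₁.append (SimpleGraph.Walk.cons hax (SimpleGraph.Walk.cons hxy'
      (SimpleGraph.Walk.cons hyb P₁)))).edges = Q₁.edges ++ (L ++ P₁.edges) := by
    simp [SimpleGraph.Walk.edges_append, hL]
  refine ⟨a, e, Q₁.append (SimpleGraph.Walk.cons hax (SimpleGraph.Walk.cons hxy'
    (SimpleGraph.Walk.cons hyb P₁))), U ∪ (L.map φ).toFinset, T ∪ {x, y}, ⟨?_, ?_, ?_, ?_, ?_, ?_, ?_⟩, ?_, ?_⟩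
  · rw [SimpleGraph.Walk.isPath_def, hsupp]
    refine List.Nodup.append hQ₁.support_nodup (List.Nodup.append (by simp [hxy]) hP₁.support_nodup ?_) ?_
    · intro v hv hv'
      simp only [List.mem_cons, List.not_mem_nil, or_false] at hv
      rcases hv with rfl | rfl
      · exact hxP (hPs.subset hv')
      · exact hyP (hPs.subset hv')
    · intro v hv hv'
      simp only [List.mem_append, List.mem_cons, List.not_mem_nil, or_false] at hv'
      rcases hv' with (rfl | rfl) | hv'
      · exact hxQ (hQs hv)
      · exact hyQ (hQs hv)
      · exact hQP v (hQs hv) (hPs.subset hv')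
  · intro v hv
    rw [hsupp] at hv
    simp only [List.mem_append, List.mem_cons, List.not_mem_nil, or_false] at hv
    rcases hv with hv | (rfl | rfl) | hv
    · rcases h.supp v (hQs hv) with hv | hv
      · exact Or.inl (Or.inl hv)
      · exact Or.inr (mem_union_left _ hv)
    · exact Or.inr (by simp)
    · exact Or.inr (by simp)
    · exact Or.inl (Or.inr (hPs.subset hv))
  · intro k hk
    rw [hedges, List.mem_append, List.mem_append] at hk
    rcases hk with hk | hk | hk
    · exact (h.edge k (hQe.subset hk)).imp_right fun h' => ⟨h'.1, mem_union_left _ h'.2⟩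
    · exact Or.inr ⟨(hcol k hk).2.2, mem_union_right _ (List.mem_toFinset.2 (List.mem_map_of_mem hk))⟩
    · exact Or.inl (hPE k (hPe.subset hk))
  · rw [hedges, List.map_append, List.map_append]
    refine List.Nodup.append (h.nodup.sublist (hQe.map φ))
      (List.Nodup.append hnd (hPn.sublist (hPe.map φ)) ?_) ?_
    · intro k hk hk'
      obtain ⟨f', hf', rfl⟩ := List.mem_map.1 hk
      obtain ⟨g', hg', hfg⟩ := List.mem_map.1 hk'
      exact hES g' (hPE g' (hPe.subset hg')) (hfg ▸ (hcol f' hf').1)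
    · rw [List.disjoint_append_right]
      refine ⟨?_, ?_⟩
      · intro k hk hk'
        obtain ⟨f', hf', rfl⟩ := List.mem_map.1 hk
        obtain ⟨g', hg', hfg⟩ := List.mem_map.1 hk'
        have h1 := hcol g' hg'
        rw [hfg] at h1
        rcases h.edge f' (hQe.subset hf') with h2 | h2
        · exact hES f' h2 h1.1
        · exact h1.2.1 h2.2
      · have hd := colour_disjoint (P := P) hE hES h.colour h.edge hPE hQP
        intro k hk hk'
        exact hd ((hQe.map φ).subset hk) ((hPe.map φ).subset hk')
  · intro v hv hg
    have hg' : Good U T v := hanti _ _ _ _ v subset_union_left subset_union_left hg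
    rw [hsupp]
    simp only [List.mem_append]
    rcases hv with hv | hv
    · exact Or.inl (hQgood v (h.good v hv hg') ⟨hX v hv, hg'⟩)
    · exact Or.inr (Or.inr (hPgood v hv hg'))
  · intro v hv
    rcases mem_union.1 hv with hv | hv
    · exact h.res v hv
    · simp only [mem_insert, mem_singleton] at hv
      rcases hv with rfl | rfl <;> assumption
  · intro k hk
    rcases mem_union.1 hk with hk | hk
    · exact h.colour k hk
    · obtain ⟨f', hf', rfl⟩ := List.mem_map.1 (List.mem_toFinset.1 hk)
      exact (hcol f' hf').1
  · refine (card_union_le _ _).trans (Nat.add_le_add_left ?_ _)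
    exact (List.toFinset_card_le _).trans (by simp [hL])
  · exact (card_union_le _ _).trans (Nat.add_le_add_left card_le_two _)

end Linking

section Closing
variable {V C : Type} {G : SimpleGraph V}
variable {φ : Sym2 V → C} {R : V → Prop} {S : C → Prop} {B : Finset (Sym2 V)}
  {E : Set (Sym2 V)} {Good : Finset C → Finset V → V → Prop}

lemma PathState.extend {k : ℕ}
    (hanti : ∀ U U' T T' v, U ⊆ U' → T ⊆ T' → Good U' T' v → Good U T v)
    (hlink : ∀ U T, U.card ≤ 3 * k → T.card ≤ 2 * k →
      ∀ a b, a ≠ b → ¬ R a → ¬ R b → Good U T a → Good U T b → Link G φ R S B U T a b)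
    (hE : Set.InjOn φ E) (hES : ∀ e ∈ E, ¬ S (φ e)) (l : List (Σ a b : V, G.Walk a b)) :
    ∀ (X : Set V) (a b : V) (Q : G.Walk a b) (U : Finset C) (T : Finset V),
      PathState φ R S B E Good X Q U T → (∀ v ∈ X, ¬ R v) →
      U.card + 3 * l.length ≤ 3 * k → T.card + 2 * l.length ≤ 2 * k →
      (∀ w ∈ l, w.2.2.IsPath) → (∀ w ∈ l, ∀ f ∈ w.2.2.edges, f ∈ E) →
      (∀ w ∈ l, ∀ v ∈ wsupport w, ¬ R v ∧ v ∉ X) →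
      (l.Pairwise fun w w' => (wsupport w).Disjoint (wsupport w')) →
      ∃ (a' b' : V) (Q' : G.Walk a' b') (U' : Finset C) (T' : Finset V),
        PathState φ R S B E Good (X ∪ {v | ∃ w ∈ l, v ∈ wsupport w}) Q' U' T' ∧
        U'.card ≤ 3 * k ∧ T'.card ≤ 2 * k := by
  induction l with
  | nil =>
    intro X a b Q U T h _ hU hT _ _ _ _
    refine ⟨a, b, Q, U, T, ?_, by simpa using hU, by simpa using hT⟩
    have : X ∪ {v | ∃ w ∈ ([] : List (Σ a b : V, G.Walk a b)), v ∈ wsupport w} = X := by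
      ext v; simp
    rw [this]; exact h
  | cons w l ih =>
    intro X a b Q U T h hX hU hT hpath hedge hsupp hpw
    rw [List.length_cons] at hU hT
    rw [List.pairwise_cons] at hpw
    obtain ⟨a', b', Q', U', T', h', hU', hT'⟩ := h.step hanti
      (hlink U T (by omega) (by omega)) hE hES hX w.2.2 (hpath w (by simp)) (hedge w (by simp))
      (fun v hv => (hsupp w (by simp) v hv).1) (fun v hv => (hsupp w (by simp) v hv).2)
    have hX' : ∀ v ∈ X ∪ {v | v ∈ w.2.2.support}, ¬ R v := by
      rintro v (hv | hv)
      · exact hX v hv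
      · exact (hsupp w (by simp) v hv).1
    have hsupp' : ∀ w' ∈ l, ∀ v ∈ wsupport w', ¬ R v ∧ v ∉ X ∪ {v | v ∈ w.2.2.support} := by
      intro w' hw' v hv
      have h3 := hsupp w' (List.mem_cons_of_mem _ hw') v hv
      refine ⟨h3.1, ?_⟩
      rintro (hv' | hv')
      · exact h3.2 hv'
      · exact hpw.1 w' hw' hv' hv
    obtain ⟨a₂, b₂, Q₂, U₂, T₂, h₂, hU₂, hT₂⟩ := ih _ a' b' Q' U' T' h' hX' (by omega) (by omega)
      (fun w' hw' => hpath w' (List.mem_cons_of_mem _ hw'))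
      (fun w' hw' => hedge w' (List.mem_cons_of_mem _ hw')) hsupp' hpw.2
    refine ⟨a₂, b₂, Q₂, U₂, T₂, ?_, hU₂, hT₂⟩
    have : X ∪ {v | ∃ w' ∈ w :: l, v ∈ wsupport w'} =
        X ∪ {v | v ∈ w.2.2.support} ∪ {v | ∃ w ∈ l, v ∈ wsupport w} := by
      ext v; simp [wsupport, or_assoc]
    rw [this]; exact h₂

lemma PathState.exists_cycle {X : Set V} {a b : V} {Q : G.Walk a b} {U : Finset C} {T : Finset V}
    (h : PathState φ R S B E Good X Q U T)
    (hlink : ∀ a b, a ≠ b → ¬ R a → ¬ R b → Good U T a → Good U T b → Link G φ R S B U T a b)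
    (hES : ∀ e ∈ E, ¬ S (φ e)) (hX : ∀ v ∈ X, ¬ R v)
    (N : Finset V) (hN : ∀ v ∈ N, v ∈ X ∧ Good U T v) (hN2 : 2 ≤ N.card) :
    ∃ (c : V) (w : G.Walk c c) (U' : Finset C), w.IsCycle ∧ (w.edges.map φ).Nodup ∧
      (∀ e ∈ w.edges, e ∈ E ∨ (e ∉ B ∧ φ e ∈ U')) ∧ (∀ c ∈ U', S c) ∧
      U'.card ≤ U.card + 3 ∧ N.card ≤ w.length := by
  obtain ⟨n₁, hn₁⟩ : N.Nonempty := card_pos.1 (by omega)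
  have hgood : ∀ v ∈ N, ¬ R v ∧ Good U T v := fun v hv => ⟨hX v (hN v hv).1, (hN v hv).2⟩
  have hNQ : ∀ v ∈ N, v ∈ Q.support := fun v hv => h.good v (hN v hv).1 (hN v hv).2
  obtain ⟨e, Q₁, ⟨heR, heG⟩, hQ₁, hQs, hQe, hQgood⟩ := exists_trim_end Q
    (fun v => ¬ R v ∧ Good U T v) h.path ⟨n₁, hNQ _ hn₁, hgood _ hn₁⟩
  obtain ⟨g, Q₂, ⟨hgR, hgG⟩, hQ₂, hQs₂, hQe₂, hQgood₂⟩ := exists_trim_start Q₁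
    (fun v => ¬ R v ∧ Good U T v) hQ₁ ⟨n₁, hQgood _ (hNQ _ hn₁) (hgood _ hn₁), hgood _ hn₁⟩
  have hNQ₂ : ∀ v ∈ N, v ∈ Q₂.support := fun v hv =>
    hQgood₂ v (hQgood v (hNQ v hv) (hgood v hv)) (hgood v hv)
  have hlen : N.card ≤ Q₂.support.length :=
    (card_le_card fun v hv => List.mem_toFinset.2 (hNQ₂ v hv)).trans (List.toFinset_card_le _)
  have hge : e ≠ g := by
    rintro rfl
    have : Q₂ = SimpleGraph.Walk.nil := SimpleGraph.Walk.eq_nil_iff_nil.2 (SimpleGraph.Walk.isPath_iff_nil.1 hQ₂)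
    rw [this] at hlen
    simp at hlen
    omega
  obtain ⟨x, y, ⟨hxR, hyR, hxT, hyT, hxy⟩, ⟨hax, hxy', hyb⟩, hcol, hnd⟩ :=
    hlink e g hge heR hgR heG hgG
  have hsub : ∀ v ∈ Q₂.support, v ∈ Q.support := fun v hv => hQs (hQs₂.subset hv)
  have hesub : ∀ v ∈ Q₂.edges, v ∈ Q.edges := fun v hv => hQe.subset (hQe₂.subset hv)
  have hxQ : x ∉ Q₂.support := fun hx => (h.supp x (hsub x hx)).elim (fun h' => hX x h' hxR) hxT
  have hyQ : y ∉ Q₂.support := fun hx => (h.supp y (hsub y hx)).elim (fun h' => hX y h' hyR) hyT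
  set L : List (Sym2 V) := [s(e, x), s(x, y), s(y, g)] with hL
  set P := Q₂.append (SimpleGraph.Walk.cons hax (SimpleGraph.Walk.cons hxy' SimpleGraph.Walk.nil))
    with hP
  have hsupp : P.support = Q₂.support ++ [x, y] := by
    simp [hP, SimpleGraph.Walk.support_append]
  have hperm : (SimpleGraph.Walk.cons hyb P).edges.Perm (Q₂.edges ++ L) := by
    rw [SimpleGraph.Walk.edges_cons, hP, SimpleGraph.Walk.edges_append, hL]
    simp only [SimpleGraph.Walk.edges_cons, SimpleGraph.Walk.edges_nil]
    refine List.Perm.trans (List.perm_append_comm (l₁ := [s(y, g)])) ?_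
    simp
  have hnodup : ((SimpleGraph.Walk.cons hyb P).edges.map φ).Nodup := by
    rw [(hperm.map φ).nodup_iff, List.map_append]
    refine List.Nodup.append (h.nodup.sublist ((hQe₂.trans hQe).map φ)) hnd ?_
    intro k hk hk'
    obtain ⟨f', hf', rfl⟩ := List.mem_map.1 hk
    obtain ⟨g', hg', hfg⟩ := List.mem_map.1 hk'
    have h1 := hcol g' hg'
    rw [hfg] at h1
    rcases h.edge f' (hesub _ hf') with h2 | h2
    · exact hES f' h2 h1.1
    · exact h1.2.1 h2.2
  refine ⟨y, SimpleGraph.Walk.cons hyb P, U ∪ (L.map φ).toFinset, ?_, hnodup, ?_, ?_, ?_, ?_⟩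
  · rw [SimpleGraph.Walk.cons_isCycle_iff]
    refine ⟨?_, ?_⟩
    · rw [SimpleGraph.Walk.isPath_def, hsupp]
      refine List.Nodup.append hQ₂.support_nodup (by simp [hxy]) ?_
      intro v hv hv'
      simp only [List.mem_cons, List.not_mem_nil, or_false] at hv'
      rcases hv' with rfl | rfl
      · exact hxQ hv
      · exact hyQ hv
    · have := hnodup.of_map
      rw [SimpleGraph.Walk.edges_cons, List.nodup_cons] at this
      exact this.1
  · intro k hk
    rw [hperm.mem_iff, List.mem_append] at hk
    rcases hk with hk | hk
    · exact (h.edge k (hesub k hk)).imp_right fun h' => ⟨h'.1, mem_union_left _ h'.2⟩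
    · exact Or.inr ⟨(hcol k hk).2.2, mem_union_right _ (List.mem_toFinset.2 (List.mem_map_of_mem hk))⟩
  · intro k hk
    rcases mem_union.1 hk with hk | hk
    · exact h.colour k hk
    · obtain ⟨f', hf', rfl⟩ := List.mem_map.1 (List.mem_toFinset.1 hk)
      exact (hcol f' hf').1
  · refine (card_union_le _ _).trans (Nat.add_le_add_left ?_ _)
    exact (List.toFinset_card_le _).trans (by simp [hL])
  · rw [SimpleGraph.Walk.length_support] at hlen
    rw [SimpleGraph.Walk.length_cons, hP, SimpleGraph.Walk.length_append]
    omega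

lemma exists_rainbow_cycle {k m : ℕ} (W : Finset V) (l : List (Σ a b : V, G.Walk a b))
    (hl : l.length ≤ k) (hm : 2 ≤ m)
    (hanti : ∀ U U' T T' v, U ⊆ U' → T ⊆ T' → Good U' T' v → Good U T v)
    (hlink : ∀ U T, U.card ≤ 3 * k → T.card ≤ 2 * k →
      ∀ a b, a ≠ b → ¬ R a → ¬ R b → Good U T a → Good U T b → Link G φ R S B U T a b)
    (hgood : ∀ U T, U.card ≤ 3 * k → T.card ≤ 2 * k → m ≤ (W.filter fun v => Good U T v).card)
    (hE : Set.InjOn φ E) (hES : ∀ e ∈ E, ¬ S (φ e)) (hW : ∀ v ∈ W, ¬ R v)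
    (hpath : ∀ w ∈ l, w.2.2.IsPath) (hedge : ∀ w ∈ l, ∀ f ∈ w.2.2.edges, f ∈ E)
    (hcover : ∀ v, v ∈ W ↔ ∃ w ∈ l, v ∈ wsupport w)
    (hpw : l.Pairwise fun w w' => (wsupport w).Disjoint (wsupport w')) :
    ∃ (c : V) (w : G.Walk c c) (U' : Finset C), w.IsCycle ∧ (w.edges.map φ).Nodup ∧
      (∀ e ∈ w.edges, e ∈ E ∨ (e ∉ B ∧ φ e ∈ U')) ∧ (∀ c ∈ U', S c) ∧
      U'.card ≤ 3 * (k + 1) ∧ m ≤ w.length := by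
  cases l with
  | nil =>
    exfalso
    have h0 := (hgood ∅ ∅ (by simp) (by simp)).trans (card_filter_le _ _)
    have : W = ∅ := eq_empty_of_forall_notMem fun v hv => by simpa using (hcover v).1 hv
    rw [this] at h0
    simp at h0
    omega
  | cons w l =>
    rw [List.pairwise_cons] at hpw
    rw [List.length_cons] at hl
    have hWs : ∀ w' ∈ w :: l, ∀ v ∈ wsupport w', ¬ R v := fun w' hw' v hv =>
      hW v ((hcover v).2 ⟨w', hw', hv⟩)
    have h0 : PathState φ R S B E Good {v | v ∈ wsupport w} w.2.2 ∅ ∅ := by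
      refine ⟨hpath w (by simp), fun v hv => Or.inl hv, fun e he => Or.inl (hedge w (by simp) e he),
        ?_, fun v hv _ => hv, by simp, by simp⟩
      refine List.Nodup.map_on ?_ (hpath w (by simp)).isTrail.edges_nodup
      intro x hx y hy hxy
      exact hE (hedge w (by simp) x hx) (hedge w (by simp) y hy) hxy
    obtain ⟨a, b, Q, U, T, h, hU, hT⟩ := PathState.extend hanti hlink hE hES l _ _ _ _ _ _ h0
      (fun v hv => hWs w (by simp) v hv) (by simp; omega) (by simp; omega)
      (fun w' hw' => hpath w' (List.mem_cons_of_mem _ hw'))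
      (fun w' hw' => hedge w' (List.mem_cons_of_mem _ hw'))
      (fun w' hw' v hv => ⟨hWs w' (List.mem_cons_of_mem _ hw') v hv,
        fun h' => hpw.1 w' hw' h' hv⟩) hpw.2
    have hX : ∀ v ∈ {v | v ∈ wsupport w} ∪ {v | ∃ w ∈ l, v ∈ wsupport w}, ¬ R v := by
      rintro v (hv | ⟨w', hw', hv⟩)
      · exact hWs w (by simp) v hv
      · exact hWs w' (List.mem_cons_of_mem _ hw') v hv
    have hN : ∀ v ∈ W.filter fun v => Good U T v,
        v ∈ {v | v ∈ wsupport w} ∪ {v | ∃ w ∈ l, v ∈ wsupport w} ∧ Good U T v := by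
      intro v hv
      rw [mem_filter] at hv
      refine ⟨?_, hv.2⟩
      obtain ⟨w', hw', hv'⟩ := (hcover v).1 hv.1
      rcases List.mem_cons.1 hw' with rfl | hw'
      · exact Or.inl hv'
      · exact Or.inr ⟨w', hw', hv'⟩
    obtain ⟨c, w', U', h1, h2, h3, h4, h5, h6⟩ := h.exists_cycle (hlink U T hU hT) hES hX
      (W.filter fun v => Good U T v) hN (hm.trans (hgood U T hU hT))
    exact ⟨c, w', U', h1, h2, h3, h4, by omega, (hgood U T hU hT).trans h6⟩

end Closing

section Reserve
variable {V C : Type} [Fintype V] (G : SimpleGraph V) (φ : Sym2 V → C)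

noncomputable def reserveNbrs (R : V → Prop) (S : C → Prop) (B : Finset (Sym2 V)) (U : Finset C)
    (T : Finset V) (a : V) : Finset V :=
  univ.filter fun x => G.Adj a x ∧ R x ∧ S (φ s(a, x)) ∧ x ∉ T ∧ φ s(a, x) ∉ U ∧ s(a, x) ∉ B

lemma reserveNbrs_anti (R : V → Prop) (S : C → Prop) (B : Finset (Sym2 V)) {U U' : Finset C}
    {T T' : Finset V} (a : V) (hU : U ⊆ U') (hT : T ⊆ T') :
    reserveNbrs G φ R S B U' T' a ⊆ reserveNbrs G φ R S B U T a := by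
  intro x hx
  simp only [reserveNbrs, mem_filter, mem_univ, true_and] at hx ⊢
  exact ⟨hx.1, hx.2.1, hx.2.2.1, fun h => hx.2.2.2.1 (hT h), fun h => hx.2.2.2.2.1 (hU h),
    hx.2.2.2.2.2⟩

lemma card_pairs_sym2_mem_le (B : Finset (Sym2 V)) :
    (univ.filter fun p : V × V => s(p.1, p.2) ∈ B).card ≤ 2 * B.card := by
  have : (univ.filter fun p : V × V => s(p.1, p.2) ∈ B) ⊆
      B.biUnion fun e => univ.filter fun p : V × V => s(p.1, p.2) = e := by
    intro p hp
    simpa using hp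
  refine (card_le_card this).trans (card_biUnion_le.trans ?_)
  rw [mul_comm, ← smul_eq_mul]
  refine sum_le_card_nsmul _ _ _ fun e _ => ?_
  induction e with | _ x y
  refine (card_le_card (t := {(x, y), (y, x)}) ?_).trans card_le_two
  rintro ⟨a, b⟩ hp
  simpa [Sym2.eq_iff] using hp

lemma card_pairs_colour_mem_le {K : ℝ}
    (hK : ∀ c, ((univ.filter fun p : V × V => G.Adj p.1 p.2 ∧ φ s(p.1, p.2) = c).card : ℝ) ≤ K)
    (U : Finset C) :
    ((univ.filter fun p : V × V => G.Adj p.1 p.2 ∧ φ s(p.1, p.2) ∈ U).card : ℝ) ≤ K * U.card := by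
  have : (univ.filter fun p : V × V => G.Adj p.1 p.2 ∧ φ s(p.1, p.2) ∈ U) ⊆
      U.biUnion fun c => univ.filter fun p : V × V => G.Adj p.1 p.2 ∧ φ s(p.1, p.2) = c := by
    intro p hp
    simpa [and_comm] using hp
  have h := (card_le_card this).trans card_biUnion_le
  calc _ ≤ ((∑ c ∈ U, (univ.filter fun p : V × V => G.Adj p.1 p.2 ∧ φ s(p.1, p.2) = c).card : ℕ) : ℝ) := by
        exact_mod_cast h
    _ ≤ ∑ c ∈ U, K := by
        push_cast
        exact sum_le_sum fun c _ => hK c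
    _ = K * U.card := by rw [sum_const, nsmul_eq_mul, mul_comm]

lemma sum_card_filter_eq (P : V → V → Prop) [∀ a b, Decidable (P a b)] :
    ∑ v, (univ.filter fun u => P v u).card = (univ.filter fun p : V × V => P p.1 p.2).card := by
  simp only [card_filter, Fintype.sum_prod_type]

lemma card_mul_le_of_few_reserveNbrs {R : V → Prop} {S : C → Prop} {n d η μ θ K m : ℝ}
    (hn : n = Fintype.card V) (hμ : 0 ≤ μ) (hθ : 0 ≤ θ)
    (hdeg : ∀ u, (d - η) * n ≤ (univ.filter fun v => G.Adj u v).card)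
    (hK : ∀ c, ((univ.filter fun p : V × V => G.Adj p.1 p.2 ∧ φ s(p.1, p.2) = c).card : ℝ) ≤ K)
    (h4 : reserveDev G φ μ R S ≤ θ ^ 2 * n ^ 3)
    (B : Finset (Sym2 V)) (U : Finset C) (T : Finset V)
    (hT : 2 * m + T.card ≤ μ * ((d - η) * n)) :
    (univ.filter fun v => ¬ m ≤ (reserveNbrs G φ R S B U T v).card).card * m
      ≤ θ * n ^ 2 + K * U.card + 2 * B.card := by
  have hn0 : 0 ≤ n := by rw [hn]; positivity
  obtain ⟨dev, hdev⟩ : ∃ dev : V → ℝ, ∀ u, dev u =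
      ((univ.filter fun v => G.Adj u v ∧ R v ∧ S (φ s(u, v))).card : ℝ)
        - μ * (univ.filter fun v => G.Adj u v).card := ⟨_, fun _ => rfl⟩
  have hsum : ∑ u, |dev u| ≤ θ * n ^ 2 := by
    refine sum_abs_le_of_card_mul_sum_sq_le _ _ (by positivity) ?_
    rw [card_univ, ← hn]
    have : ∑ u, dev u ^ 2 ≤ θ ^ 2 * n ^ 3 := by simpa only [hdev, reserveDev] using h4
    calc _ ≤ n * (θ ^ 2 * n ^ 3) := mul_le_mul_of_nonneg_left this hn0
      _ = _ := by ring
  have hstep : ∀ v, ((univ.filter fun x => G.Adj v x ∧ R x ∧ S (φ s(v, x))).card : ℝ) ≤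
      (reserveNbrs G φ R S B U T v).card + T.card
        + (univ.filter fun x => G.Adj v x ∧ φ s(v, x) ∈ U).card
        + (univ.filter fun x => s(v, x) ∈ B).card := by
    intro v
    have : (univ.filter fun x => G.Adj v x ∧ R x ∧ S (φ s(v, x))) ⊆
        ((reserveNbrs G φ R S B U T v ∪ T) ∪ (univ.filter fun x => G.Adj v x ∧ φ s(v, x) ∈ U))
          ∪ (univ.filter fun x => s(v, x) ∈ B) := by
      intro x hx
      simp only [reserveNbrs, mem_union, mem_filter, mem_univ, true_and] at hx ⊢
      tauto
    have h1 := (card_le_card this).trans ((card_union_le _ _).trans (Nat.add_le_add_right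
      ((card_union_le _ _).trans (Nat.add_le_add_right (card_union_le _ _) _)) _))
    exact_mod_cast h1
  have hbad : ∀ v ∈ univ.filter (fun v => ¬ m ≤ (reserveNbrs G φ R S B U T v).card),
      m ≤ |dev v| + (univ.filter fun x => G.Adj v x ∧ φ s(v, x) ∈ U).card
        + (univ.filter fun x => s(v, x) ∈ B).card := by
    intro v hv
    rw [mem_filter] at hv
    have h1 := hstep v
    have h2 := hdev v
    have h3 := neg_abs_le (dev v)
    have h4 := mul_le_mul_of_nonneg_left (hdeg v) hμ
    have h5 := not_le.1 hv.2
    linarith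
  calc _ = ∑ v ∈ univ.filter (fun v => ¬ m ≤ (reserveNbrs G φ R S B U T v).card), m := by
        rw [sum_const, nsmul_eq_mul]
    _ ≤ ∑ v ∈ univ.filter (fun v => ¬ m ≤ (reserveNbrs G φ R S B U T v).card),
        (|dev v| + (univ.filter fun x => G.Adj v x ∧ φ s(v, x) ∈ U).card
        + (univ.filter fun x => s(v, x) ∈ B).card) := sum_le_sum hbad
    _ ≤ ∑ v, (|dev v| + (univ.filter fun x => G.Adj v x ∧ φ s(v, x) ∈ U).card
        + (univ.filter fun x => s(v, x) ∈ B).card) :=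
        sum_le_sum_of_subset_of_nonneg (filter_subset _ _) fun _ _ _ => by positivity
    _ = ∑ v, |dev v| + ((univ.filter fun p : V × V => G.Adj p.1 p.2 ∧ φ s(p.1, p.2) ∈ U).card : ℝ)
        + ((univ.filter fun p : V × V => s(p.1, p.2) ∈ B).card : ℝ) := by
        rw [sum_add_distrib, sum_add_distrib,
          ← sum_card_filter_eq (fun v x => G.Adj v x ∧ φ s(v, x) ∈ U),
          ← sum_card_filter_eq (fun v x => s(v, x) ∈ B)]
        push_cast
        rfl
    _ ≤ θ * n ^ 2 + K * U.card + 2 * B.card := by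
        have h1 := card_pairs_colour_mem_le G φ hK U
        have h2 : ((univ.filter fun p : V × V => s(p.1, p.2) ∈ B).card : ℝ) ≤ 2 * B.card := by
          exact_mod_cast card_pairs_sym2_mem_le B
        linarith

lemma card_pairs_le_of_fst {P : V → V → Prop} [∀ a b, Decidable (P a b)] {n b : ℝ} (hn : n = Fintype.card V)
    (h : ∀ x, ((univ.filter fun y => P x y).card : ℝ) ≤ b) :
    ((univ.filter fun p : V × V => P p.1 p.2).card : ℝ) ≤ n * b := by
  rw [← sum_card_filter_eq]
  push_cast
  calc _ ≤ ∑ v : V, b := sum_le_sum fun v _ => h v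
    _ = n * b := by rw [sum_const, card_univ, nsmul_eq_mul, hn]

lemma card_pairs_le_of_snd {P : V → V → Prop} [∀ a b, Decidable (P a b)] {n b : ℝ} (hn : n = Fintype.card V)
    (h : ∀ y, ((univ.filter fun x => P x y).card : ℝ) ≤ b) :
    ((univ.filter fun p : V × V => P p.1 p.2).card : ℝ) ≤ n * b := by
  have h1 := card_pairs_le_of_fst (P := fun y x => P x y) hn h
  have : (univ.filter fun p : V × V => P p.1 p.2).card =
      (univ.filter fun p : V × V => P p.2 p.1).card := by
    refine card_bij (fun p _ => p.swap) ?_ ?_ ?_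
    · intro p hp; simpa using hp
    · intro p _ p' _ h; exact Prod.swap_injective h
    · intro p hp; exact ⟨p.swap, by simpa using hp, by simp⟩
  rw [this]; exact h1

lemma link_of_card_reserveNbrs {R : V → Prop} {S : C → Prop} {n d η γ δ K m : ℝ}
    (hn : n = Fintype.card V) (hd : 0 ≤ d * γ) (hm : 0 ≤ m)
    (hloc : ∀ v c, ((univ.filter fun u => G.Adj v u ∧ φ s(v, u) = c).card : ℝ) ≤ η * n)
    (hK : ∀ c, ((univ.filter fun p : V × V => G.Adj p.1 p.2 ∧ φ s(p.1, p.2) = c).card : ℝ) ≤ K)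
    (hdisc : ∀ X Y : Finset V, d * γ * X.card * Y.card - δ * n ^ 2
      ≤ ((X ×ˢ Y).filter fun p => G.Adj p.1 p.2 ∧ S (φ s(p.1, p.2))).card)
    {B : Finset (Sym2 V)} {U : Finset C} {T : Finset V} {a b : V}
    (ha : m ≤ (reserveNbrs G φ R S B U T a).card) (hb : m ≤ (reserveNbrs G φ R S B U T b).card)
    (hnum : K * U.card + 2 * B.card + 3 * η * n ^ 2 < d * γ * m ^ 2 - δ * n ^ 2) :
    Link G φ R S B U T a b := by
  by_contra hcon
  have hX := hdisc (reserveNbrs G φ R S B U T a) (reserveNbrs G φ R S B U T b)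
  obtain ⟨X, hXdef⟩ : ∃ X, X = reserveNbrs G φ R S B U T a := ⟨_, rfl⟩
  obtain ⟨Y, hYdef⟩ : ∃ Y, Y = reserveNbrs G φ R S B U T b := ⟨_, rfl⟩
  rw [← hXdef] at ha hX
  rw [← hYdef] at hb hX
  have hsub : ((X ×ˢ Y).filter fun p => G.Adj p.1 p.2 ∧ S (φ s(p.1, p.2))) ⊆
      ((((univ.filter fun p : V × V => G.Adj p.1 p.2 ∧ φ s(p.1, p.2) ∈ U)
        ∪ (univ.filter fun p : V × V => s(p.1, p.2) ∈ B))
        ∪ (univ.filter fun p : V × V => G.Adj p.1 p.2 ∧ φ s(p.1, p.2) = φ s(a, p.1)))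
        ∪ (univ.filter fun p : V × V => G.Adj p.2 p.1 ∧ φ s(p.2, p.1) = φ s(b, p.2)))
        ∪ (univ.filter fun p : V × V => G.Adj b p.2 ∧ φ s(b, p.2) = φ s(a, p.1)) := by
    rintro ⟨x, y⟩ hp
    simp only [mem_filter, mem_product, hXdef, hYdef, reserveNbrs, mem_univ, true_and, mem_union] at hp ⊢
    obtain ⟨⟨⟨h1, h2, h3, h4, h5, h6⟩, ⟨k1, k2, k3, k4, k5, k6⟩⟩, hxy, hS⟩ := hp
    by_contra hno
    push Not at hno
    obtain ⟨⟨⟨⟨n1, n2⟩, n3⟩, n4⟩, n5⟩ := hno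
    refine hcon ⟨x, y, ⟨h2, k2, h4, k4, hxy.ne⟩, ⟨h1, hxy, k1.symm⟩, ?_, ?_⟩
    · intro e he
      simp only [List.mem_cons, List.not_mem_nil, or_false] at he
      rcases he with rfl | rfl | rfl
      · exact ⟨h3, h5, h6⟩
      · exact ⟨hS, n1 hxy, n2⟩
      · rw [Sym2.eq_swap]; exact ⟨k3, k5, k6⟩
    · have e1 : φ s(x, y) ≠ φ s(a, x) := n3 hxy
      have e2 : φ s(y, x) ≠ φ s(b, y) := n4 hxy.symm
      have e3 : φ s(b, y) ≠ φ s(a, x) := n5 k1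
      rw [Sym2.eq_swap (a := y) (b := x)] at e2
      simp only [List.map_cons, List.map_nil, List.nodup_cons, List.mem_cons, List.not_mem_nil,
        or_false, not_or, not_false_eq_true, List.nodup_nil, and_true]
      rw [Sym2.eq_swap (a := y) (b := b)]
      exact ⟨⟨e1.symm, e3.symm⟩, e2⟩
  have hc := (card_le_card hsub).trans ((card_union_le _ _).trans (Nat.add_le_add_right
    ((card_union_le _ _).trans (Nat.add_le_add_right ((card_union_le _ _).trans
      (Nat.add_le_add_right (card_union_le _ _) _)) _)) _))
  have hc' : (((X ×ˢ Y).filter fun p => G.Adj p.1 p.2 ∧ S (φ s(p.1, p.2))).card : ℝ) ≤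
      (univ.filter fun p : V × V => G.Adj p.1 p.2 ∧ φ s(p.1, p.2) ∈ U).card
        + (univ.filter fun p : V × V => s(p.1, p.2) ∈ B).card
        + (univ.filter fun p : V × V => G.Adj p.1 p.2 ∧ φ s(p.1, p.2) = φ s(a, p.1)).card
        + (univ.filter fun p : V × V => G.Adj p.2 p.1 ∧ φ s(p.2, p.1) = φ s(b, p.2)).card
        + (univ.filter fun p : V × V => G.Adj b p.2 ∧ φ s(b, p.2) = φ s(a, p.1)).card := by
    exact_mod_cast hc
  have b1 := card_pairs_colour_mem_le G φ hK U
  have b2 : ((univ.filter fun p : V × V => s(p.1, p.2) ∈ B).card : ℝ) ≤ 2 * B.card := by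
    exact_mod_cast card_pairs_sym2_mem_le B
  have b3 := card_pairs_le_of_fst (P := fun x y => G.Adj x y ∧ φ s(x, y) = φ s(a, x)) hn
    fun x => hloc x _
  have b4 := card_pairs_le_of_snd (P := fun x y => G.Adj y x ∧ φ s(y, x) = φ s(b, y)) hn
    fun y => hloc y _
  have b5 := card_pairs_le_of_fst (P := fun x y => G.Adj b y ∧ φ s(b, y) = φ s(a, x)) hn
    fun x => hloc b _
  have b6 : d * γ * m ^ 2 ≤ d * γ * X.card * Y.card := by
    rw [mul_assoc (d * γ), sq]
    exact mul_le_mul_of_nonneg_left (mul_le_mul ha hb hm (by positivity)) hd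
  have b7 : n * (η * n) = η * n ^ 2 := by ring
  rw [b7] at b3 b4 b5
  clear hsub hc hcon hdisc hloc hK hXdef hYdef
  linarith

end Reserve

lemma val_add_one_of_ne_zero {q : ℕ} [NeZero q] (x : ZMod q) (h : x + 1 ≠ 0) :
    (x + 1).val = x.val + 1 := by
  have h1 : x.val + 1 < q := by
    refine lt_of_le_of_ne (Nat.succ_le_of_lt (ZMod.val_lt x)) fun h2 => h ?_
    have h3 : ((x.val + 1 : ℕ) : ZMod q) = 0 := by rw [h2]; simp
    rw [Nat.cast_add, ZMod.natCast_zmod_val, Nat.cast_one] at h3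
    exact h3
  have h4 : x + 1 = ((x.val + 1 : ℕ) : ZMod q) := by
    rw [Nat.cast_add, ZMod.natCast_zmod_val, Nat.cast_one]
  rw [h4, ZMod.val_natCast_of_lt h1]

lemma card_edges_filter_le {V C : Type} {G : SimpleGraph V} {φ : Sym2 V → C} {a b : V} (w : G.Walk a b) (h : (w.edges.map φ).Nodup) (U : Finset C) :
    (w.edges.toFinset.filter fun e => φ e ∈ U).card ≤ U.card := by
  refine card_le_card_of_injOn φ (fun e he => (mem_filter.1 he).2) ?_
  intro x hx y hy hxy
  have hx' := (mem_filter.1 (mem_coe.1 hx)).1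
  have hy' := (mem_filter.1 (mem_coe.1 hy)).1
  exact List.inj_on_of_nodup_map h (List.mem_toFinset.1 hx') (List.mem_toFinset.1 hy') hxy

section Slots
variable {V C : Type} [Fintype V] {G : SimpleGraph V} {φ : Sym2 V → C} {q : ℕ}

lemma SlotFamily.exists_cycles [Nonempty V] [Fact q.Prime] [NeZero q] {s : ℕ} {ρ : V → ZMod q}
    {R : V → Prop} {S : C → Prop} {Mt : ZMod q × Fin s → Finset (V × V)}
    (sf : SlotFamily G φ ρ R S Mt) {k m b : ℕ} {m₀ : ℝ} (hm : 2 ≤ m)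
    (hlink : ∀ (B : Finset (Sym2 V)) (U : Finset C) (T : Finset V), B.card ≤ b → U.card ≤ 3 * k →
      T.card ≤ 2 * k → ∀ x y, m₀ ≤ (reserveNbrs G φ R S B U T x).card →
        m₀ ≤ (reserveNbrs G φ R S B U T y).card → Link G φ R S B U T x y)
    (hgood : ∀ (B : Finset (Sym2 V)) (U : Finset C) (T : Finset V), B.card ≤ b → U.card ≤ 3 * k →
      T.card ≤ 2 * k → m ≤ ((univ.filter fun v => ¬ R v).filter fun v =>
        m₀ ≤ (reserveNbrs G φ R S B U T v).card).card)
    (I₀ : Finset (ZMod q × Fin s)) (hI₀ : ∀ i ∈ I₀, i.1 ≠ 0)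
    (hsize : ∀ i ∈ I₀, (univ.filter fun v => ¬ R v).card ≤ (Mt i).card + k)
    (hb : 3 * (k + 1) * I₀.card ≤ b) :
    ∃ w : ZMod q × Fin s → Σ v, G.Walk v v,
      (∀ i ∈ I₀, (w i).2.IsCycle ∧ ((w i).2.edges.map φ).Nodup ∧ m ≤ (w i).2.length) ∧
      ∀ i ∈ I₀, ∀ j ∈ I₀, i ≠ j → ∀ e ∈ (w i).2.edges, e ∉ (w j).2.edges := by
  suffices H : ∀ J ⊆ I₀, ∃ (w : ZMod q × Fin s → Σ v, G.Walk v v) (B : Finset (Sym2 V)),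
      B.card ≤ 3 * (k + 1) * J.card ∧
      (∀ i ∈ J, (w i).2.IsCycle ∧ ((w i).2.edges.map φ).Nodup ∧ m ≤ (w i).2.length) ∧
      (∀ i ∈ J, ∀ e ∈ (w i).2.edges, (∃ p ∈ Mt i, e = s(p.1, p.2)) ∨ (S (φ e) ∧ e ∈ B)) ∧
      ∀ i ∈ J, ∀ j ∈ J, i ≠ j → ∀ e ∈ (w i).2.edges, e ∉ (w j).2.edges by
    obtain ⟨w, _, _, h1, _, h2⟩ := H I₀ subset_rfl
    exact ⟨w, h1, h2⟩
  intro J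
  induction J using Finset.induction_on with
  | empty =>
    intro _
    exact ⟨fun _ => ⟨Classical.arbitrary V, SimpleGraph.Walk.nil⟩, ∅, by simp, by simp, by simp, by simp⟩
  | insert i J hiJ ih =>
    intro hJ
    obtain ⟨w, B, hB, hw, hwe, hdis⟩ := ih ((subset_insert _ _).trans hJ)
    have hi : i ∈ I₀ := hJ (mem_insert_self _ _)
    have hJI : J.card + 1 ≤ I₀.card := by
      rw [← card_insert_of_notMem hiJ]; exact card_le_card hJ
    have hBb : B.card ≤ b := hB.trans ((Nat.mul_le_mul_left _ (by omega)).trans hb)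
    have hmain : ∀ p ∈ Mt i, G.Adj p.1 p.2 ∧ (ρ p.1 ≠ ρ p.2 ∧ ρ p.2 ≠ 0) ∧ ¬ R p.1 ∧ ¬ R p.2 ∧
        ¬ S (φ s(p.1, p.2)) := fun p hp => by
      simpa [mainPairs] using sf.mem i p hp
    obtain ⟨l, hl1, hl2, hl3, hl4, hl5⟩ := exists_path_partition (G := G)
      (univ.filter fun v => ¬ R v) (fun v => (ρ v * i.1⁻¹).val) (Mt i)
      (fun p hp => by
        obtain ⟨h1, ⟨_, h2⟩, h3, h4, _⟩ := hmain p hp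
        refine ⟨h1, by simpa using h3, by simpa using h4, ?_⟩
        have h5 : ρ p.2 * i.1⁻¹ = ρ p.1 * i.1⁻¹ + 1 := by
          rw [sf.label i p hp, add_mul, mul_inv_cancel₀ (hI₀ i hi)]
        change (ρ p.2 * i.1⁻¹).val = _
        rw [h5]
        refine val_add_one_of_ne_zero _ ?_
        rw [← h5]
        exact mul_ne_zero h2 (inv_ne_zero (hI₀ i hi)))
      (fun p hp p' hp' h => sf.out_inj i p hp p' hp' h)
      (fun p hp p' hp' h => sf.in_inj i p hp p' hp' h)
    have hsz := hsize i hi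
    have hlk : l.length ≤ k := by omega
    obtain ⟨E, hE⟩ : ∃ E : Set (Sym2 V), E = {e | ∃ p ∈ Mt i, e = s(p.1, p.2)} := ⟨_, rfl⟩
    have hEi : Set.InjOn φ E := by
      rw [hE]
      rintro e ⟨p, hp, rfl⟩ e' ⟨p', hp', rfl⟩ h
      rw [sf.colour_inj i p hp p' hp' h]
    have hES : ∀ e ∈ E, ¬ S (φ e) := by
      rw [hE]
      rintro e ⟨p, hp, rfl⟩
      exact (hmain p hp).2.2.2.2
    obtain ⟨c, w', U', h1, h2, h3, h4, h5, h6⟩ := exists_rainbow_cycle (G := G) (φ := φ) (R := R)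
      (S := S) (B := B) (E := E)
      (Good := fun U T v => m₀ ≤ (reserveNbrs G φ R S B U T v).card) (k := k) (m := m)
      (univ.filter fun v => ¬ R v) l hlk hm
      (fun U U' T T' v hU hT h => h.trans (by exact_mod_cast card_le_card (reserveNbrs_anti G φ R S B v hU hT)))
      (fun U T hU hT x y _ _ _ hx hy => hlink B U T hBb hU hT x y hx hy)
      (fun U T hU hT => hgood B U T hBb hU hT) hEi hES (fun v hv => by simpa using hv)
      hl1 (fun x hx f hf => by
        obtain ⟨d, hd, rfl⟩ := List.mem_map.1 hf
        rw [hE]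
        exact ⟨d.toProd, hl4 x hx d hd, rfl⟩) hl3 hl2
    have hEmem : ∀ e ∈ w'.edges, (∃ p ∈ Mt i, e = s(p.1, p.2)) ∨ (S (φ e) ∧ e ∉ B ∧ φ e ∈ U') := by
      intro e he
      rcases h3 e he with h | h
      · rw [hE] at h; exact Or.inl h
      · exact Or.inr ⟨h4 _ h.2, h⟩
    have hcross : ∀ j ∈ J, ∀ e ∈ w'.edges, e ∉ (w j).2.edges := by
      intro j hj e he he'
      have hij : i ≠ j := fun h => hiJ (h ▸ hj)
      rcases hEmem e he with ⟨p, hp, hep⟩ | h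
      · rcases hwe j hj e he' with ⟨p', hp', hep'⟩ | h'
        · exact hij (sf.edge_inj i j p hp p' hp' (hep.symm.trans hep')).1
        · exact (hmain p hp).2.2.2.2 (hep ▸ h'.1)
      · rcases hwe j hj e he' with ⟨p', hp', hep'⟩ | h'
        · have h8 := sf.mem j p' hp'
          simp only [mainPairs, mem_filter] at h8
          exact h8.2.2.2.2.2 (hep' ▸ h.1)
        · exact h.2.1 h'.2
    have hup : ∀ j ∈ J, Function.update w i ⟨c, w'⟩ j = w j := fun j hj =>
      Function.update_of_ne (fun h : j = i => hiJ (h ▸ hj)) _ _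
    refine ⟨Function.update w i ⟨c, w'⟩, B ∪ w'.edges.toFinset.filter fun e => φ e ∈ U', ?_, ?_, ?_, ?_⟩
    · refine (card_union_le _ _).trans ?_
      rw [card_insert_of_notMem hiJ, mul_add]
      exact Nat.add_le_add hB (((card_edges_filter_le w' h2 U').trans h5).trans (by omega))
    · intro j hj
      rcases mem_insert.1 hj with rfl | hj
      · rw [Function.update_self]; exact ⟨h1, h2, h6⟩
      · rw [hup j hj]; exact hw j hj
    · intro j hj e he
      rcases mem_insert.1 hj with rfl | hj
      · rw [Function.update_self] at he
        refine (hEmem e he).imp_right fun h => ⟨h.1, mem_union_right _ ?_⟩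
        rw [mem_filter, List.mem_toFinset]
        exact ⟨he, h.2.2⟩
      · rw [hup j hj] at he
        exact (hwe j hj e he).imp_right fun h => ⟨h.1, mem_union_left _ h.2⟩
    · intro j hj j' hj' hne e he he'
      rcases mem_insert.1 hj with rfl | hk
      · rcases mem_insert.1 hj' with rfl | hk'
        · exact hne rfl
        · rw [Function.update_self] at he
          rw [hup j' hk'] at he'
          exact hcross j' hk' e he he'
      · rcases mem_insert.1 hj' with rfl | hk'
        · rw [Function.update_self] at he'
          rw [hup j hk] at he
          exact hcross j hk e he' he
        · rw [hup j hk] at he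
          rw [hup j' hk'] at he'
          exact hdis j hk j' hk' hne e he he'

end Slots

lemma link_budget {n d γ c β η δ A u b : ℝ} (hn : 0 < n) (hA : 0 < A) (hAc : A ≤ d * γ * c ^ 2)
    (hβ : 96 * β ≤ A) (hη : 12 * η ≤ A) (hδ : 4 * δ ≤ A) (hu : u ≤ 3 * β * n)
    (hb : b ≤ 6 * β * n ^ 2) :
    4 * n * u + 2 * b + 3 * η * n ^ 2 < d * γ * (c * n) ^ 2 - δ * n ^ 2 := by
  have h1 : 4 * n * u ≤ 12 * β * n ^ 2 := by nlinarith
  have hn2 : 0 < n ^ 2 := by positivity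
  have h2 : d * γ * (c * n) ^ 2 = d * γ * c ^ 2 * n ^ 2 := by ring
  have h3 : A * n ^ 2 ≤ d * γ * c ^ 2 * n ^ 2 := mul_le_mul_of_nonneg_right hAc hn2.le
  have h4 : 96 * β * n ^ 2 ≤ A * n ^ 2 := mul_le_mul_of_nonneg_right hβ hn2.le
  have h5 : 12 * η * n ^ 2 ≤ A * n ^ 2 := mul_le_mul_of_nonneg_right hη hn2.le
  have h6 : 4 * δ * n ^ 2 ≤ A * n ^ 2 := mul_le_mul_of_nonneg_right hδ hn2.le
  have h7 : 0 < A * n ^ 2 := by positivity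
  rw [h2]
  linarith

lemma good_budget {n c β δ θ u b x : ℝ} (hn : 0 < n) (hc : 0 < c)
    (hβ : 192 * β ≤ c * δ) (hθ : 8 * θ ≤ c * δ) (hu : u ≤ 3 * β * n) (hb : b ≤ 6 * β * n ^ 2)
    (hx : x * (c * n) ≤ θ * n ^ 2 + 4 * n * u + 2 * b) : x ≤ δ / 4 * n := by
  have h1 : 4 * n * u ≤ 12 * β * n ^ 2 := by nlinarith
  have hn2 : 0 < n ^ 2 := by positivity
  have h2 : 192 * β * n ^ 2 ≤ c * δ * n ^ 2 := mul_le_mul_of_nonneg_right hβ hn2.le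
  have h3 : 8 * θ * n ^ 2 ≤ c * δ * n ^ 2 := mul_le_mul_of_nonneg_right hθ hn2.le
  have h4 : x * (c * n) ≤ δ / 4 * n * (c * n) := by
    have : δ / 4 * n * (c * n) = c * δ * n ^ 2 / 4 := by ring
    rw [this]; linarith
  exact le_of_mul_le_mul_right h4 (by positivity)

lemma coverage_bound {n d d₀ η κ q β δ s t : ℝ} (hd₀ : 0 < d₀) (hd : d₀ ≤ d) (hn : 0 < n)
    (hδ : 0 < δ) (hδ1 : 8 * δ ≤ 1) (hη : η ≤ d₀ * δ) (hκ : 1 - δ ≤ κ ^ 2) (hq : 1 ≤ q * δ)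
    (hβ : β ≤ δ) (hqn : 4 * q ≤ d₀ * δ * n) (hs : d * n * (κ ^ 2 / q) / 2 - 1 ≤ s)
    (ht : (1 - β) * ((q - 1) * s) ≤ t) :
    (1 - 8 * δ) * ((d + η) * n ^ 2) ≤ 2 * (t * ((1 - δ) * n)) := by
  have hd0 : 0 < d := by linarith
  have hq0 : 0 < q := by
    by_contra h
    have := mul_nonneg (by linarith : 0 ≤ -q) hδ.le
    linarith
  have hq1 : 1 ≤ q := by nlinarith
  have hdn : 0 < d * n := by positivity
  -- the rounding term is negligible
  have h1 : (1 - 2 * δ) * (d * n) ≤ 2 * (q * s) := by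
    have e1 : q * (d * n * (κ ^ 2 / q) / 2 - 1) = d * n * κ ^ 2 / 2 - q := by field_simp
    have e2 := mul_le_mul_of_nonneg_left hs hq0.le
    rw [e1] at e2
    have e3 : d * n * (1 - δ) ≤ d * n * κ ^ 2 := mul_le_mul_of_nonneg_left hκ hdn.le
    have e4 : d₀ * (δ * n) ≤ d * (δ * n) := mul_le_mul_of_nonneg_right hd (by positivity)
    linarith
  have hs0 : 0 ≤ q * s := by
    have : 0 ≤ (1 - 2 * δ) * (d * n) := mul_nonneg (by linarith) hdn.le
    linarith
  have h2 : (1 - δ) * (q * s) ≤ (q - 1) * s := by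
    have hs' : 0 ≤ s := by
      by_contra h
      have := mul_pos hq0 (by linarith : 0 < -s)
      linarith
    have : 1 * s ≤ q * δ * s := mul_le_mul_of_nonneg_right hq hs'
    linarith
  have h3 : (1 - δ) * ((1 - δ) * (q * s)) ≤ t := by
    have e0 : 0 ≤ (q - 1) * s := le_trans (mul_nonneg (by linarith) hs0) h2
    calc (1 - δ) * ((1 - δ) * (q * s)) ≤ (1 - δ) * ((q - 1) * s) :=
          mul_le_mul_of_nonneg_left h2 (by linarith)
      _ ≤ (1 - β) * ((q - 1) * s) := mul_le_mul_of_nonneg_right (by linarith) e0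
      _ ≤ t := ht
  have h4 : (1 - δ) ^ 3 * ((1 - 2 * δ) * (d * n)) * n ≤ 2 * (t * ((1 - δ) * n)) := by
    have f1 : 0 ≤ (1 - δ) := by linarith
    have f2 : (1 - δ) ^ 3 * ((1 - 2 * δ) * (d * n)) ≤ (1 - δ) ^ 3 * (2 * (q * s)) :=
      mul_le_mul_of_nonneg_left h1 (by positivity)
    have f3 : (1 - δ) * (2 * ((1 - δ) * ((1 - δ) * (q * s)))) ≤ (1 - δ) * (2 * t) :=
      mul_le_mul_of_nonneg_left (by linarith) f1
    have f4 : (1 - δ) ^ 3 * ((1 - 2 * δ) * (d * n)) ≤ (1 - δ) * (2 * t) := by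
      refine f2.trans (le_trans (le_of_eq ?_) f3); ring
    have := mul_le_mul_of_nonneg_right f4 hn.le
    linarith
  refine le_trans ?_ h4
  have g1 : (d + η) * n ^ 2 ≤ (1 + δ) * (d * n ^ 2) := by
    have : (d + η) ≤ (1 + δ) * d := by nlinarith
    have := mul_le_mul_of_nonneg_right this (by positivity : 0 ≤ n ^ 2)
    linarith
  have g2 : (1 - 8 * δ) * (1 + δ) ≤ (1 - δ) ^ 3 * (1 - 2 * δ) := by
    have : 0 ≤ (1 - δ) := by linarith
    nlinarith [sq_nonneg δ, pow_pos hδ 3, pow_pos hδ 4, mul_pos hδ hδ]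
  calc (1 - 8 * δ) * ((d + η) * n ^ 2) ≤ (1 - 8 * δ) * ((1 + δ) * (d * n ^ 2)) :=
        mul_le_mul_of_nonneg_left g1 (by linarith)
    _ = (1 - 8 * δ) * (1 + δ) * (d * n ^ 2) := by ring
    _ ≤ (1 - δ) ^ 3 * (1 - 2 * δ) * (d * n ^ 2) := mul_le_mul_of_nonneg_right g2 (by positivity)
    _ = _ := by ring

lemma reserve_budget {k I β n : ℝ} (hk : k ≤ β * n) (hβn : 1 ≤ β * n) (hI : I ≤ n) (hI0 : 0 ≤ I) :
    3 * (k + 1) * I ≤ 6 * β * n ^ 2 := by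
  have h1 : 3 * (k + 1) ≤ 6 * (β * n) := by linarith
  calc 3 * (k + 1) * I ≤ 6 * (β * n) * I := mul_le_mul_of_nonneg_right h1 hI0
    _ ≤ 6 * (β * n) * n := mul_le_mul_of_nonneg_left hI (by linarith)
    _ = _ := by ring

lemma SlotFamily.exists_long_cycles {V C : Type} [Fintype V] [Nonempty V] {G : SimpleGraph V}
    {φ : Sym2 V → C} {q : ℕ} [Fact q.Prime] [NeZero q] {s : ℕ} {ρ : V → ZMod q}
    {R : V → Prop} {S : C → Prop} {Mt : ZMod q × Fin s → Finset (V × V)}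
    (sf : SlotFamily G φ ρ R S Mt) {n d d₀ η γ θ β δ δ' c A κ : ℝ} (hn : n = Fintype.card V)
    (hn0 : 0 < n) (hd₀ : 0 < d₀) (hd : d₀ ≤ d) (hd2 : d ≤ 2) (hη1 : η ≤ 1) (hηd : η ≤ d₀ / 2)
    (hloc : ∀ v c, ((univ.filter fun u => G.Adj v u ∧ φ s(v, u) = c).card : ℝ) ≤ η * n)
    (hcol : ∀ c, ((univ.filter fun p : V × V => G.Adj p.1 p.2 ∧ φ s(p.1, p.2) = c).card : ℝ)
        ≤ (1 + η) * d * n)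
    (hdeg : ∀ u, (d - η) * n ≤ (univ.filter fun v => G.Adj u v).card)
    (h4 : reserveDev G φ (γ * γ) R S ≤ θ ^ 2 * n ^ 3)
    (h7 : (((univ.filter fun v => ¬ R v).card : ℝ) - κ * n) ^ 2 ≤ θ ^ 2 * n ^ 2)
    (hdisc : ∀ X Y : Finset V, d * γ * X.card * Y.card - δ' * n ^ 2
      ≤ ((X ×ˢ Y).filter fun p => G.Adj p.1 p.2 ∧ S (φ s(p.1, p.2))).card)
    (hγ : 0 < γ) (hc : c = γ * γ * d₀ / 8) (hA : A = d₀ * γ * c ^ 2) (hβ0 : 0 < β)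
    (hβA : 96 * β ≤ A) (hηA : 12 * η ≤ A) (hδA : 4 * δ' ≤ A) (hβc : 192 * β ≤ c * δ)
    (hθc : 8 * θ ≤ c * δ) (hβc' : β ≤ c) (hβn : 1 ≤ β * n) (hκ : 1 - δ / 2 ≤ κ) (hθ : 0 ≤ θ)
    (hθδ : 4 * θ ≤ δ) (hδn : 1 < (1 - δ) * n)
    (I₀ : Finset (ZMod q × Fin s)) (hI₀ : ∀ i ∈ I₀, i.1 ≠ 0) (hIn : (I₀.card : ℝ) ≤ n)
    (hsize : ∀ i ∈ I₀, ((univ.filter fun v => ¬ R v).card : ℝ) - β * n ≤ (Mt i).card) :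
    ∃ w : ZMod q × Fin s → Σ v, G.Walk v v,
      (∀ i ∈ I₀, (w i).2.IsCycle ∧ ((w i).2.edges.map φ).Nodup ∧
        (1 - δ) * n ≤ (w i).2.length) ∧
      ∀ i ∈ I₀, ∀ j ∈ I₀, i ≠ j → ∀ e ∈ (w i).2.edges, e ∉ (w j).2.edges := by
  have hd0 : 0 < d := hd₀.trans_le hd
  have hc0 : 0 < c := by rw [hc]; positivity
  have hA0 : 0 < A := by rw [hA]; positivity
  have hAd : A ≤ d * γ * c ^ 2 := by
    rw [hA]
    exact mul_le_mul_of_nonneg_right (mul_le_mul_of_nonneg_right hd hγ.le) (by positivity)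
  have hK : ∀ c, ((univ.filter fun p : V × V => G.Adj p.1 p.2 ∧ φ s(p.1, p.2) = c).card : ℝ)
      ≤ 4 * n := by
    intro c
    refine (hcol c).trans (mul_le_mul_of_nonneg_right ?_ hn0.le)
    nlinarith
  obtain ⟨k, hk⟩ : ∃ k : ℕ, k = ⌊β * n⌋₊ := ⟨_, rfl⟩
  have hkn : (k : ℝ) ≤ β * n := by rw [hk]; exact Nat.floor_le (by positivity)
  have hU : ∀ x : ℕ, x ≤ 3 * k → (x : ℝ) ≤ 3 * β * n := by
    intro x hx
    have : (x : ℝ) ≤ 3 * k := by exact_mod_cast hx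
    linarith
  have hT : ∀ x : ℕ, x ≤ 2 * k → (x : ℝ) ≤ 2 * (c * n) := by
    intro x hx
    have : (x : ℝ) ≤ 2 * k := by exact_mod_cast hx
    have := mul_le_mul_of_nonneg_right hβc' hn0.le
    linarith
  have hB : ∀ x : ℕ, x ≤ 3 * (k + 1) * I₀.card → (x : ℝ) ≤ 6 * β * n ^ 2 := by
    intro x hx
    have h1 : (x : ℝ) ≤ 3 * (k + 1) * I₀.card := by exact_mod_cast hx
    exact h1.trans (reserve_budget hkn hβn hIn (by positivity))
  refine Exists.imp (fun w h => ⟨fun i hi => ⟨(h.1 i hi).1, (h.1 i hi).2.1,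
    Nat.ceil_le.1 (h.1 i hi).2.2⟩, h.2⟩) (sf.exists_cycles (k := k) (m := ⌈(1 - δ) * n⌉₊)
    (b := 3 * (k + 1) * I₀.card) (m₀ := c * n) (Nat.lt_ceil.2 (by simpa using hδn)) ?_ ?_ I₀ hI₀ ?_ le_rfl)
  · intro B U T hBc hUc hTc x y hx hy
    refine link_of_card_reserveNbrs G φ hn (d := d) (γ := γ) (δ := δ') (K := 4 * n) (by positivity)
      (by positivity) hloc hK hdisc hx hy ?_
    exact link_budget hn0 hA0 hAd hβA hηA hδA (hU _ hUc) (hB _ hBc)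
  · intro B U T hBc hUc hTc
    have h1 := card_mul_le_of_few_reserveNbrs G φ (m := c * n) hn (mul_self_nonneg γ) hθ hdeg hK h4 B U T (by
      have e1 := hT _ hTc
      have e2 : γ * γ * (d₀ / 2 * n) ≤ γ * γ * ((d - η) * n) := by
        refine mul_le_mul_of_nonneg_left (mul_le_mul_of_nonneg_right ?_ hn0.le) (mul_self_nonneg γ)
        linarith
      have e3 : 4 * (c * n) = γ * γ * (d₀ / 2 * n) := by rw [hc]; ring
      linarith)
    have h2 := good_budget hn0 hc0 hβc hθc (hU _ hUc) (hB _ hBc) h1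
    refine Nat.ceil_le.2 ?_
    have h3 : (univ.filter fun v => ¬ R v).card ≤
        ((univ.filter fun v => ¬ R v).filter fun v =>
          c * n ≤ (reserveNbrs G φ R S B U T v).card).card
        + (univ.filter fun v => ¬ c * n ≤ (reserveNbrs G φ R S B U T v).card).card := by
      rw [← card_filter_add_card_filter_not (s := univ.filter fun v => ¬ R v)
        (fun v => c * n ≤ (reserveNbrs G φ R S B U T v).card)]
      refine Nat.add_le_add_left (card_le_card fun v hv => ?_) _
      rw [mem_filter] at hv ⊢
      exact ⟨mem_univ _, hv.2⟩
    have h3' : ((univ.filter fun v => ¬ R v).card : ℝ) ≤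
        ((univ.filter fun v => ¬ R v).filter fun v =>
          c * n ≤ (reserveNbrs G φ R S B U T v).card).card
        + (univ.filter fun v => ¬ c * n ≤ (reserveNbrs G φ R S B U T v).card).card := by
      exact_mod_cast h3
    have h5 : κ * n - θ * n ≤ ((univ.filter fun v => ¬ R v).card : ℝ) := by
      have h51 : (((univ.filter fun v => ¬ R v).card : ℝ) - κ * n) ^ 2 ≤ (θ * n) ^ 2 := by
        rw [mul_pow]; exact h7
      have := (abs_le_of_sq_le_sq' h51 (mul_nonneg hθ hn0.le)).1
      linarith
    have h6 := mul_le_mul_of_nonneg_right hκ hn0.le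
    have h8 := mul_le_mul_of_nonneg_right hθδ hn0.le
    have h9 : (1 - δ / 2) * n = n - δ * n / 2 := by ring
    have h10 : (1 - δ) * n = n - δ * n := by ring
    have h11 : δ / 4 * n = δ * n / 4 := by ring
    rw [h10]
    linarith
  · intro i hi
    have h1 := hsize i hi
    have h2 : ((univ.filter fun v => ¬ R v).card : ℝ) - (Mt i).card ≤ β * n := by linarith
    have h3 : (univ.filter fun v => ¬ R v).card - (Mt i).card ≤ k := by
      rw [hk]
      refine Nat.le_floor ?_
      rcases le_total (univ.filter fun v => ¬ R v).card (Mt i).card with h | h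
      · rw [Nat.sub_eq_zero_of_le h]; simp; positivity
      · rw [Nat.cast_sub h]; exact h2
    omega

lemma exists_pos_le_of_pos (l : List ℝ) (h : ∀ x ∈ l, 0 < x) : ∃ y : ℝ, 0 < y ∧ ∀ x ∈ l, y ≤ x := by
  induction l with
  | nil => exact ⟨1, one_pos, by simp⟩
  | cons a l ih =>
    obtain ⟨y, hy, hyl⟩ := ih fun x hx => h x (List.mem_cons_of_mem _ hx)
    refine ⟨min a y, lt_min (h a (by simp)) hy, fun x hx => ?_⟩
    rcases List.mem_cons.1 hx with rfl | hx
    · exact min_le_left _ _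
    · exact (min_le_right _ _).trans (hyl x hx)

lemma card_slots_le {q s : ℕ} [NeZero q] {n d κ : ℝ} (hn : 0 < n) (hd2 : d ≤ 2) (hκ : 0 ≤ κ)
    (hκ1 : κ ≤ 1) (hs : 2 * (s : ℝ) ≤ d * n * (κ ^ 2 / q)) (I : Finset (ZMod q × Fin s)) :
    (I.card : ℝ) ≤ n := by
  have hq0 : (0 : ℝ) < q := by exact_mod_cast Nat.pos_of_ne_zero (NeZero.ne q)
  have h1 : I.card ≤ q * s := (card_le_univ I).trans (by simp [Fintype.card_prod, ZMod.card])
  have h2 : (I.card : ℝ) ≤ q * s := by exact_mod_cast h1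
  have h3 := mul_le_mul_of_nonneg_left hs hq0.le
  have h4 : q * (d * n * (κ ^ 2 / q)) = d * n * κ ^ 2 := by field_simp
  have h5 : d * n * κ ^ 2 ≤ 2 * n * 1 :=
    mul_le_mul (mul_le_mul_of_nonneg_right hd2 hn.le) (pow_le_one₀ hκ hκ1) (by positivity)
      (by positivity)
  rw [h4] at h3
  linarith

set_option maxHeartbeats 2000000 in
theorem exists_cycle_family {α d₀ : ℝ} (hα : 0 < α) (hα1 : α ≤ 1 / 2) (hd₀ : 0 < d₀) :
    ∃ η : ℝ, 0 < η ∧ η ≤ 1 ∧ ∃ n₀ : ℕ, ∀ (V C : Type) [Fintype V] [Fintype C] (G : SimpleGraph V)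
      (φ : Sym2 V → C) (n d : ℝ), n = Fintype.card V → n₀ ≤ n → d₀ ≤ d → d ≤ 2 →
      (∀ v c, ((univ.filter fun u => G.Adj v u ∧ φ s(v, u) = c).card : ℝ) ≤ η * n) →
      (∀ u, (d - η) * n ≤ (univ.filter fun v => G.Adj u v).card) →
      (∀ u, ((univ.filter fun v => G.Adj u v).card : ℝ) ≤ (d + η) * n) →
      (∀ c, ((univ.filter fun p : V × V => G.Adj p.1 p.2 ∧ φ s(p.1, p.2) = c).card : ℝ)
        ≤ (1 + η) * d * n) →
      (((univ.filter fun p : V × V => (d ^ 2 + η) * n <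
        (univ.filter fun w => G.Adj p.1 w ∧ G.Adj p.2 w).card).card : ℝ) ≤ 3 * η * n ^ 2) →
      ∃ (t : ℕ) (v : Fin t → V) (w : ∀ i, G.Walk (v i) (v i)),
        (∀ i, (w i).IsCycle) ∧ (∀ i, ((w i).edges.map φ).Nodup) ∧
        (∀ i, (1 - α) * n ≤ (w i).length) ∧
        (∀ i j, i ≠ j → ∀ e ∈ (w i).edges, e ∉ (w j).edges) ∧
        (1 - α) * (univ.filter fun p : V × V => G.Adj p.1 p.2).card ≤ 2 * ∑ i, ((w i).length : ℝ) := by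
  obtain ⟨δ, hδ⟩ : ∃ δ, δ = α / 8 := ⟨_, rfl⟩
  have hδ0 : 0 < δ := by rw [hδ]; positivity
  have hδ1 : 16 * δ ≤ 1 := by rw [hδ]; linarith
  obtain ⟨L, hL⟩ := exists_nat_ge (2 / δ)
  have hL0 : (0 : ℝ) < L := lt_of_lt_of_le (by positivity) hL
  have : NeZero L := ⟨by rintro rfl; simp at hL0⟩
  obtain ⟨γ, hγ⟩ : ∃ γ : ℝ, γ = 1 / L := ⟨_, rfl⟩
  have hγ0 : 0 < γ := by rw [hγ]; positivity
  have hγδ : γ ≤ δ / 2 := by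
    rw [hγ, div_le_iff₀ hL0]
    rw [div_le_iff₀ hδ0] at hL
    linarith
  obtain ⟨c, hc⟩ : ∃ c, c = γ * γ * d₀ / 8 := ⟨_, rfl⟩
  have hc0 : 0 < c := by rw [hc]; positivity
  obtain ⟨A, hA⟩ : ∃ A, A = d₀ * γ * c ^ 2 := ⟨_, rfl⟩
  have hA0 : 0 < A := by rw [hA]; positivity
  obtain ⟨β, hβ0, hβ⟩ := exists_pos_le_of_pos [1, δ, A / 96, c * δ / 192, c]
    (by simp only [List.mem_cons, List.not_mem_nil, or_false]
        rintro x (rfl | rfl | rfl | rfl | rfl) <;> positivity)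
  simp only [List.forall_mem_cons, List.not_mem_nil, IsEmpty.forall_iff, implies_true, and_true] at hβ
  obtain ⟨hβ1, hβδ, hβA, hβc, hβc'⟩ := hβ
  obtain ⟨N, hN⟩ := exists_nat_ge (8 / β ^ 2 + 1 / δ)
  obtain ⟨q, hqN, hqp⟩ := Nat.exists_infinite_primes N
  have : Fact q.Prime := ⟨hqp⟩
  have : NeZero q := ⟨hqp.ne_zero⟩
  have hqr : 8 / β ^ 2 + 1 / δ ≤ q := hN.trans (by exact_mod_cast hqN)
  have hq0 : (0 : ℝ) < q := by exact_mod_cast hqp.pos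
  have hqβ : 8 / β ^ 2 ≤ q := by linarith [show 0 < 1 / δ by positivity]
  have hqδ : 1 ≤ q * δ := by
    rw [← div_le_iff₀ hδ0]
    linarith [show 0 < 8 / β ^ 2 by positivity]
  obtain ⟨θ₀, hθ₀, hslot⟩ := exists_slotFamily hβ0 hβ1 hd₀ q hqp.two_le hqβ
  obtain ⟨θ, hθ0, hθ⟩ := exists_pos_le_of_pos [θ₀, δ / 4, c * δ / 8, A ^ 2 / 320]
    (by simp only [List.mem_cons, List.not_mem_nil, or_false]
        rintro x (rfl | rfl | rfl | rfl) <;> positivity)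
  simp only [List.forall_mem_cons, List.not_mem_nil, IsEmpty.forall_iff, implies_true, and_true] at hθ
  obtain ⟨hθθ₀, hθδ, hθc, hθA⟩ := hθ
  obtain ⟨η, hη0, hη⟩ := exists_pos_le_of_pos [1, θ, θ ^ 2 / (17 * (q : ℝ) ^ 4), d₀ / 2, d₀ * δ, A / 12]
    (by simp only [List.mem_cons, List.not_mem_nil, or_false]
        rintro x (rfl | rfl | rfl | rfl | rfl | rfl) <;> positivity)
  simp only [List.forall_mem_cons, List.not_mem_nil, IsEmpty.forall_iff, implies_true, and_true] at hη
  obtain ⟨hη1, hηθ, hηq, hηd, hηδ, hηA⟩ := hη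
  rw [le_div_iff₀ (by positivity)] at hηq
  obtain ⟨n₀, hn₀⟩ := exists_nat_ge (2 / η + 1 / β + 4 * q / (d₀ * δ))
  refine ⟨η, hη0, hη1, n₀, ?_⟩
  intro V C _ _ G φ n d hn hnn hd hd2 hloc hdeg hdeg' hcol hcodeg
  have hnn' := hn₀.trans hnn
  have p1 : 0 < 2 / η := by positivity
  have p2 : 0 < 1 / β := by positivity
  have p3 : 0 < 4 * q / (d₀ * δ) := by positivity
  have hn0 : 0 < n := by linarith
  have hηn : 2 ≤ η * n := by
    rw [mul_comm, ← div_le_iff₀ hη0]; linarith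
  have hβn : 1 ≤ β * n := by
    rw [mul_comm, ← div_le_iff₀ hβ0]; linarith
  have hqn : 4 * q ≤ d₀ * δ * n := by
    rw [mul_comm (d₀ * δ), ← div_le_iff₀ (by positivity)]; linarith
  have hd0 : 0 < d := hd₀.trans_le hd
  have hV : 0 < Fintype.card V := by
    rw [hn] at hn0; exact_mod_cast hn0
  have : Nonempty V := Fintype.card_pos_iff.1 hV
  have hn2 : 2 ≤ n := hηn.trans ((mul_le_mul_of_nonneg_right hη1 hn0.le).trans_eq (one_mul n))
  obtain ⟨κ, hκ⟩ : ∃ κ : ℝ, κ = 1 - 1 / L := ⟨_, rfl⟩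
  have hκγ : κ = 1 - γ := by rw [hκ, hγ]
  have hκ1 : κ ≤ 1 := by linarith
  have hκh : 1 / 2 ≤ κ := by linarith
  have hκ0 : 0 ≤ κ := by linarith
  have hδn : 1 < (1 - δ) * n := by
    have := mul_le_mul_of_nonneg_right hδ1 hn0.le
    linarith [sub_mul 1 δ n, mul_assoc 16 δ n]
  have hκδ : 1 - δ ≤ κ ^ 2 := by rw [hκγ]; linarith [sq_nonneg γ, sub_sq (1 : ℝ) γ]
  obtain ⟨ρ, R, S, h1, h2, h3, h4, h5, h6, h7⟩ :=
    exists_labelling G φ q L (M := η * n) (by linarith) hV hloc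
  rw [← hn] at h1 h2 h3 h4 h5 h6 h7
  rw [← hκ] at h1 h2 h3 h7
  rw [← hγ] at h4 h5 h6
  have up : ∀ k : ℕ, 17 * (q : ℝ) ^ 4 * (η * n) * n ^ k ≤ θ ^ 2 * n ^ (k + 1) := by
    intro k
    have := mul_le_mul_of_nonneg_right hηq (by positivity : 0 ≤ n ^ (k + 1))
    refine le_trans (le_of_eq ?_) this
    ring
  have h7' : (((univ.filter fun v => ¬ R v).card : ℝ) - κ * n) ^ 2 ≤ θ ^ 2 * n ^ 2 := by
    refine h7.trans (le_trans (le_of_eq ?_) (up 1)); ring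
  obtain ⟨a, ha⟩ : ∃ a : ℕ, a = (univ.filter fun p : V × V => G.Adj p.1 p.2).card := ⟨_, rfl⟩
  have hasum : (a : ℝ) = ∑ u, ((univ.filter fun v => G.Adj u v).card : ℝ) := by
    rw [ha, ← Nat.cast_sum]; exact congrArg _ (sum_card_filter_eq G.Adj).symm
  have ha1 : (d - η) * n ^ 2 ≤ a := by
    rw [hasum]
    have : ∑ _u : V, (d - η) * n = (d - η) * n ^ 2 := by
      rw [sum_const, card_univ, nsmul_eq_mul, ← hn]; ring
    rw [← this]
    exact sum_le_sum fun u _ => hdeg u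
  have ha2 : a ≤ (d + η) * n ^ 2 := by
    rw [hasum]
    have : ∑ _u : V, (d + η) * n = (d + η) * n ^ 2 := by
      rw [sum_const, card_univ, nsmul_eq_mul, ← hn]; ring
    rw [← this]
    exact sum_le_sum fun u _ => hdeg' u
  obtain ⟨s, hs⟩ : ∃ s : ℕ, s = ⌊d * n * (κ ^ 2 / q) / 2⌋₊ := ⟨_, rfl⟩
  have hs1 : 2 * (s : ℝ) ≤ d * n * (κ ^ 2 / q) := by
    have : (s : ℝ) ≤ d * n * (κ ^ 2 / q) / 2 := by rw [hs]; exact Nat.floor_le (by positivity)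
    linarith
  have hs2 : d * n * (κ ^ 2 / q) / 2 - 1 ≤ s := by
    rw [hs]; linarith [Nat.lt_floor_add_one (d * n * (κ ^ 2 / q) / 2)]
  obtain ⟨Mt, I₀, sf, hI₀, hIc, hsize⟩ := hslot V C G φ s ρ R S n d κ η θ hn0 hd hκh hκ1 hη0 hηθ hθθ₀
    hηn hs1 hloc hdeg' hcol (by rw [← ha]; exact ha1) (h1.trans (up 2)) (h2.trans (up 2))
    (h3.trans (up 3)) h7'
  have hsqrt : 4 * Real.sqrt (20 * θ) ≤ A := by
    have : Real.sqrt (20 * θ) ≤ A / 4 := by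
      rw [Real.sqrt_le_left (by positivity)]
      have : (A / 4) ^ 2 = A ^ 2 / 16 := by ring
      rw [this]; linarith
    linarith
  have hdisc := discrepancy G φ (S := S) (γ := γ) hn hn0 hd0.le hd2 hη0.le hηθ hγ0.le (by linarith) hloc hdeg
    hcodeg (h5.trans (up 2)) (h6.trans (up 3))
  obtain ⟨w, hw, hdis⟩ := sf.exists_long_cycles hn hn0 hd₀ hd hd2 hη1 hηd hloc hcol hdeg
    (h4.trans (up 2)) h7' hdisc hγ0 hc hA hβ0 (by linarith) (by linarith) hsqrt (by linarith)
    (by linarith) hβc' hβn (by linarith) hθ0.le (by linarith) (δ := δ) hδn I₀ hI₀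
    (card_slots_le hn0 hd2 hκ0 hκ1 hs1 I₀) hsize
  have hcov := coverage_bound (η := η) hd₀ hd hn0 hδ0 (by linarith) hηδ hκδ hqδ hβδ hqn hs2 hIc
  have hαδ : 8 * δ = α := by rw [hδ]; ring
  obtain ⟨e⟩ : Nonempty (Fin I₀.card ≃ I₀) := ⟨I₀.equivFin.symm⟩
  refine ⟨I₀.card, fun i => (w (e i)).1, fun i => (w (e i)).2, fun i => (hw _ (e i).2).1,
    fun i => (hw _ (e i).2).2.1, fun i => ?_, fun i j hij => ?_, ?_⟩
  · refine le_trans (mul_le_mul_of_nonneg_right ?_ hn0.le) (hw _ (e i).2).2.2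
    linarith
  · exact hdis _ (e i).2 _ (e j).2 fun h => hij (e.injective (Subtype.ext h))
  · rw [← ha]
    have hsum : (I₀.card : ℝ) * ((1 - δ) * n) ≤ ∑ i : Fin I₀.card, ((w (e i)).2.length : ℝ) := by
      calc (I₀.card : ℝ) * ((1 - δ) * n) = ∑ _i : Fin I₀.card, (1 - δ) * n := by simp
        _ ≤ _ := sum_le_sum fun i _ => (hw _ (e i).2).2.2
    rw [← hαδ]
    calc (1 - 8 * δ) * (a : ℝ) ≤ (1 - 8 * δ) * ((d + η) * n ^ 2) :=
          mul_le_mul_of_nonneg_left ha2 (by linarith)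
      _ ≤ 2 * (I₀.card * ((1 - δ) * n)) := hcov
      _ ≤ _ := by linarith

lemma ncard_setOf_eq {α : Type} [Fintype α] (P : α → Prop) [DecidablePred P] :
    ({x | P x} : Set α).ncard = (univ.filter P).card := by
  rw [← Set.ncard_coe_finset]
  congr 1
  ext
  simp

lemma card_adj_pairs_eq {V : Type} [Fintype V] (G : SimpleGraph V) :
    (univ.filter fun p : V × V => G.Adj p.1 p.2).card = 2 * G.edgeSet.ncard := by
  rw [← sum_card_filter_eq G.Adj, ← SimpleGraph.coe_edgeFinset G, Set.ncard_coe_finset,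
    ← G.sum_degrees_eq_twice_card_edges]
  refine sum_congr rfl fun v _ => ?_
  rw [← G.card_neighborFinset_eq_degree, G.neighborFinset_eq_filter]

lemma ncard_edgeSet_diff_add_sum_length {V : Type} [Fintype V] {G : SimpleGraph V} {t : ℕ}
    {v : Fin t → V} (w : ∀ i, G.Walk (v i) (v i)) (hw : ∀ i, (w i).IsCycle)
    (hdis : ∀ i j, i ≠ j → ∀ e ∈ (w i).edges, e ∉ (w j).edges) :
    (G.edgeSet \ ⋃ i, {e | e ∈ (w i).edges}).ncard + ∑ i, (w i).length = G.edgeSet.ncard := by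
  have hU : (⋃ i, {e | e ∈ (w i).edges}) =
      ((univ.biUnion fun i => (w i).edges.toFinset : Finset (Sym2 V)) : Set (Sym2 V)) := by
    ext e
    simp
  have hcard : (univ.biUnion fun i => (w i).edges.toFinset).card = ∑ i, (w i).length := by
    rw [card_biUnion]
    · refine sum_congr rfl fun i _ => ?_
      rw [List.toFinset_card_of_nodup (hw i).isTrail.edges_nodup, SimpleGraph.Walk.length_edges]
    · intro i _ j _ hij
      change Disjoint _ _
      rw [Finset.disjoint_left]
      intro e he
      simp only [List.mem_toFinset] at he ⊢
      exact hdis i j hij e he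
  have hsub : (⋃ i, {e | e ∈ (w i).edges}) ⊆ G.edgeSet :=
    Set.iUnion_subset fun i e he => (w i).edges_subset_edgeSet he
  rw [← hcard, ← Set.ncard_coe_finset, ← hU]
  exact Set.ncard_sdiff_add_ncard_of_subset hsub (Set.toFinite _)

lemma card_pairs_le_of_gBounded {V C : Type} [Fintype V] {G : SimpleGraph V} {φ : Sym2 V → C}
    {g : ℝ} (h : GBounded G φ g) (c : C) :
    ((univ.filter fun p : V × V => G.Adj p.1 p.2 ∧ φ s(p.1, p.2) = c).card : ℝ) ≤ 2 * g := by
  have h1 := card_pairs_sym2_mem_le (univ.filter fun e => e ∈ G.edgeSet ∧ φ e = c)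
  have h2 : ((univ.filter fun e => e ∈ G.edgeSet ∧ φ e = c).card : ℝ) ≤ g := by
    simpa only [colourCls, ncard_setOf_eq] using h c
  simp only [mem_filter, mem_univ, true_and, SimpleGraph.mem_edgeSet] at h1
  have h3 : ((univ.filter fun p : V × V => G.Adj p.1 p.2 ∧ φ s(p.1, p.2) = c).card : ℝ) ≤
      2 * (univ.filter fun e => e ∈ G.edgeSet ∧ φ e = c).card := by exact_mod_cast h1
  linarith

lemma quasirandom_abs_degree_sub_le {V : Type} [Fintype V] {G : SimpleGraph V} {ε d n : ℝ}
    (h : Quasirandom G ε d) (hn : n = Fintype.card V) (u : V) :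
    |((univ.filter fun v => G.Adj u v).card : ℝ) - d * n| ≤ ε * n := by
  have := h.1 u (Set.mem_univ u)
  rw [degIn, Set.inter_univ, Set.ncard_univ, Nat.card_eq_fintype_card, ← hn] at this
  rwa [← ncard_setOf_eq]

lemma quasirandom_card_codegree_le {V : Type} [Fintype V] {G : SimpleGraph V} {ε d n : ℝ}
    (h : Quasirandom G ε d) (hn : n = Fintype.card V) (hn0 : 0 ≤ n) (hεn : 1 ≤ ε * n) :
    ((univ.filter fun p : V × V => (d ^ 2 + ε) * n <
      (univ.filter fun w => G.Adj p.1 w ∧ G.Adj p.2 w).card).card : ℝ) ≤ 3 * ε * n ^ 2 := by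
  have h1 := h.2
  rw [Set.ncard_univ, Nat.card_eq_fintype_card, ← hn, ncard_setOf_eq] at h1
  obtain ⟨B, hB⟩ : ∃ B : Finset (Sym2 V), B = univ.filter fun p => ∃ u v, p = s(u, v) ∧ u ≠ v ∧
      u ∈ Set.univ ∧ v ∈ Set.univ ∧ ¬ (|(codegIn G u v Set.univ : ℝ) - d ^ 2 * n| ≤ ε * n) :=
    ⟨_, rfl⟩
  rw [← hB] at h1
  have h2 : (univ.filter fun p : V × V => (d ^ 2 + ε) * n <
      (univ.filter fun w => G.Adj p.1 w ∧ G.Adj p.2 w).card) ⊆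
      (univ.filter fun p : V × V => s(p.1, p.2) ∈ B) ∪ univ.diag := by
    rintro ⟨x, y⟩ hp
    rw [mem_filter] at hp
    rw [mem_union, mem_filter, mem_diag]
    by_cases hxy : x = y
    · exact Or.inr ⟨mem_univ _, hxy⟩
    · refine Or.inl ⟨mem_univ _, ?_⟩
      rw [hB, mem_filter]
      refine ⟨mem_univ _, x, y, rfl, hxy, Set.mem_univ _, Set.mem_univ _, fun hle => ?_⟩
      have h3 := (abs_le.1 hle).2
      have h4 : codegIn G x y Set.univ = (univ.filter fun w => G.Adj x w ∧ G.Adj y w).card := by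
        rw [codegIn, Set.inter_univ, ← ncard_setOf_eq]
        rfl
      rw [h4] at h3
      have h5 := hp.2
      simp only at h5
      linarith [add_mul (d ^ 2) ε n]
  have h3 := (card_le_card h2).trans (card_union_le _ _)
  have h4 := card_pairs_sym2_mem_le B
  rw [diag_card, card_univ] at h3
  have h5 : ((univ.filter fun p : V × V => (d ^ 2 + ε) * n <
      (univ.filter fun w => G.Adj p.1 w ∧ G.Adj p.2 w).card).card : ℝ) ≤ 2 * B.card + n := by
    rw [hn] at h3 ⊢
    exact_mod_cast h3.trans (Nat.add_le_add_right h4 _)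
  have h6 : n ≤ ε * n ^ 2 := by
    have := mul_le_mul_of_nonneg_right hεn hn0
    linarith [pow_two n, mul_assoc ε n n]
  linarith

end RainbowCycles

/-- Theorem 1.5: approximate decomposition of a quasirandom graph into rainbow
almost-spanning cycles. -/
theorem stmt_4 :
    ∀ α d₀ : ℝ, 0 < α → 0 < d₀ →
    ∃ η : ℝ, 0 < η ∧ ∃ n₀ : ℕ, ∀ n : ℕ, n₀ ≤ n → ∀ d : ℝ, d₀ ≤ d →
    ∀ G : SimpleGraph (Fin n), Quasirandom G η d →
    ∀ φ : Sym2 (Fin n) → ℕ,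
      GBounded G φ ((1 + η) * d * n / 2) →
      LBounded G φ (η * n) →
      ∃ (t : ℕ) (v : Fin t → Fin n) (w : ∀ i : Fin t, G.Walk (v i) (v i)),
        (∀ i, (w i).IsCycle) ∧
        (∀ i, ((w i).edges.map φ).Nodup) ∧
        (∀ i, (1 - α) * n ≤ ((w i).length : ℝ)) ∧
        (∀ i j, i ≠ j → ∀ e ∈ (w i).edges, e ∉ (w j).edges) ∧
        ((G.edgeSet \ ⋃ i, {e | e ∈ (w i).edges}).ncard : ℝ)
          ≤ α * (G.edgeSet.ncard : ℝ) := by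
  classical
  intro α d₀ hα hd₀
  obtain ⟨η, hη0, hη1, n₀, H⟩ := RainbowCycles.exists_cycle_family (α := min α (1 / 2))
    (lt_min hα (by norm_num)) (min_le_right _ _) hd₀
  obtain ⟨m, hm⟩ := exists_nat_ge (1 / η)
  refine ⟨η, hη0, max n₀ m, fun n hn d hd G hG φ hφ hloc => ?_⟩
  have hηn : 1 ≤ η * (n : ℝ) := by
    rw [mul_comm, ← div_le_iff₀ hη0]
    exact hm.trans (by exact_mod_cast (le_max_right _ _).trans hn)
  have hn0 : (0 : ℝ) < n := pos_of_mul_pos_right (one_pos.trans_le hηn) hη0.le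
  have hcard : (n : ℝ) = Fintype.card (Fin n) := by rw [Fintype.card_fin]
  have hdeg := RainbowCycles.quasirandom_abs_degree_sub_le hG hcard
  have hd2 : d ≤ 2 := by
    obtain ⟨u⟩ : Nonempty (Fin n) := ⟨⟨0, by exact_mod_cast hn0⟩⟩
    have h1 := (abs_le.1 (hdeg u)).1
    have h2 : ((Finset.univ.filter fun v => G.Adj u v).card : ℝ) ≤ n := by
      rw [hcard]
      exact_mod_cast Finset.card_le_univ _
    refine le_of_mul_le_mul_right ?_ hn0
    linarith [mul_le_mul_of_nonneg_right hη1 hn0.le]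
  have : Fintype (Set.range φ) := Fintype.ofFinite _
  obtain ⟨ψ, hψ⟩ : ∃ ψ : Sym2 (Fin n) → Set.range φ, ∀ e, (ψ e : ℕ) = φ e :=
    ⟨fun e => ⟨φ e, Set.mem_range_self e⟩, fun _ => rfl⟩
  have hψe : ∀ e c, ψ e = c ↔ φ e = c := fun e c => by rw [← hψ, Subtype.ext_iff]
  obtain ⟨t, v, w, h1, h2, h3, h4, h5⟩ := H (Fin n) (Set.range φ) G ψ n d hcard
    (by exact_mod_cast (le_max_left _ _).trans hn) hd hd2
    (fun v c => by
      refine le_trans (le_of_eq ?_) (hloc v c)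
      rw [← RainbowCycles.ncard_setOf_eq]
      simp only [hψe])
    (fun u => by linarith [(abs_le.1 (hdeg u)).1, sub_mul d η (n : ℝ)])
    (fun u => by linarith [(abs_le.1 (hdeg u)).2, add_mul d η (n : ℝ)])
    (fun c => by
      refine le_trans (le_of_eq ?_)
        ((RainbowCycles.card_pairs_le_of_gBounded hφ c).trans_eq (by ring))
      rw [← RainbowCycles.ncard_setOf_eq, ← RainbowCycles.ncard_setOf_eq]
      simp only [hψe])
    (RainbowCycles.quasirandom_card_codegree_le hG hcard hn0.le hηn)
  refine ⟨t, v, w, h1, fun i => ?_, fun i => ?_, h4, ?_⟩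
  · have h := (h2 i).map Subtype.val_injective
    rw [List.map_map] at h
    exact (List.map_congr_left fun e _ => hψ e) ▸ h
  · refine le_trans (mul_le_mul_of_nonneg_right ?_ hn0.le) (h3 i)
    linarith [min_le_left α (1 / 2)]
  · have h6 := RainbowCycles.ncard_edgeSet_diff_add_sum_length w h1 h4
    have h7 : ((G.edgeSet \ ⋃ i, {e | e ∈ (w i).edges}).ncard : ℝ) + ∑ i, ((w i).length : ℝ) =
        G.edgeSet.ncard := by exact_mod_cast h6
    rw [RainbowCycles.card_adj_pairs_eq] at h5
    push_cast at h5
    have h8 := mul_le_mul_of_nonneg_right (min_le_left α (1 / 2))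
      (Nat.cast_nonneg (α := ℝ) G.edgeSet.ncard)
    linarith [sub_mul 1 (min α (1 / 2)) (G.edgeSet.ncard : ℝ)]
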